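/- Let (C,u) be a ℤ-valued field of mixed characteristic with uniformizer p = char(Cu) (i.e. unramified), and let (K,v) and (L,w) be henselian valued field extensions of (C,u) in which p is still a uniformizer, such that the residue field extension Kv/Cu is separable. If Th_∃(Kv,Cu) ⊆ Th_∃(Lw,Cu) (as L_ring(Cu)-theories), then Th_∃(K,v,C) ⊆ Th_∃(L,w,C) (as L_val(C)-theories). -/

import Mathlib

open FirstOrder FirstOrder.Language

universe u v w x

namespace Paper



/-! ### Syntactic fragments -/

/-- `IsExistsN n φ`: `φ` is an `∃_n`-formula, i.e. of the form `∃ x₁ … x_m ψ`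
with `m ≤ n` and `ψ` quantifier-free. -/
inductive IsExistsN {L : Language} {α : Type*} : ℕ → ∀ {k : ℕ}, L.BoundedFormula α k → Prop
  | qf {n k : ℕ} {φ : L.BoundedFormula α k} : φ.IsQF → IsExistsN n φ
  | ex {n k : ℕ} {φ : L.BoundedFormula α (k + 1)} : IsExistsN n φ → IsExistsN (n + 1) φ.ex

/-- `φ` is an existential formula. -/
def IsExists {L : Language} {α : Type*} {k : ℕ} (φ : L.BoundedFormula α k) : Prop :=
  ∃ n : ℕ, IsExistsN n φ

/-- Positive boolean combinations of formulas satisfying `P`. -/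
inductive IsPosBC {L : Language} {α : Type*} (P : ∀ {k : ℕ}, L.BoundedFormula α k → Prop) :
    ∀ {k : ℕ}, L.BoundedFormula α k → Prop
  | base {k : ℕ} {φ : L.BoundedFormula α k} : P φ → IsPosBC P φ
  | inf {k : ℕ} {φ ψ : L.BoundedFormula α k} :
      IsPosBC P φ → IsPosBC P ψ → IsPosBC P (φ ⊓ ψ)
  | sup {k : ℕ} {φ ψ : L.BoundedFormula α k} :
      IsPosBC P φ → IsPosBC P ψ → IsPosBC P (φ ⊔ ψ)

/-- The `∃₁`-fragment: positive boolean combinations of formulas of the form `η` or `∃ y η`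
with `η` quantifier-free. -/
def IsE1 {L : Language} {α : Type*} {k : ℕ} (φ : L.BoundedFormula α k) : Prop :=
  IsPosBC (fun {k} φ => φ.IsQF ∨ ∃ ψ : L.BoundedFormula α (k + 1), ψ.IsQF ∧ φ = ψ.ex) φ

/-- `∃_n∃₁`-formulas: `∃ x₁ … x_m ψ` with `m ≤ n` and `ψ` in the `∃₁`-fragment. -/
inductive IsExistsNE1 {L : Language} {α : Type*} : ℕ → ∀ {k : ℕ}, L.BoundedFormula α k → Prop
  | e1 {n k : ℕ} {φ : L.BoundedFormula α k} : IsE1 φ → IsExistsNE1 n φ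
  | ex {n k : ℕ} {φ : L.BoundedFormula α (k + 1)} : IsExistsNE1 n φ → IsExistsNE1 (n + 1) φ.ex

/-- The `∃^n`-fragments, defined inductively: `∃^0`-formulas are the quantifier-free ones,
and an `∃^{n+1}`-formula is of the form `ψ` or `∃ x ψ` with `ψ` a positive boolean
combination of `∃^n`-formulas. -/
def IsExpN {L : Language} {α : Type*} : ℕ → ∀ {k : ℕ}, L.BoundedFormula α k → Prop
  | 0, _, φ => φ.IsQF
  | n + 1, k, φ => IsPosBC (IsExpN n) φ ∨
      ∃ ψ : L.BoundedFormula α (k + 1), IsPosBC (IsExpN n) ψ ∧ φ = ψ.ex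



/-! ### The language of rings with constants, and realization -/

/-- The `Language.ring`-structure on a ring. -/
noncomputable def ringStructure (M : Type*) [CommRing M] : Language.ring.Structure M :=
  (FirstOrder.Ring.compatibleRingOfRing M).toStructure

/-- The `L_ring(α)`-structure on a ring `M` with constants interpreted via `f : α → M`. -/
noncomputable def ringConStructure {α M : Type*} [CommRing M] (f : α → M) :
    (Language.ring[[α]]).Structure M :=
  letI := ringStructure M
  letI := constantsOn.structure f
  inferInstance

/-- `M ⊨ φ` for an `L_ring(α)`-sentence, with constants interpreted via `f`. -/
def RealizeRing (M : Type*) [CommRing M] {α : Type*} (f : α → M)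
    (φ : (Language.ring[[α]]).Sentence) : Prop :=
  @Sentence.Realize _ M (ringConStructure f) φ

/-- The unary relation symbol `O` for the valuation ring. -/
inductive ValRel : ℕ → Type
  | isO : ValRel 1

/-- The language with a single unary predicate `O`. -/
def oLang : Language := ⟨fun _ => Empty, ValRel⟩

/-- The language of valued fields `L_val = L_ring ∪ {O}`. -/
abbrev Lval : Language := Language.ring.sum oLang

/-- The `oLang`-structure on `M` in which `O` is interpreted as the set `O`. -/
def oStructure {M : Type*} (O : Set M) : oLang.Structure M where
  funMap := fun f _ => f.elim
  RelMap := fun {_} r => match r with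
    | .isO => fun xs => xs 0 ∈ O

/-- The `L_val(α)`-structure on a ring `M`, with `O` interpreted as the set `O` and
constants interpreted via `f : α → M`. -/
noncomputable def valConStructure {α M : Type*} [CommRing M] (O : Set M) (f : α → M) :
    (Lval[[α]]).Structure M :=
  letI := ringStructure M
  letI := oStructure O
  letI : Lval.Structure M := inferInstance
  letI := constantsOn.structure f
  inferInstance

/-- `M ⊨ φ` for an `L_val(α)`-sentence. -/
def RealizeVal (M : Type*) [CommRing M] (O : Set M) {α : Type*} (f : α → M)
    (φ : (Lval[[α]]).Sentence) : Prop :=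
  @Sentence.Realize _ M (valConStructure O f) φ



abbrev Zm0 : Type := WithZero (Multiplicative ℤ)

variable {K : Type*} [Field K] {Γ : Type*} [LinearOrderedCommGroupWithZero Γ]

/-- `π` is a uniformizer of `(K, v)`: `v π` is minimal positive
(multiplicatively: `0 < v π < 1` and `v π` is the largest value `< 1`). -/
def IsUniformizer (v : Valuation K Γ) (π : K) : Prop :=
  0 < v π ∧ v π < 1 ∧ ∀ x : K, v x < 1 → v x ≤ v π

/-- The valuation ring of `v`, as a set. -/
def Oset (v : Valuation K Γ) : Set K := {x | v x ≤ 1}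

/-- The residue field `Kv` of the valued field `(K, v)`. -/
abbrev ResF (v : Valuation K Γ) : Type _ :=
  IsLocalRing.ResidueField v.valuationSubring

/-- The residue map `O_v → Kv`. -/
abbrev resMap (v : Valuation K Γ) : v.valuationSubring →+* ResF v :=
  IsLocalRing.residue _

/-- `(K, v)` is a henselian valued field. -/
abbrev IsHenselian (v : Valuation K Γ) : Prop :=
  HenselianLocalRing v.valuationSubring

/-- compatibility of a ring homomorphism between residue fields with the residue maps,
for an extension `(K, v)` of `(C, u)`. -/
def ResCompat {C : Type*} [Field C] {Γ₀ : Type*} [LinearOrderedCommGroupWithZero Γ₀]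
    (u : Valuation C Γ₀) [Algebra C K] (v : Valuation K Γ)
    (g : ResF u →+* ResF v) : Prop :=
  ∀ (x : u.valuationSubring) (hx : algebraMap C K ↑x ∈ v.valuationSubring),
    g (resMap u x) = resMap v ⟨algebraMap C K ↑x, hx⟩

/-- `(K, v)` is complete (with respect to the valuation uniformity). -/
def IsCompleteValued (v : Valuation K Γ) : Prop :=
  letI : Valued K Γ := Valued.mk' v
  CompleteSpace K



/-- `E/F` admits a separating transcendence basis. -/
def HasSepTransBasis (F E : Type*) [Field F] [Field E] [Algebra F E] : Prop :=
  ∃ s : Set E, AlgebraicIndependent F ((↑) : s → E) ∧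
    Algebra.IsSeparable (IntermediateField.adjoin F s) E

/-- The field extension `E/F` is separable: every finitely generated subextension
admits a separating transcendence basis. -/
def IsSepExt (F E : Type*) [Field F] [Field E] [Algebra F E] : Prop :=
  ∀ s : Finset E, HasSepTransBasis F (IntermediateField.adjoin F (s : Set E))

/-- The extension given by a ring homomorphism `f : F →+* E` of fields is separable. -/
def IsSepExtHom {F E : Type*} [Field F] [Field E] (f : F →+* E) : Prop :=
  letI := f.toAlgebra
  IsSepExt F E

/-- `trdeg(E/F) ≤ d`: there is a finite transcendence basis with at most `d` elements. -/
def TrdegLE (F E : Type*) [CommRing F] [CommRing E] [Algebra F E] (d : ℕ) : Prop :=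
  ∃ s : Finset E, s.card ≤ d ∧ IsTranscendenceBasis F (Subtype.val : ((s : Set E)) → E)

/-- `F` is a large field: `F` is existentially closed in `F((t))`. -/
def LargeField (F : Type u) [Field F] : Prop :=
  ∀ φ : (Language.ring[[F]]).Sentence, IsExists φ →
    RealizeRing (LaurentSeries F) (algebraMap F (LaurentSeries F)) φ →
    RealizeRing F (id : F → F) φ

/-- `(R4_n)`: whenever a valuation `w` on a field `E` is trivial on a large subfield `F` of `E`
with residue field `Eu = F` (via the residue map), every `∃_n`-`L_ring(F)`-sentence true in `E`
is true in `F`. -/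
def R4N (n : ℕ) : Prop :=
  ∀ (E : Type u) [Field E] (Γ : Type u) [LinearOrderedCommGroupWithZero Γ]
    (w : Valuation E Γ) (F : Subfield E),
    LargeField.{u} F →
    (∀ y : F, (y : E) ≠ 0 → w y = 1) →
    (∀ y : E, w y ≤ 1 → ∃ x : F, w (y - x) < 1) →
    ∀ φ : (Language.ring[[F]]).Sentence, IsExistsN n φ →
      RealizeRing E ((↑) : F → E) φ → RealizeRing F (id : F → F) φ

/-- Excellence of the valuation ring of an (equicharacteristic, `ℤ`-valued) valued field
`(C, u)`, via the characterization: the fraction field of the completion (i.e. the completion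
of `C`) is a separable extension of `C`. -/
def ExcellentCompletion (C : Type u) [Field C] (u : Valuation C Zm0) : Prop :=
  letI : Valued C Zm0 := Valued.mk' u
  letI : Field (UniformSpace.Completion C) := UniformSpace.Completion.instField
  IsSepExtHom (UniformSpace.Completion.coeRingHom : C →+* UniformSpace.Completion C)


/-- `Th_P(K, fK) ⊆ Th_P(L, fL)`: every positive boolean combination of `L_ring(α)`-sentences
of the fragment `P` that is true in `K` is true in `L`. -/
def ThRingSub {α : Type*} (P : ∀ {k : ℕ}, (Language.ring[[α]]).BoundedFormula Empty k → Prop)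
    (K : Type*) [CommRing K] (fK : α → K) (L : Type*) [CommRing L] (fL : α → L) : Prop :=
  ∀ φ : (Language.ring[[α]]).Sentence, IsPosBC P φ →
    RealizeRing K fK φ → RealizeRing L fL φ

/-- `Th_P(K, OK, fK) ⊆ Th_P(L, OL, fL)` for `L_val(α)`-sentences. -/
def ThValSub {α : Type*} (P : ∀ {k : ℕ}, (Lval[[α]]).BoundedFormula Empty k → Prop)
    (K : Type*) [CommRing K] (OK : Set K) (fK : α → K)
    (L : Type*) [CommRing L] (OL : Set L) (fL : α → L) : Prop :=
  ∀ φ : (Lval[[α]]).Sentence, IsPosBC P φ →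
    RealizeVal K OK fK φ → RealizeVal L OL fL φ

end Paper

namespace Paper

section Specialization

open Polynomial

/-- Clearing denominators of a polynomial over `C(t)`. -/
theorem exists_clear_denominator {C K ι : Type*} [Field C] [Field K] [Algebra C K] (t : ι → K)
    (ht : AlgebraicIndependent C t) (q : (IntermediateField.adjoin C (Set.range t))[X]) :
    ∃ b : MvPolynomial ι C, b ≠ 0 ∧ ∃ Q : (MvPolynomial ι C)[X],
      Q.map (MvPolynomial.aeval t : MvPolynomial ι C →ₐ[C] K).toRingHom =
        Polynomial.C (MvPolynomial.aeval t b) * q.map (algebraMap _ K) := by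
  induction q using Polynomial.induction_on' with
  | add q₁ q₂ h₁ h₂ =>
    obtain ⟨b₁, hb₁, Q₁, h₁⟩ := h₁
    obtain ⟨b₂, hb₂, Q₂, h₂⟩ := h₂
    refine ⟨b₁ * b₂, mul_ne_zero hb₁ hb₂, Polynomial.C b₂ * Q₁ + Polynomial.C b₁ * Q₂, ?_⟩
    rw [Polynomial.map_add, Polynomial.map_mul, Polynomial.map_mul, h₁, h₂, Polynomial.map_C,
      Polynomial.map_C, Polynomial.map_add, map_mul, Polynomial.C_mul]
    simp only [AlgHom.toRingHom_eq_coe, RingHom.coe_coe]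
    ring
  | monomial n a =>
    obtain ⟨r, s, hrs⟩ := (IntermediateField.mem_adjoin_range_iff C t (a : K)).1 a.2
    by_cases hs : s = 0
    · refine ⟨1, one_ne_zero, 0, ?_⟩
      have ha : (a : K) = 0 := by rw [hrs, hs]; simp
      have : a = 0 := by exact_mod_cast ha
      simp [this]
    · refine ⟨s, hs, Polynomial.monomial n r, ?_⟩
      have hs' : MvPolynomial.aeval t s ≠ 0 := by
        intro h
        exact hs ((injective_iff_map_eq_zero _).1 ht s h)
      rw [Polynomial.map_monomial, Polynomial.map_monomial, Polynomial.C_mul_monomial]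
      congr 1
      change _ = _ * (a : K)
      rw [hrs]
      field_simp
      rfl

/-- A homomorphism out of the image of a ring map extends from a kernel inclusion. -/
theorem nonempty_algHom_of_ker_le {C P K L : Type*} [CommRing C] [CommRing P] [CommRing K]
    [CommRing L] [Algebra C P] [Algebra C K] [Algebra C L] (ε : P →ₐ[C] K) (ρ : P →ₐ[C] L)
    (h : ∀ a, ε a = 0 → ρ a = 0) (D : Subalgebra C K) (hD : ∀ z ∈ D, ∃ a, ε a = z) :
    Nonempty (D →ₐ[C] L) := by
  have hle : D ≤ ε.range := fun z hz => by
    obtain ⟨a, ha⟩ := hD z hz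
    exact ⟨a, ha⟩
  have hker : ∀ a ∈ RingHom.ker ε.rangeRestrict, ρ a = 0 := fun a ha => h a (by
    have := congrArg Subtype.val ((RingHom.mem_ker).1 ha)
    exact this)
  let e := Ideal.quotientKerAlgEquivOfSurjective (f := ε.rangeRestrict)
    ε.rangeRestrict_surjective
  exact ⟨((Ideal.Quotient.liftₐ _ ρ hker).comp e.symm.toAlgHom).comp (Subalgebra.inclusion hle)⟩

/-- A version of `nonempty_algHom_of_ker_le` with a common denominator. -/
theorem nonempty_algHom_of_denominator {C P K L : Type*} [Field C] [CommRing P] [Field K]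
    [Field L] [Algebra C P] [Algebra C K] [Algebra C L] (ε₀ : P →ₐ[C] K) (ρ₀ : P →ₐ[C] L)
    (h : ∀ a, ε₀ a = 0 → ρ₀ a = 0) (B : P) (hε : ε₀ B ≠ 0) (hρ : ρ₀ B ≠ 0) (S : Set K)
    (hS : ∀ z ∈ S, ∃ a, ε₀ a = ε₀ B * z) :
    Nonempty (Algebra.adjoin C S →ₐ[C] L) := by
  have uε : ∀ m : Submonoid.powers B, IsUnit (ε₀ m) := by
    rintro ⟨_, k, rfl⟩
    simp only [map_pow]
    exact (isUnit_iff_ne_zero.2 hε).pow k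
  have uρ : ∀ m : Submonoid.powers B, IsUnit (ρ₀ m) := by
    rintro ⟨_, k, rfl⟩
    simp only [map_pow]
    exact (isUnit_iff_ne_zero.2 hρ).pow k
  let ε : Localization (Submonoid.powers B) →ₐ[C] K :=
    IsLocalization.liftAlgHom (M := Submonoid.powers B) (f := ε₀) uε
  let ρ : Localization (Submonoid.powers B) →ₐ[C] L :=
    IsLocalization.liftAlgHom (M := Submonoid.powers B) (f := ρ₀) uρ
  have hεg : ∀ g, ε (algebraMap _ _ g) = ε₀ g := fun g => by simp [ε]
  have hρg : ∀ g, ρ (algebraMap _ _ g) = ρ₀ g := fun g => by simp [ρ]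
  refine nonempty_algHom_of_ker_le ε ρ ?_ _ ?_
  · intro a ha
    obtain ⟨⟨g, m⟩, hg⟩ := IsLocalization.surj (Submonoid.powers B) a
    have h1 : ε₀ g = 0 := by
      rw [← hεg, ← hg, map_mul, ha, zero_mul]
    have h2 : ρ₀ g = 0 := h g h1
    have h3 : ρ a * ρ₀ m = 0 := by
      rw [← hρg, ← map_mul, hg, hρg, h2]
    exact (mul_eq_zero.1 h3).resolve_right (uρ m).ne_zero
  · intro z hz
    have hle : Algebra.adjoin C S ≤ ε.range := by
      refine Algebra.adjoin_le fun z hz => ?_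
      obtain ⟨a, ha⟩ := hS z hz
      let m : Submonoid.powers B := ⟨B, 1, pow_one B⟩
      refine ⟨IsLocalization.mk' _ a m, ?_⟩
      have h4 := congrArg ε (IsLocalization.mk'_spec (Localization (Submonoid.powers B)) a m)
      rw [map_mul, hεg, hεg, ha, mul_comm] at h4
      exact mul_left_cancel₀ hε h4
    exact hle hz

/-- Pseudo-division by a minimal polynomial with cleared denominators. -/
theorem eval₂_eq_zero_of_hypersurface {R N K L : Type*} [CommRing R] [IsDomain R] [Field N]
    [Field K] [Field L] [Algebra N K] (f : R →+* N) (hf : Function.Injective f) (g : R →+* L)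
    (y : K) (hy : IsIntegral N y) (y' : L) (d₀ : R) (hd₀ : d₀ ≠ 0) (hd' : g d₀ ≠ 0) (H₀ : R[X])
    (hH₀ : H₀.map f = Polynomial.C (f d₀) * minpoly N y) (hH' : H₀.eval₂ g y' = 0)
    (G : R[X]) (hG : Polynomial.aeval y (G.map f) = 0) : G.eval₂ g y' = 0 := by
  have hlead : H₀.leadingCoeff = d₀ := by
    apply hf
    rw [← Polynomial.leadingCoeff_map_of_injective hf, hH₀, Polynomial.leadingCoeff_mul,
      Polynomial.leadingCoeff_C, (minpoly.monic hy).leadingCoeff, mul_one]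
  have hfd : f d₀ ≠ 0 := fun h => hd₀ (hf (h.trans (map_zero f).symm))
  have hdeg : H₀.natDegree = (minpoly N y).natDegree := by
    rw [← Polynomial.natDegree_map_eq_of_injective hf, hH₀, Polynomial.natDegree_C_mul hfd]
  have hH0y : Polynomial.aeval y (H₀.map f) = 0 := by
    rw [hH₀, map_mul, minpoly.aeval, mul_zero]
  have hpos : 0 < H₀.natDegree := by
    rw [hdeg]; exact minpoly.natDegree_pos hy
  induction hn : G.natDegree using Nat.strong_induction_on generalizing G with
  | _ n ih =>
    by_cases hlt : n < H₀.natDegree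
    · have hG0 : G = 0 := by
        by_contra hne
        have hg0 : G.map f ≠ 0 := (Polynomial.map_ne_zero_iff hf).2 hne
        have h1 := Polynomial.natDegree_le_natDegree (minpoly.degree_le_of_ne_zero N y hg0 hG)
        rw [Polynomial.natDegree_map_eq_of_injective hf] at h1
        omega
      rw [hG0, Polynomial.eval₂_zero]
    · push Not at hlt
      let G' := Polynomial.C d₀ * G - Polynomial.C G.leadingCoeff *
        (Polynomial.X ^ (n - H₀.natDegree) * H₀)
      have hG' : Polynomial.aeval y (G'.map f) = 0 := by
        simp only [G', Polynomial.map_sub, Polynomial.map_mul, map_sub, map_mul, hG, hH0y,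
          mul_zero, sub_zero]
      have hdegG' : G'.natDegree < n := by
        have hle : G'.natDegree ≤ n := by
          refine (Polynomial.natDegree_sub_le _ _).trans (max_le ?_ ?_)
          · exact (Polynomial.natDegree_C_mul_le _ _).trans hn.le
          · refine (Polynomial.natDegree_C_mul_le _ _).trans ?_
            refine (Polynomial.natDegree_mul_le).trans ?_
            have := Polynomial.natDegree_X_pow_le (R := R) (n - H₀.natDegree)
            omega
        refine lt_of_le_of_ne hle fun heq => ?_
        have hc : G'.coeff n = 0 := by
          simp only [G', Polynomial.coeff_sub, Polynomial.coeff_C_mul,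
            Polynomial.coeff_X_pow_mul']
          rw [if_pos (Nat.sub_le _ _), Nat.sub_sub_self hlt,
            Polynomial.coeff_natDegree, hlead, ← hn, Polynomial.coeff_natDegree]
          ring
        have : G' = 0 := by
          rw [← Polynomial.leadingCoeff_eq_zero, Polynomial.leadingCoeff, heq, hc]
        rw [this, Polynomial.natDegree_zero] at heq
        omega
      have hG'0 : G'.eval₂ g y' = 0 := ih _ hdegG' G' hG' rfl
      simp only [G', Polynomial.eval₂_sub, Polynomial.eval₂_mul, Polynomial.eval₂_C, hH',
        mul_zero, sub_zero] at hG'0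
      exact (mul_eq_zero.1 hG'0).resolve_left hd'

/-- Spreading out a finite set of elements of `C(t)(y)` as functions on an open piece of a
hypersurface. -/
theorem exists_specialization {C K L ι : Type*} [Field C] [Field K] [Field L] [Algebra C K]
    [Algebra C L] (t : ι → K) (ht : AlgebraicIndependent C t) (y : K)
    (hy : IsIntegral (IntermediateField.adjoin C (Set.range t)) y) (S : Finset K)
    (hS : ∀ z ∈ S, z ∈ IntermediateField.adjoin (IntermediateField.adjoin C (Set.range t)) {y}) :
    ∃ d : MvPolynomial ι C, d ≠ 0 ∧ ∃ H : (MvPolynomial ι C)[X],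
      H.map (MvPolynomial.aeval t : MvPolynomial ι C →ₐ[C] K).toRingHom =
        Polynomial.C (MvPolynomial.aeval t d) *
          (minpoly (IntermediateField.adjoin C (Set.range t)) y).map (algebraMap _ K) ∧
      ∀ (t' : ι → L) (y' : L), MvPolynomial.aeval t' d ≠ 0 →
        (H.map (MvPolynomial.aeval t' : MvPolynomial ι C →ₐ[C] L).toRingHom).eval y' = 0 →
        Nonempty (Algebra.adjoin C (S : Set K) →ₐ[C] L) := by
  classical
  set N := IntermediateField.adjoin C (Set.range t)
  have hinj : Function.Injective
      ((MvPolynomial.aeval t : MvPolynomial ι C →ₐ[C] K).toRingHom) := ht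
  obtain ⟨d₀, hd₀, H₀, hH₀⟩ := exists_clear_denominator t ht (minpoly N y)
  -- every element of `S` is a quotient
  have key : ∀ z : K, z ∈ IntermediateField.adjoin N {y} → ∃ b : MvPolynomial ι C, b ≠ 0 ∧
      ∃ Q : (MvPolynomial ι C)[X], Q.eval₂ (MvPolynomial.aeval t :
        MvPolynomial ι C →ₐ[C] K).toRingHom y = MvPolynomial.aeval t b * z := by
    intro z hz
    have hz' : z ∈ (IntermediateField.adjoin N {y}).toSubalgebra := hz
    rw [IntermediateField.adjoin_simple_toSubalgebra_of_isAlgebraic hy.isAlgebraic,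
      Algebra.adjoin_singleton_eq_range_aeval] at hz'
    obtain ⟨q, hq⟩ := hz'
    obtain ⟨b, hb, Q, hQ⟩ := exists_clear_denominator t ht q
    refine ⟨b, hb, Q, ?_⟩
    rw [Polynomial.eval₂_eq_eval_map, hQ, Polynomial.eval_mul, Polynomial.eval_C, ← hq]
    congr 1
    exact (Polynomial.eval_map_algebraMap _ _)
  choose! b hb Q hQ using key
  let d := d₀ * ∏ z ∈ S, b z
  have hprod : ∏ z ∈ S, b z ≠ 0 := Finset.prod_ne_zero_iff.2 fun z hz => hb z (hS z hz)
  have hd : d ≠ 0 := mul_ne_zero hd₀ hprod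
  refine ⟨d, hd, Polynomial.C (∏ z ∈ S, b z) * H₀, ?_, ?_⟩
  · rw [Polynomial.map_mul, hH₀, Polynomial.map_C, ← mul_assoc, ← Polynomial.C_mul]
    simp only [AlgHom.toRingHom_eq_coe, RingHom.coe_coe, d, map_mul]
    rw [mul_comm (Polynomial.C (MvPolynomial.aeval t d₀))]
  · intro t' y' hd' hH'
    have hd0' : MvPolynomial.aeval t' d₀ ≠ 0 := fun h => hd' (by simp [d, h])
    have hp' : MvPolynomial.aeval t' (∏ z ∈ S, b z) ≠ 0 := fun h => hd' (by
      simp only [d, map_mul, h, mul_zero])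
    have hH0' : (H₀.map (MvPolynomial.aeval t' : MvPolynomial ι C →ₐ[C] L).toRingHom).eval y'
        = 0 := by
      rw [Polynomial.map_mul, Polynomial.map_C, Polynomial.eval_mul, Polynomial.eval_C] at hH'
      exact (mul_eq_zero.1 hH').resolve_left hp'
    have hm : ∀ r : MvPolynomial ι C, MvPolynomial.aeval t r ∈ N := by
      intro r
      have : MvPolynomial.aeval t r ∈ Algebra.adjoin C (Set.range t) := by
        rw [Algebra.adjoin_range_eq_range_aeval]
        exact ⟨r, rfl⟩
      exact IntermediateField.algebra_adjoin_le_adjoin C _ this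
    let f : MvPolynomial ι C →+* N :=
      (MvPolynomial.aeval t : MvPolynomial ι C →ₐ[C] K).toRingHom.codRestrict N.toSubring hm
    have hf : Function.Injective f := fun r s h => hinj (congrArg Subtype.val h)
    have hcomp : (algebraMap N K).comp f =
      (MvPolynomial.aeval t : MvPolynomial ι C →ₐ[C] K).toRingHom := rfl
    have rel : ∀ G : (MvPolynomial ι C)[X],
        G.eval₂ (MvPolynomial.aeval t : MvPolynomial ι C →ₐ[C] K).toRingHom y = 0 →
        G.eval₂ (MvPolynomial.aeval t' : MvPolynomial ι C →ₐ[C] L).toRingHom y' = 0 := by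
      intro G hG
      refine eval₂_eq_zero_of_hypersurface f hf _ y hy y' d₀ hd₀ hd0' H₀ ?_ ?_ G ?_
      · apply Polynomial.map_injective _ (algebraMap N K).injective
        rw [Polynomial.map_map, hcomp, hH₀, Polynomial.map_mul, Polynomial.map_C]
        rfl
      · rw [Polynomial.eval₂_eq_eval_map]; exact hH0'
      · rw [← Polynomial.eval_map_algebraMap, Polynomial.map_map, hcomp,
          ← Polynomial.eval₂_eq_eval_map]
        exact hG
    let B : (MvPolynomial ι C)[X] := Polynomial.C (∏ z ∈ S, b z)
    let ε₀ : (MvPolynomial ι C)[X] →ₐ[C] K :=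
      { Polynomial.eval₂RingHom
          (MvPolynomial.aeval t : MvPolynomial ι C →ₐ[C] K).toRingHom y with
        commutes' := fun c => by
          have : algebraMap C (MvPolynomial ι C)[X] c = Polynomial.C (MvPolynomial.C c) := rfl
          simp [this] }
    let ρ₀ : (MvPolynomial ι C)[X] →ₐ[C] L :=
      { Polynomial.eval₂RingHom
          (MvPolynomial.aeval t' : MvPolynomial ι C →ₐ[C] L).toRingHom y' with
        commutes' := fun c => by
          have : algebraMap C (MvPolynomial ι C)[X] c = Polynomial.C (MvPolynomial.C c) := rfl
          simp [this] }
    have hεB : ε₀ B = MvPolynomial.aeval t (∏ z ∈ S, b z) := Polynomial.eval₂_C _ _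
    have hρB : ρ₀ B = MvPolynomial.aeval t' (∏ z ∈ S, b z) := Polynomial.eval₂_C _ _
    have hεB0 : ε₀ B ≠ 0 := by
      rw [hεB]
      intro h
      exact hprod (hinj (h.trans (map_zero _).symm))
    refine nonempty_algHom_of_denominator ε₀ ρ₀ (fun a ha => rel a ha) B hεB0 (hρB ▸ hp') _ ?_
    intro z hz
    have hz : z ∈ S := hz
    refine ⟨Q z * Polynomial.C (∏ z' ∈ S.erase z, b z'), ?_⟩
    rw [hεB, map_mul, ← Finset.mul_prod_erase S b hz, map_mul]
    have h1 : ε₀ (Q z) = MvPolynomial.aeval t (b z) * z := hQ z (hS z hz)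
    have h2 : ε₀ (Polynomial.C (∏ z' ∈ S.erase z, b z')) =
      MvPolynomial.aeval t (∏ z' ∈ S.erase z, b z') := Polynomial.eval₂_C _ _
    rw [h1, h2]
    ring

end Specialization

end Paper

namespace Paper

section Newton

open Polynomial IsLocalRing

/-- Over a henselian local ring, a polynomial congruent to `X ^ (n + 1) - X ^ n` has a root
congruent to `1`. -/
theorem exists_root_of_congruent {R : Type*} [CommRing R] [HenselianLocalRing R] (n : ℕ)
    (e : R[X]) (hdeg : e.degree < (n + 1 : ℕ)) (he : ∀ i, e.coeff i ∈ maximalIdeal R) :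
    ∃ s : R, (X ^ (n + 1) - X ^ n + e).eval s = 0 ∧ s - 1 ∈ maximalIdeal R := by
  have heval : ∀ (q : R[X]) (_ : ∀ i, q.coeff i ∈ maximalIdeal R) (z : R),
      q.eval z ∈ maximalIdeal R := by
    intro q hq z
    rw [Polynomial.eval_eq_sum_range]
    exact Ideal.sum_mem _ fun i _ => Ideal.mul_mem_right _ _ (hq i)
  have hmonic : (X ^ (n + 1) - X ^ n + e).Monic := by
    have : (X ^ (n + 1) - X ^ n + e) = X ^ (n + 1) + (e - X ^ n) := by ring
    rw [this]
    apply Polynomial.monic_X_pow_add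
    refine lt_of_le_of_lt (Polynomial.degree_sub_le _ _) (max_lt ?_ ?_)
    · exact_mod_cast hdeg
    · refine lt_of_le_of_lt (Polynomial.degree_X_pow_le n) ?_
      exact_mod_cast Nat.lt_succ_self n
  obtain ⟨s, hs, hs1⟩ := HenselianLocalRing.is_henselian _ hmonic 1
    (by simpa using heval e he 1) (by
      have : (derivative (X ^ (n + 1) - X ^ n + e)).eval 1 = 1 + (derivative e).eval 1 := by
        simp [Polynomial.derivative_X_pow]
      rw [this]
      by_contra hu
      have h1 : (derivative e).eval 1 ∈ maximalIdeal R := by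
        refine heval _ (fun i => ?_) 1
        rw [Polynomial.coeff_derivative]
        exact Ideal.mul_mem_right _ _ (he _)
      have h2 : (1 : R) ∈ maximalIdeal R := by
        have := Ideal.sub_mem _ ((mem_maximalIdeal _).2 hu) h1
        simpa using this
      exact (mem_maximalIdeal _).1 h2 isUnit_one)
  exact ⟨s, hs, hs1⟩

/-- Newton's version of Hensel's lemma, without monicity. -/
theorem exists_root_of_eval_eq_sq_mul {R : Type*} [CommRing R] [HenselianLocalRing R]
    (f : R[X]) (a m : R) (hm : m ∈ maximalIdeal R)
    (h : f.eval a = (derivative f).eval a ^ 2 * m) : ∃ y, f.eval y = 0 := by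
  set D := (derivative f).eval a with hD
  set c : ℕ → R := fun i => (taylor a f).coeff i with hc
  set n := f.natDegree + 1 with hn
  let e : R[X] := ∑ i ∈ Finset.range n,
    Polynomial.C (c (i + 2) * D ^ i * (-1) ^ i * m ^ (i + 1)) * X ^ (n - 1 - i)
  obtain ⟨s, hs, hs1⟩ := exists_root_of_congruent (R := R) n e
    (by
      refine lt_of_le_of_lt (Polynomial.degree_sum_le _ _) ?_
      rw [Finset.sup_lt_iff (by exact WithBot.bot_lt_coe _)]
      intro i _
      refine lt_of_le_of_lt (Polynomial.degree_C_mul_X_pow_le _ _) ?_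
      exact_mod_cast (by omega : n - 1 - i < n + 1))
    (by
      intro i
      simp only [e, Polynomial.finset_sum_coeff, Polynomial.coeff_C_mul]
      refine Ideal.sum_mem _ fun j _ => Ideal.mul_mem_right _ _ ?_
      rw [pow_succ]
      exact Ideal.mul_mem_left _ _ (Ideal.mul_mem_left _ _ hm))
  have hu : IsUnit s := by
    by_contra hu
    have := Ideal.sub_mem _ ((mem_maximalIdeal _).2 hu) hs1
    simp only [sub_sub_cancel] at this
    exact (mem_maximalIdeal _).1 this isUnit_one
  obtain ⟨r, hr⟩ := hu.exists_right_inv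
  refine ⟨a + D * (-(m * r)), ?_⟩
  have htay : f.eval (a + D * (-(m * r))) = ∑ i ∈ Finset.range (n + 2), c i *
      (D * (-(m * r))) ^ i := by
    have : f.eval (a + D * (-(m * r))) = (taylor a f).eval (D * (-(m * r))) := by
      rw [Polynomial.taylor_eval, add_comm]
    rw [this, Polynomial.eval_eq_sum_range' (n := n + 2)]
    rw [Polynomial.natDegree_taylor]
    omega
  have h0 : c 0 = D ^ 2 * m := by simp [hc, h]
  have h1 : c 1 = D := by simp [hc, hD, Polynomial.taylor_coeff_one]
  rw [htay, Finset.sum_range_succ', Finset.sum_range_succ']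
  simp only [h0, h1, pow_zero, zero_add, pow_one, mul_one]
  simp only [e, Polynomial.eval_add, Polynomial.eval_sub, Polynomial.eval_pow, Polynomial.eval_X,
    Polynomial.eval_finset_sum, Polynomial.eval_mul, Polynomial.eval_C] at hs
  have hrs : ∀ k, r ^ k * s ^ k = 1 := fun k => by rw [← mul_pow, mul_comm r, hr, one_pow]
  have key : r ^ (n + 1) * (s ^ (n + 1) - s ^ n) = 1 - r := by
    have := hrs (n + 1)
    have h2 := hrs n
    linear_combination this - r * h2
  have key2 : ∀ i ∈ Finset.range n, c (i + 2) * (D * (-(m * r))) ^ (i + 2) =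
      D ^ 2 * m * r ^ (n + 1) * (c (i + 2) * D ^ i * (-1) ^ i * m ^ (i + 1) * s ^ (n - 1 - i)) := by
    intro i hi
    have hi : i < n := Finset.mem_range.1 hi
    have h3 : r ^ (n + 1) * s ^ (n - 1 - i) = r ^ (i + 2) := by
      have : n + 1 = (i + 2) + (n - 1 - i) := by omega
      rw [this, pow_add, mul_assoc, hrs, mul_one]
    calc _ = c (i + 2) * D ^ (i + 2) * (-1) ^ i * m ^ (i + 2) * r ^ (i + 2) := by
          rw [mul_pow, neg_pow, mul_pow, pow_add (-1 : R)]; ring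
      _ = c (i + 2) * D ^ (i + 2) * (-1) ^ i * m ^ (i + 2) * (r ^ (n + 1) * s ^ (n - 1 - i)) := by
          rw [h3]
      _ = _ := by ring
  have key3 : ∑ i ∈ Finset.range n, c (i + 2) * (D * (-(m * r))) ^ (i + 2) =
      D ^ 2 * m * (r ^ (n + 1) * (∑ i ∈ Finset.range n,
        c (i + 2) * D ^ i * (-1) ^ i * m ^ (i + 1) * s ^ (n - 1 - i))) := by
    rw [Finset.sum_congr rfl key2, ← Finset.mul_sum]; ring
  simp only [add_assoc, one_add_one_eq_two]
  rw [key3]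
  linear_combination D ^ 2 * m * r ^ (n + 1) * hs - D ^ 2 * m * key

end Newton

end Paper

namespace Paper

section Logic

/-- `L_val(C)`-terms are polynomials over `C`. -/
theorem exists_polynomial_of_term {C : Type u} [CommRing C] {k : ℕ}
    (t : (Lval[[C]]).Term (Empty ⊕ Fin k)) :
    ∃ P : MvPolynomial (Fin k) C, ∀ (M : Type u) [CommRing M] [Algebra C M] (O : Set M)
      (e : Empty → M) (xs : Fin k → M),
      @Term.realize _ M (valConStructure O (algebraMap C M)) _ (Sum.elim e xs) t =
        MvPolynomial.aeval xs P := by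
  induction t with
  | var a =>
    cases a with
    | inl a => exact a.elim
    | inr i => exact ⟨MvPolynomial.X i, fun M _ _ O e xs => by simp [Term.realize]⟩
  | func f ts ih =>
    choose P hP using ih
    cases f with
    | inl f =>
      cases f with
      | inl f =>
        cases f with
        | add =>
          refine ⟨P 0 + P 1, fun M _ _ O e xs => ?_⟩
          rw [map_add, ← hP 0 M O e xs, ← hP 1 M O e xs]
          rfl
        | mul =>
          refine ⟨P 0 * P 1, fun M _ _ O e xs => ?_⟩
          rw [map_mul, ← hP 0 M O e xs, ← hP 1 M O e xs]
          rfl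
        | neg =>
          refine ⟨- P 0, fun M _ _ O e xs => ?_⟩
          rw [map_neg, ← hP 0 M O e xs]
          rfl
        | zero => exact ⟨0, fun M _ _ O e xs => by rw [map_zero]; rfl⟩
        | one => exact ⟨1, fun M _ _ O e xs => by rw [map_one]; rfl⟩
      | inr f => exact f.elim
    | inr f =>
      rename_i l
      cases l with
      | zero =>
        exact ⟨MvPolynomial.C (show C from f), fun M _ _ O e xs =>
          (MvPolynomial.aeval_C (R := C) xs (show C from f)).symm⟩
      | succ l => exact f.elim

/-- Quantifier-free formulas are transferred along homomorphisms of large enough finitely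
generated subalgebras. -/
theorem qf_transfer {C K L : Type u} [Field C] [Field K] [Field L] [Algebra C K] [Algebra C L]
    (OK : Set K) (OL : Set L)
    (hO : ∀ a : K, ∃ S : Finset K, ∀ (D : Subalgebra C K) (_ : (S : Set K) ⊆ D)
      (ρ : D →ₐ[C] L) (ha : a ∈ D), a ∈ OK ↔ ρ ⟨a, ha⟩ ∈ OL)
    {k : ℕ} (φ : (Lval[[C]]).BoundedFormula Empty k) (hφ : φ.IsQF) (e : Empty → K)
    (e' : Empty → L) (xs : Fin k → K) :
    ∃ S : Finset K, ∀ (D : Subalgebra C K) (_ : (S : Set K) ⊆ D) (ρ : D →ₐ[C] L)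
      (hx : ∀ i, xs i ∈ D),
      @BoundedFormula.Realize _ K (valConStructure OK (algebraMap C K)) _ _ φ e xs ↔
      @BoundedFormula.Realize _ L (valConStructure OL (algebraMap C L)) _ _ φ e'
        (fun i => ρ ⟨xs i, hx i⟩) := by
  classical
  have hmap : ∀ (D : Subalgebra C K) (ρ : D →ₐ[C] L) (hx : ∀ i, xs i ∈ D)
      (P : MvPolynomial (Fin k) C), ∃ h : MvPolynomial.aeval xs P ∈ D,
      MvPolynomial.aeval (fun i => ρ ⟨xs i, hx i⟩) P = ρ ⟨MvPolynomial.aeval xs P, h⟩ := by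
    intro D ρ hx P
    have h : MvPolynomial.aeval xs P =
        ((MvPolynomial.aeval (fun i => (⟨xs i, hx i⟩ : D)) P : D) : K) := by
      exact MvPolynomial.aeval_algebraMap_apply K (fun i => (⟨xs i, hx i⟩ : D)) P
    refine ⟨by rw [h]; exact Subtype.property _, ?_⟩
    have h3 := (MvPolynomial.comp_aeval_apply (fun i => (⟨xs i, hx i⟩ : D)) ρ P).symm
    rw [h3]
    congr 1
    exact Subtype.ext h.symm
  induction hφ with
  | falsum => exact ⟨∅, fun D _ ρ hx => Iff.rfl⟩
  | of_isAtomic h =>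
    cases h with
    | equal t₁ t₂ =>
      obtain ⟨P₁, h₁⟩ := exists_polynomial_of_term t₁
      obtain ⟨P₂, h₂⟩ := exists_polynomial_of_term t₂
      refine ⟨{(MvPolynomial.aeval xs (P₁ - P₂))⁻¹}, fun D hD ρ hx => ?_⟩
      obtain ⟨hm, hρ⟩ := hmap D ρ hx (P₁ - P₂)
      have hK : @BoundedFormula.Realize _ K (valConStructure OK (algebraMap C K)) _ _
          (t₁.bdEqual t₂) e xs ↔ MvPolynomial.aeval xs (P₁ - P₂) = 0 := by
        rw [map_sub, sub_eq_zero, ← h₁ K OK e, ← h₂ K OK e]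
        rfl
      have hL : @BoundedFormula.Realize _ L (valConStructure OL (algebraMap C L)) _ _
          (t₁.bdEqual t₂) e' (fun i => ρ ⟨xs i, hx i⟩) ↔
          MvPolynomial.aeval (fun i => ρ ⟨xs i, hx i⟩) (P₁ - P₂) = 0 := by
        rw [map_sub, sub_eq_zero, ← h₁ L OL e', ← h₂ L OL e']
        rfl
      rw [hK, hL, hρ]
      constructor
      · intro h0
        have : (⟨_, hm⟩ : D) = 0 := Subtype.ext h0
        rw [this, map_zero]
      · intro h0
        by_contra hne
        have hinv : (MvPolynomial.aeval xs (P₁ - P₂))⁻¹ ∈ D := hD (by simp)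
        have : (⟨_, hm⟩ : D) * ⟨_, hinv⟩ = 1 := Subtype.ext (mul_inv_cancel₀ hne)
        have h1 := congrArg ρ this
        rw [map_mul, h0, zero_mul, map_one] at h1
        exact zero_ne_one h1
    | rel R ts =>
      rename_i l
      cases R with
      | inr R => exact R.elim
      | inl R =>
        cases R with
        | inl R => exact R.elim
        | inr R =>
          cases R with
          | isO =>
            obtain ⟨P, h⟩ := exists_polynomial_of_term (ts 0)
            obtain ⟨S, hS⟩ := hO (MvPolynomial.aeval xs P)
            refine ⟨S, fun D hD ρ hx => ?_⟩
            obtain ⟨hm, hρ⟩ := hmap D ρ hx P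
            have := hS D hD ρ hm
            rw [← hρ, ← h K OK e, ← h L OL e'] at this
            exact this
  | imp h₁ h₂ ih₁ ih₂ =>
    obtain ⟨S₁, h₁⟩ := ih₁
    obtain ⟨S₂, h₂⟩ := ih₂
    refine ⟨S₁ ∪ S₂, fun D hD ρ hx => ?_⟩
    rw [Finset.coe_union, Set.union_subset_iff] at hD
    exact imp_congr (h₁ D hD.1 ρ hx) (h₂ D hD.2 ρ hx)

/-- Existential formulas are transferred along homomorphisms of large enough finitely generated
subalgebras. -/
theorem isExistsN_transfer {C K L : Type u} [Field C] [Field K] [Field L] [Algebra C K]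
    [Algebra C L] (OK : Set K) (OL : Set L)
    (hO : ∀ a : K, ∃ S : Finset K, ∀ (D : Subalgebra C K) (_ : (S : Set K) ⊆ D)
      (ρ : D →ₐ[C] L) (ha : a ∈ D), a ∈ OK ↔ ρ ⟨a, ha⟩ ∈ OL)
    {n k : ℕ} (φ : (Lval[[C]]).BoundedFormula Empty k) (hφ : IsExistsN n φ) (e : Empty → K)
    (e' : Empty → L) (xs : Fin k → K)
    (h : @BoundedFormula.Realize _ K (valConStructure OK (algebraMap C K)) _ _ φ e xs) :
    ∃ S : Finset K, ∀ (D : Subalgebra C K) (_ : (S : Set K) ⊆ D) (ρ : D →ₐ[C] L)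
      (hx : ∀ i, xs i ∈ D),
      @BoundedFormula.Realize _ L (valConStructure OL (algebraMap C L)) _ _ φ e'
        (fun i => ρ ⟨xs i, hx i⟩) := by
  classical
  let : (Lval[[C]]).Structure K := valConStructure OK (algebraMap C K)
  let : (Lval[[C]]).Structure L := valConStructure OL (algebraMap C L)
  induction hφ with
  | qf hφ =>
    obtain ⟨S, hS⟩ := qf_transfer OK OL hO _ hφ e e' xs
    exact ⟨S, fun D hD ρ hx => (hS D hD ρ hx).1 h⟩
  | ex hφ ih =>
    rw [BoundedFormula.realize_ex] at h
    obtain ⟨a, ha⟩ := h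
    obtain ⟨S, hS⟩ := ih _ ha
    refine ⟨insert a S, fun D hD ρ hx => ?_⟩
    rw [Finset.coe_insert, Set.insert_subset_iff] at hD
    have hx' : ∀ i, (Fin.snoc xs a : Fin _ → K) i ∈ D := by
      intro i
      refine Fin.lastCases ?_ (fun i => ?_) i
      · rw [Fin.snoc_last]; exact hD.1
      · rw [Fin.snoc_castSucc]; exact hx i
    rw [BoundedFormula.realize_ex]
    refine ⟨ρ ⟨a, hD.1⟩, ?_⟩
    have := hS D hD.2 ρ hx'
    convert this using 1
    funext i
    refine Fin.lastCases ?_ (fun i => ?_) i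
    · simp only [Fin.snoc_last]
    · simp only [Fin.snoc_castSucc]

/-- Inclusion of existential theories from the existence of enough homomorphisms. -/
theorem thValSub_of_algHom {C K L : Type u} [Field C] [Field K] [Field L] [Algebra C K]
    [Algebra C L] (OK : Set K) (OL : Set L)
    (hO : ∀ a : K, ∃ S : Finset K, ∀ (D : Subalgebra C K) (_ : (S : Set K) ⊆ D)
      (ρ : D →ₐ[C] L) (ha : a ∈ D), a ∈ OK ↔ ρ ⟨a, ha⟩ ∈ OL)
    (hEC : ∀ S : Finset K, Nonempty (Algebra.adjoin C (S : Set K) →ₐ[C] L)) :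
    ThValSub (fun {k} φ => IsExists φ) K OK (algebraMap C K) L OL (algebraMap C L) := by
  let : (Lval[[C]]).Structure K := valConStructure OK (algebraMap C K)
  let : (Lval[[C]]).Structure L := valConStructure OL (algebraMap C L)
  have main : ∀ {k : ℕ} (φ : (Lval[[C]]).BoundedFormula Empty k),
      IsPosBC (fun {k} φ => IsExists φ) φ → k = 0 → ∀ (e : Empty → K) (e' : Empty → L)
      (xs : Fin k → K) (xs' : Fin k → L),
      @BoundedFormula.Realize _ K (valConStructure OK (algebraMap C K)) _ _ φ e xs →
      @BoundedFormula.Realize _ L (valConStructure OL (algebraMap C L)) _ _ φ e' xs' := by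
    intro k φ hφ
    induction hφ with
    | base h =>
      rintro rfl e e' xs xs' hK
      obtain ⟨n, hn⟩ := h
      obtain ⟨S, hS⟩ := isExistsN_transfer OK OL hO _ hn e e' xs hK
      obtain ⟨ρ⟩ := hEC S
      have := hS _ Algebra.subset_adjoin ρ (fun i => i.elim0)
      convert this using 1
    | inf h₁ h₂ ih₁ ih₂ =>
      intro hk e e' xs xs' hK
      rw [BoundedFormula.realize_inf] at hK ⊢
      exact ⟨ih₁ hk e e' xs xs' hK.1, ih₂ hk e e' xs xs' hK.2⟩
    | sup h₁ h₂ ih₁ ih₂ =>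
      intro hk e e' xs xs' hK
      rw [BoundedFormula.realize_sup] at hK ⊢
      exact hK.imp (ih₁ hk e e' xs xs') (ih₂ hk e e' xs xs')
  intro φ hφ hK
  exact main φ hφ rfl _ _ _ _ hK

end Logic

end Paper

namespace Paper

section Logic

/-- Polynomials over `F` are realized by `L_ring(F)`-terms. -/
theorem exists_term_of_polynomial {F : Type u} [CommRing F] {k : ℕ} (P : MvPolynomial (Fin k) F) :
    ∃ t : (Language.ring[[F]]).Term (Empty ⊕ Fin k), ∀ (M : Type u) [CommRing M] (f : F →+* M)
      (e : Empty → M) (xs : Fin k → M),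
      @Term.realize _ M (ringConStructure f) _ (Sum.elim e xs) t = MvPolynomial.eval₂ f xs P := by
  have hadd : ∀ t₁ t₂ : (Language.ring[[F]]).Term (Empty ⊕ Fin k), ∃ t, ∀ (M : Type u)
      [CommRing M] (f : F →+* M) (e : Empty → M) (xs : Fin k → M),
      @Term.realize _ M (ringConStructure f) _ (Sum.elim e xs) t =
      @Term.realize _ M (ringConStructure f) _ (Sum.elim e xs) t₁ +
      @Term.realize _ M (ringConStructure f) _ (Sum.elim e xs) t₂ := fun t₁ t₂ =>
    ⟨Term.func (Sum.inl FirstOrder.Ring.addFunc : (Language.ring[[F]]).Functions 2) ![t₁, t₂],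
      fun M _ f e xs => rfl⟩
  have hmul : ∀ t₁ t₂ : (Language.ring[[F]]).Term (Empty ⊕ Fin k), ∃ t, ∀ (M : Type u)
      [CommRing M] (f : F →+* M) (e : Empty → M) (xs : Fin k → M),
      @Term.realize _ M (ringConStructure f) _ (Sum.elim e xs) t =
      @Term.realize _ M (ringConStructure f) _ (Sum.elim e xs) t₁ *
      @Term.realize _ M (ringConStructure f) _ (Sum.elim e xs) t₂ := fun t₁ t₂ =>
    ⟨Term.func (Sum.inl FirstOrder.Ring.mulFunc : (Language.ring[[F]]).Functions 2) ![t₁, t₂],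
      fun M _ f e xs => rfl⟩
  induction P using MvPolynomial.induction_on with
  | C a =>
    refine ⟨Term.func (Sum.inr (show (constantsOn F).Functions 0 from a) :
      (Language.ring[[F]]).Functions 0) ![], fun M _ f e xs => ?_⟩
    rw [MvPolynomial.eval₂_C]
    rfl
  | add P Q hP hQ =>
    obtain ⟨t₁, h₁⟩ := hP
    obtain ⟨t₂, h₂⟩ := hQ
    obtain ⟨t, ht⟩ := hadd t₁ t₂
    exact ⟨t, fun M _ f e xs => by rw [ht, h₁, h₂, MvPolynomial.eval₂_add]⟩
  | mul_X P i hP =>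
    obtain ⟨t₁, h₁⟩ := hP
    obtain ⟨t, ht⟩ := hmul t₁ (Term.var (Sum.inr i))
    exact ⟨t, fun M _ f e xs => by
      rw [ht, h₁, MvPolynomial.eval₂_mul, MvPolynomial.eval₂_X]; rfl⟩

/-- Finite systems of polynomial equations are expressed by quantifier-free formulas. -/
theorem exists_formula_of_system {F : Type u} [CommRing F] {k : ℕ}
    (S : Finset (MvPolynomial (Fin k) F)) :
    ∃ φ : (Language.ring[[F]]).BoundedFormula Empty k, φ.IsQF ∧
      ∀ (M : Type u) [CommRing M] (f : F →+* M) (e : Empty → M) (xs : Fin k → M),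
      @BoundedFormula.Realize _ M (ringConStructure f) _ _ φ e xs ↔
        ∀ P ∈ S, MvPolynomial.eval₂ f xs P = 0 := by
  classical
  induction S using Finset.induction_on with
  | empty =>
    exact ⟨⊤, BoundedFormula.isQF_bot.imp BoundedFormula.isQF_bot, fun M _ f e xs => by
      let : (Language.ring[[F]]).Structure M := ringConStructure f
      simp⟩
  | insert P S _ ih =>
    obtain ⟨φ, hφ, h⟩ := ih
    obtain ⟨t, ht⟩ := exists_term_of_polynomial P
    obtain ⟨t₀, ht₀⟩ := exists_term_of_polynomial (0 : MvPolynomial (Fin k) F)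
    refine ⟨t.bdEqual t₀ ⊓ φ, (BoundedFormula.IsAtomic.equal t t₀).isQF.inf hφ,
      fun M _ f e xs => ?_⟩
    let : (Language.ring[[F]]).Structure M := ringConStructure f
    rw [BoundedFormula.realize_inf, h M f e xs, Finset.forall_mem_insert,
      BoundedFormula.realize_bdEqual]
    refine and_congr ?_ Iff.rfl
    have h1 := ht M f e xs
    have h2 := ht₀ M f e xs
    rw [MvPolynomial.eval₂_zero] at h2
    rw [← h1, ← h2]

theorem IsExistsN.exs {L' : Language} {α : Type*} {n k : ℕ} {φ : L'.BoundedFormula α k}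
    (h : IsExistsN n φ) : IsExists φ.exs := by
  induction k generalizing n with
  | zero => exact ⟨n, h⟩
  | succ k ih => exact ih (φ := φ.ex) (n := n + 1) (IsExistsN.ex h)

/-- Solvability of finite systems of polynomial equations is transferred by an inclusion of
existential theories. -/
theorem exists_solution_of_thRingSub {F E E' : Type u} [CommRing F] [CommRing E] [CommRing E']
    (f : F →+* E) (f' : F →+* E')
    (h : ThRingSub (fun {k} φ => IsExists φ) E f E' f') {ι : Type*}
    (S : Finset (MvPolynomial ι F)) (xs : ι → E)
    (hxs : ∀ P ∈ S, MvPolynomial.eval₂ f xs P = 0) :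
    ∃ ys : ι → E', ∀ P ∈ S, MvPolynomial.eval₂ f' ys P = 0 := by
  classical
  let s : Finset ι := S.biUnion fun P => P.vars
  let g : Fin s.card → ι := fun i => (s.equivFin.symm i : ι)
  have hg : Function.Injective g := fun i j hij =>
    s.equivFin.symm.injective (Subtype.ext hij)
  have hQ : ∀ P ∈ S, ∃ Q : MvPolynomial (Fin s.card) F, MvPolynomial.rename g Q = P := by
    intro P hP
    refine MvPolynomial.exists_rename_eq_of_vars_subset_range P g hg ?_
    intro i hi
    have : i ∈ s := Finset.mem_biUnion.2 ⟨P, hP, hi⟩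
    exact ⟨s.equivFin ⟨i, this⟩, by simp [g]⟩
  choose! Q hQ using hQ
  obtain ⟨φ, hφ, hr⟩ := exists_formula_of_system (S.image Q)
  have hE : RealizeRing E f φ.exs := by
    let : (Language.ring[[F]]).Structure E := ringConStructure f
    refine BoundedFormula.realize_exs.2 ⟨xs ∘ g, (hr E f _ _).2 ?_⟩
    intro P' hP'
    obtain ⟨P, hP, rfl⟩ := Finset.mem_image.1 hP'
    rw [← MvPolynomial.eval₂_rename, hQ P hP]
    exact hxs P hP
  have hE' := h _ (IsPosBC.base (IsExistsN.exs (IsExistsN.qf (n := 0) hφ))) hE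
  let : (Language.ring[[F]]).Structure E' := ringConStructure f'
  obtain ⟨ys, hys⟩ := BoundedFormula.realize_exs.1 hE'
  have hys := (hr E' f' _ _).1 hys
  refine ⟨Function.extend g ys 0, fun P hP => ?_⟩
  have := hys _ (Finset.mem_image_of_mem Q hP)
  have he : Function.extend g ys 0 ∘ g = ys := funext fun i => hg.extend_apply ys 0 i
  rw [← hQ P hP, MvPolynomial.eval₂_rename, he]
  exact this

end Logic

end Paper

namespace Paper

section Smooth

/-- An explicit criterion for the vanishing of `H¹(L_{S/R})`. -/
theorem subsingleton_h1Cotangent_iff (R : Type u) (S : Type v) [CommRing R] [CommRing S]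
    [Algebra R S] :
    Subsingleton (Algebra.H1Cotangent R S) ↔ ∀ x : MvPolynomial S R,
      MvPolynomial.aeval (id : S → S) x = 0 →
      (∀ i, MvPolynomial.aeval (id : S → S) (MvPolynomial.pderiv i x) = 0) →
      x ∈ (RingHom.ker (MvPolynomial.aeval (R := R) (id : S → S))) ^ 2 := by
  let P := (Algebra.Generators.self R S)
  have hker : P.toExtension.ker = RingHom.ker (MvPolynomial.aeval (R := R) (id : S → S)) := by
    ext x
    rfl
  have hc : ∀ (x : MvPolynomial S R) (hx : x ∈ P.toExtension.ker),
      P.toExtension.cotangentComplex (Algebra.Extension.Cotangent.mk ⟨x, hx⟩) = 0 ↔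
      ∀ i, MvPolynomial.aeval (id : S → S) (MvPolynomial.pderiv i x) = 0 := by
    intro x hx
    rw [Algebra.Extension.cotangentComplex_mk, ← P.cotangentSpaceBasis.repr.map_eq_zero_iff,
      Finsupp.ext_iff]
    refine forall_congr' fun i => ?_
    have := P.cotangentSpaceBasis_repr_one_tmul x i
    rw [this]
    rfl
  have : Algebra.FormallySmooth R P.toExtension.Ring :=
    inferInstanceAs (Algebra.FormallySmooth R (MvPolynomial S R))
  rw [← Algebra.Extension.cotangentComplex_injective_iff P.toExtension, injective_iff_map_eq_zero]
  constructor
  · intro h x hx hd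
    have := h _ ((hc x hx).2 hd)
    rw [Algebra.Extension.Cotangent.mk_eq_zero_iff] at this
    exact (congrArg (fun I : Ideal (MvPolynomial S R) => x ∈ I ^ 2) hker).mp this
  · intro h z hz
    obtain ⟨⟨x, hx⟩, rfl⟩ := Algebra.Extension.Cotangent.mk_surjective z
    rw [Algebra.Extension.Cotangent.mk_eq_zero_iff]
    exact (congrArg (fun I : Ideal (MvPolynomial S R) => x ∈ I ^ 2) hker).mpr
      (h x hx ((hc x hx).1 hz))

/-- Separable field extensions are formally smooth. -/
theorem IsSepExt.formallySmooth {F E : Type*} [Field F] [Field E] [Algebra F E]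
    (h : IsSepExt F E) : Algebra.FormallySmooth F E := by
  classical
  refine ⟨inferInstance, (subsingleton_h1Cotangent_iff F E).2 fun x hx hd => ?_⟩
  let s : Finset E := x.vars
  let E₀ := IntermediateField.adjoin F (s : Set E)
  obtain ⟨b, hb, hsep⟩ := h s
  have : Algebra.FormallySmooth F E₀ := by
    have hr : Set.range ((↑) : b → E₀) = b := Subtype.range_coe
    have : Algebra.IsSeparable
        (IntermediateField.adjoin F (Set.range ((↑) : b → E₀))) E₀ := by rw [hr]; exact hsep
    exact Algebra.FormallySmooth.of_algebraicIndependent_of_isSeparable hb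
  have h0 := (subsingleton_h1Cotangent_iff F E₀).1 this.subsingleton_h1Cotangent
  have hinj : Function.Injective (algebraMap E₀ E) := (algebraMap E₀ E).injective
  obtain ⟨x₀, hx₀⟩ := MvPolynomial.exists_rename_eq_of_vars_subset_range x (algebraMap E₀ E) hinj
    (by
      intro y hy
      exact ⟨⟨y, IntermediateField.subset_adjoin F _ hy⟩, rfl⟩)
  rw [← hx₀] at hx hd ⊢
  have hev : ∀ q : MvPolynomial E₀ F, MvPolynomial.aeval (id : E → E)
      (MvPolynomial.rename (algebraMap E₀ E) q) =
      algebraMap E₀ E (MvPolynomial.aeval (id : E₀ → E₀) q) := by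
    intro q
    rw [MvPolynomial.aeval_rename, ← MvPolynomial.aeval_algebraMap_apply]
    rfl
  have h1 : x₀ ∈ (RingHom.ker (MvPolynomial.aeval (R := F) (id : E₀ → E₀))) ^ 2 := by
    refine h0 x₀ ?_ fun i => ?_
    · rw [hev] at hx
      exact hinj (hx.trans (map_zero _).symm)
    · have := hd (algebraMap E₀ E i)
      rw [MvPolynomial.pderiv_rename hinj, hev] at this
      exact hinj (this.trans (map_zero _).symm)
  have h2 := Ideal.mem_map_of_mem (MvPolynomial.rename (algebraMap E₀ E)).toRingHom h1
  rw [Ideal.map_pow] at h2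
  refine Ideal.pow_right_mono ?_ 2 h2
  rw [Ideal.map_le_iff_le_comap]
  intro q hq
  change MvPolynomial.aeval _ _ = _
  change _ = _ at hq
  change MvPolynomial.aeval (id : E → E) (MvPolynomial.rename (algebraMap E₀ E) q) = 0
  rw [hev]
  have : MvPolynomial.aeval (id : E₀ → E₀) q = 0 := hq
  rw [this, map_zero]

end Smooth

end Paper

namespace Paper

section

open scoped TensorProduct

section Lifting

theorem exists_one_tmul {R A R' : Type*} [CommRing R] [CommRing A] [CommRing R'] [Algebra R A]
    [Algebra R R'] (hs : Function.Surjective (algebraMap R R')) (z : R' ⊗[R] A) :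
    ∃ a : A, z = 1 ⊗ₜ[R] a := by
  induction z with
  | zero => exact ⟨0, by simp⟩
  | tmul r a =>
    obtain ⟨r, rfl⟩ := hs r
    exact ⟨r • a, by rw [TensorProduct.tmul_smul, TensorProduct.smul_tmul',
      Algebra.smul_def, mul_one]⟩
  | add x y hx hy =>
    obtain ⟨a, rfl⟩ := hx
    obtain ⟨b, rfl⟩ := hy
    exact ⟨a + b, by rw [TensorProduct.tmul_add]⟩

theorem formallySmooth_tensor_of_square_zero {R A R₁ R₂ : Type*} [CommRing R] [CommRing A]
    [CommRing R₁] [CommRing R₂] [Algebra R A] [Algebra R R₁] [Algebra R R₂] [Module.Flat R A]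
    (g : R₁ →ₐ[R] R₂) (hg : Function.Surjective g) (sq0 : RingHom.ker g ^ 2 = ⊥)
    (h : Algebra.FormallySmooth R₂ (R₂ ⊗[R] A)) : Algebra.FormallySmooth R₁ (R₁ ⊗[R] A) := by
  rw [← RingHom.formallySmooth_algebraMap]
  refine RingHom.FormallySmooth.of_flat_of_ker_eq_map_of_square_zero
    (algebraMap R₁ (R₁ ⊗[R] A)) ?_ g.toRingHom
    (Algebra.TensorProduct.map g (AlgHom.id R A)).toRingHom (algebraMap R₂ (R₂ ⊗[R] A)) hg ?_ ?_
    sq0 ?_ ?_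
  · rw [RingHom.flat_algebraMap_iff]
    infer_instance
  · exact TensorProduct.map_surjective hg Function.surjective_id
  · ext x
    simp
  · exact Algebra.TensorProduct.rTensor_ker g hg
  · rwa [RingHom.formallySmooth_algebraMap]

theorem formallySmooth_tensor_of_surjective {R A k E : Type*} [CommRing R] [CommRing A]
    [CommRing k] [CommRing E] [Algebra R A] [Algebra R k] [Algebra k E] [Algebra R E]
    [IsScalarTower R k E] (hk : Function.Surjective (algebraMap R k)) (π : R)
    (f : A →ₐ[R] E) (hf : Function.Surjective f) (hkπ : algebraMap R k π = 0)
    (hπ : RingHom.ker f ≤ Ideal.span {algebraMap R A π})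
    (h : Algebra.FormallySmooth k E) : Algebra.FormallySmooth k (k ⊗[R] A) := by
  let φ : k ⊗[R] A →ₐ[k] E :=
    Algebra.TensorProduct.lift (Algebra.ofId k E) f (fun _ _ => Commute.all _ _)
  have hφ : ∀ a, φ (1 ⊗ₜ a) = f a := fun a => by simp [φ]
  have hb : Function.Bijective φ := by
    constructor
    · rw [injective_iff_map_eq_zero]
      intro z hz
      obtain ⟨a, rfl⟩ := exists_one_tmul hk z
      rw [hφ] at hz
      obtain ⟨b, rfl⟩ := Ideal.mem_span_singleton.1 (hπ hz)
      rw [← Algebra.smul_def, TensorProduct.tmul_smul, TensorProduct.smul_tmul',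
        Algebra.smul_def, hkπ]
      simp
    · intro e
      obtain ⟨a, rfl⟩ := hf e
      exact ⟨_, hφ a⟩
  exact Algebra.FormallySmooth.of_equiv (AlgEquiv.ofBijective φ hb).symm

theorem formallySmooth_tensor_quotient {R A k : Type*} [CommRing R] [CommRing A]
    [CommRing k] [Algebra R A] [Algebra R k] [Module.Flat R A] (π : R)
    (hk : Function.Surjective (algebraMap R k)) (hπ : RingHom.ker (algebraMap R k) = Ideal.span {π})
    (h : Algebra.FormallySmooth k (k ⊗[R] A)) (n : ℕ) :
    Algebra.FormallySmooth (R ⧸ Ideal.span {π ^ (n + 1)})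
      ((R ⧸ Ideal.span {π ^ (n + 1)}) ⊗[R] A) := by
  induction n with
  | zero =>
    have hle : ∀ a ∈ Ideal.span {π ^ (0 + 1)}, Algebra.ofId R k a = 0 := by
      intro a ha
      rw [zero_add, pow_one, ← hπ] at ha
      exact ha
    refine formallySmooth_tensor_of_square_zero (Ideal.Quotient.liftₐ _ _ hle) ?_ ?_ h
    · intro y
      obtain ⟨x, rfl⟩ := hk y
      exact ⟨Ideal.Quotient.mk _ x, rfl⟩
    · rw [eq_bot_iff]
      refine (Ideal.pow_le_self two_ne_zero).trans ?_
      intro z hz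
      obtain ⟨z, rfl⟩ := Ideal.Quotient.mk_surjective z
      have : z ∈ RingHom.ker (algebraMap R k) := hz
      rw [hπ] at this
      refine Ideal.mem_bot.2 (Ideal.Quotient.eq_zero_iff_mem.2 ?_)
      rwa [zero_add, pow_one]
  | succ n ih =>
    have hle : Ideal.span {π ^ (n + 1 + 1)} ≤ Ideal.span {π ^ (n + 1)} :=
      Ideal.span_singleton_le_span_singleton.2 (pow_dvd_pow π (Nat.le_succ _))
    refine formallySmooth_tensor_of_square_zero (Ideal.Quotient.factorₐ R hle)
      (Ideal.Quotient.factor_surjective hle) ?_ ih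
    have hker : RingHom.ker (Ideal.Quotient.factorₐ R hle) ≤
        Ideal.span {Ideal.Quotient.mk (Ideal.span {π ^ (n + 1 + 1)}) (π ^ (n + 1))} := by
      intro z hz
      obtain ⟨z, rfl⟩ := Ideal.Quotient.mk_surjective z
      have : z ∈ Ideal.span {π ^ (n + 1)} := Ideal.Quotient.eq_zero_iff_mem.1 hz
      obtain ⟨c, rfl⟩ := Ideal.mem_span_singleton.1 this
      rw [map_mul]
      exact Ideal.mul_mem_right _ _ (Ideal.mem_span_singleton_self _)
    rw [eq_bot_iff]
    refine (Ideal.pow_right_mono hker 2).trans ?_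
    rw [Ideal.span_singleton_pow, Ideal.span_le, Set.singleton_subset_iff]
    refine Ideal.mem_bot.2 ?_
    rw [← map_pow]
    refine Ideal.Quotient.eq_zero_iff_mem.2 (Ideal.mem_span_singleton.2 ?_)
    rw [← pow_mul]
    exact pow_dvd_pow π (by omega)

/-- Lifting a homomorphism to `B / π B` from a `π`-adically formally smooth algebra to
`B / π ^ n B`. -/
theorem nonempty_algHom_quotient_pow {R A k B B' : Type*} [CommRing R] [CommRing A]
    [CommRing k] [CommRing B] [CommRing B'] [Algebra R A] [Algebra R k] [Algebra R B]
    [Algebra R B'] [Module.Flat R A] (π : R)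
    (hk : Function.Surjective (algebraMap R k)) (hπ : RingHom.ker (algebraMap R k) = Ideal.span {π})
    (h : Algebra.FormallySmooth k (k ⊗[R] A)) (q : B →ₐ[R] B') (hq : Function.Surjective q)
    (hker : RingHom.ker q = Ideal.span {algebraMap R B π}) (f : A →ₐ[R] B') (n : ℕ) :
    Nonempty (A →ₐ[R] B ⧸ Ideal.span {algebraMap R B π ^ (n + 1)}) := by
  let I := Ideal.span {π ^ (n + 1)}
  let J := Ideal.span {algebraMap R B π ^ (n + 1)}
  have := formallySmooth_tensor_quotient π hk hπ h n
  have hπ0 : algebraMap R B' π = 0 := by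
    rw [← q.commutes]
    exact hker.ge (Ideal.mem_span_singleton_self _)
  have hB' : ∀ a ∈ I, Algebra.ofId R B' a = 0 := by
    intro a ha
    obtain ⟨c, rfl⟩ := Ideal.mem_span_singleton.1 ha
    rw [map_mul, map_pow, Algebra.ofId_apply, hπ0]
    simp
  have hB : ∀ a ∈ I, Algebra.ofId R (B ⧸ J) a = 0 := by
    intro a ha
    obtain ⟨c, rfl⟩ := Ideal.mem_span_singleton.1 ha
    change Ideal.Quotient.mk J (algebraMap R B _) = 0
    rw [Ideal.Quotient.eq_zero_iff_mem, map_mul, map_pow]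
    exact Ideal.mul_mem_right _ _ (Ideal.mem_span_singleton_self _)
  have hqJ : ∀ b ∈ J, q b = 0 := by
    intro b hb
    obtain ⟨c, rfl⟩ := Ideal.mem_span_singleton.1 hb
    rw [map_mul, map_pow, q.commutes, hπ0]
    simp
  let qJ : (B ⧸ J) →ₐ[R] B' := Ideal.Quotient.liftₐ J q hqJ
  let : Algebra (R ⧸ I) B' := (Ideal.Quotient.liftₐ I _ hB').toRingHom.toAlgebra
  let : Algebra (R ⧸ I) (B ⧸ J) := (Ideal.Quotient.liftₐ I _ hB).toRingHom.toAlgebra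
  have : IsScalarTower R (R ⧸ I) B' := IsScalarTower.of_algebraMap_eq fun x => rfl
  have : IsScalarTower R (R ⧸ I) (B ⧸ J) := IsScalarTower.of_algebraMap_eq fun x => rfl
  let g : (B ⧸ J) →ₐ[R ⧸ I] B' := { qJ with
    commutes' := by
      intro r
      obtain ⟨r, rfl⟩ := Ideal.Quotient.mk_surjective r
      exact q.commutes r }
  let φ : (R ⧸ I) ⊗[R] A →ₐ[R ⧸ I] B' :=
    Algebra.TensorProduct.lift (Algebra.ofId _ _) f (fun _ _ => Commute.all _ _)
  have hgs : Function.Surjective g := by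
    intro y
    obtain ⟨x, rfl⟩ := hq y
    exact ⟨Ideal.Quotient.mk J x, rfl⟩
  have hnil : IsNilpotent (RingHom.ker (g : (B ⧸ J) →+* B')) := by
    refine ⟨n + 1, ?_⟩
    have hle : RingHom.ker (g : (B ⧸ J) →+* B') ≤
        Ideal.span {Ideal.Quotient.mk J (algebraMap R B π)} := by
      intro z hz
      obtain ⟨z, rfl⟩ := Ideal.Quotient.mk_surjective z
      have : z ∈ RingHom.ker q := hz
      rw [hker] at this
      obtain ⟨c, rfl⟩ := Ideal.mem_span_singleton.1 this
      rw [map_mul]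
      exact Ideal.mul_mem_right _ _ (Ideal.mem_span_singleton_self _)
    rw [Ideal.zero_eq_bot, eq_bot_iff]
    refine (Ideal.pow_right_mono hle _).trans ?_
    rw [Ideal.span_singleton_pow, Ideal.span_le, Set.singleton_subset_iff, ← map_pow]
    exact Ideal.mem_bot.2 (Ideal.Quotient.eq_zero_iff_mem.2 (Ideal.mem_span_singleton_self _))
  let ψ : (R ⧸ I) ⊗[R] A →ₐ[R ⧸ I] (B ⧸ J) :=
    Algebra.FormallySmooth.liftOfSurjective φ g hgs hnil
  exact ⟨(ψ.restrictScalars R).comp Algebra.TensorProduct.includeRight⟩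

end Lifting

end

end Paper

namespace Paper

section

open scoped TensorProduct

section Approximation

theorem exists_approximate_solution {R A B k E k' : Type u} [CommRing R] [CommRing A] [CommRing B]
    [CommRing k] [CommRing E] [CommRing k'] [Algebra R A] [Algebra R B] [Algebra R k]
    [Module.Flat R A] (π : R) (gA : k →+* E) (gB : k →+* k') (rA : A →+* E) (rB : B →+* k')
    (hA : ∀ r, rA (algebraMap R A r) = gA (algebraMap R k r))
    (hB : ∀ r, rB (algebraMap R B r) = gB (algebraMap R k r))
    (hk : Function.Surjective (algebraMap R k)) (hrA : Function.Surjective rA)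
    (hrB : Function.Surjective rB)
    (kerk : RingHom.ker (algebraMap R k) = Ideal.span {π})
    (kerA : RingHom.ker rA = Ideal.span {algebraMap R A π})
    (kerB : RingHom.ker rB = Ideal.span {algebraMap R B π})
    (hsm : gA.FormallySmooth)
    (hth : ThRingSub (fun {k} φ => IsExists φ) E gA k' gB)
    {σ : Type*} (S : Finset (MvPolynomial σ R)) (xs : σ → A)
    (hxs : ∀ P ∈ S, MvPolynomial.aeval xs P = 0) (n : ℕ) :
    ∃ ys : σ → B, ∀ P ∈ S, algebraMap R B π ^ (n + 1) ∣ MvPolynomial.aeval ys P := by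
  classical
  let ι := Finset (MvPolynomial E k)
  let l : Filter ι := Filter.atTop
  have hsol : ∀ i : ι, ∃ ys : E → k', ∀ P ∈ i, MvPolynomial.eval₂ gA id P = 0 →
      MvPolynomial.eval₂ gB ys P = 0 := by
    intro i
    obtain ⟨ys, hys⟩ := exists_solution_of_thRingSub gA gB hth
      (i.filter fun P => MvPolynomial.eval₂ gA id P = 0) id
      (fun P hP => (Finset.mem_filter.1 hP).2)
    exact ⟨ys, fun P hP h => hys P (Finset.mem_filter.2 ⟨hP, h⟩)⟩
  choose Y hY using hsol
  have hev : ∀ P : MvPolynomial E k, MvPolynomial.eval₂ gA id P = 0 →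
      ∀ᶠ i in l, MvPolynomial.eval₂ gB (Y i) P = 0 := by
    intro P hP
    filter_upwards [Filter.eventually_ge_atTop ({P} : Finset (MvPolynomial E k))] with i hi
    exact hY i P (Finset.singleton_subset_iff.1 hi) hP
  let cB : (ι → B) →+* l.Germ B := Filter.Germ.coeRingHom l
  let ck : (ι → k') →+* l.Germ k' := Filter.Germ.coeRingHom l
  let θ : E →+* l.Germ k' :=
    { toFun := fun x => ((fun i => Y i x : ι → k') : l.Germ k')
      map_one' := by
        refine Filter.Germ.coe_eq.2 ?_
        filter_upwards [hev (MvPolynomial.X 1 - 1) (by simp)] with i hi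
        simpa [sub_eq_zero] using hi
      map_zero' := by
        refine Filter.Germ.coe_eq.2 ?_
        filter_upwards [hev (MvPolynomial.X 0) (by simp)] with i hi
        simpa using hi
      map_mul' := fun a b => by
        refine Filter.Germ.coe_eq.2 ?_
        filter_upwards [hev (MvPolynomial.X (a * b) - MvPolynomial.X a * MvPolynomial.X b)
          (by simp)] with i hi
        simpa [sub_eq_zero] using hi
      map_add' := fun a b => by
        refine Filter.Germ.coe_eq.2 ?_
        filter_upwards [hev (MvPolynomial.X (a + b) - (MvPolynomial.X a + MvPolynomial.X b))
          (by simp)] with i hi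
        simpa [sub_eq_zero] using hi }
  have hθ : ∀ r : k, θ (gA r) = ck (fun _ => gB r) := by
    intro r
    refine Filter.Germ.coe_eq.2 ?_
    filter_upwards [hev (MvPolynomial.X (gA r) - MvPolynomial.C r) (by simp)] with i hi
    simpa [sub_eq_zero] using hi
  let Bm : Type u := l.Germ B
  let : CommRing Bm := inferInstanceAs (CommRing (l.Germ B))
  let km : Type u := l.Germ k'
  let : CommRing km := inferInstanceAs (CommRing (l.Germ k'))
  let : Algebra R Bm := (cB.comp (algebraMap R (ι → B))).toAlgebra
  let : Algebra R km := (ck.comp (Pi.ringHom fun _ => gB.comp (algebraMap R k))).toAlgebra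
  let q : Bm →ₐ[R] km :=
    { toFun := fun x => Filter.Germ.map rB x
      map_one' := by
        refine Filter.Germ.coe_eq.2 (Filter.Eventually.of_forall fun i => ?_)
        exact map_one rB
      map_zero' := by
        refine Filter.Germ.coe_eq.2 (Filter.Eventually.of_forall fun i => ?_)
        exact map_zero rB
      map_mul' := fun a b => by
        refine Filter.Germ.inductionOn₂ a b fun a b => ?_
        refine Filter.Germ.coe_eq.2 (Filter.Eventually.of_forall fun i => ?_)
        exact map_mul rB _ _
      map_add' := fun a b => by
        refine Filter.Germ.inductionOn₂ a b fun a b => ?_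
        refine Filter.Germ.coe_eq.2 (Filter.Eventually.of_forall fun i => ?_)
        exact map_add rB _ _
      commutes' := fun r => by
        refine Filter.Germ.coe_eq.2 (Filter.Eventually.of_forall fun i => ?_)
        exact hB r }
  have hq : Function.Surjective q := by
    intro x
    refine Filter.Germ.inductionOn x fun x => ?_
    choose y hy using hrB
    refine ⟨((fun i => y (x i) : ι → B) : l.Germ B), ?_⟩
    refine Filter.Germ.coe_eq.2 (Filter.Eventually.of_forall fun i => ?_)
    exact hy _
  have hker : RingHom.ker q = Ideal.span {algebraMap R Bm π} := by
    apply le_antisymm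
    · intro x
      refine Filter.Germ.inductionOn x fun x hx => ?_
      have hx' : ∀ᶠ i in l, rB (x i) = 0 := Filter.Germ.coe_eq.1 hx
      rw [Ideal.mem_span_singleton]
      have : ∀ i, ∃ c, rB (x i) = 0 → x i = algebraMap R B π * c := by
        intro i
        by_cases h : rB (x i) = 0
        · have : x i ∈ RingHom.ker rB := h
          rw [kerB] at this
          obtain ⟨c, hc⟩ := Ideal.mem_span_singleton.1 this
          exact ⟨c, fun _ => hc⟩
        · exact ⟨0, fun h' => absurd h' h⟩
      choose c hc using this
      refine ⟨(c : l.Germ B), Filter.Germ.coe_eq.2 ?_⟩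
      filter_upwards [hx'] with i hi
      exact hc i hi
    · rw [Ideal.span_le, Set.singleton_subset_iff]
      refine Filter.Germ.coe_eq.2 (Filter.Eventually.of_forall fun i => ?_)
      exact kerB.ge (Ideal.mem_span_singleton_self _)
  let f : A →ₐ[R] km :=
    { θ.comp rA with
      commutes' := fun r => by
        change θ (rA _) = _
        rw [hA, hθ]
        rfl }
  let : Algebra k E := gA.toAlgebra
  have hsm' : Algebra.FormallySmooth k E := hsm
  let : Algebra R E := (gA.comp (algebraMap R k)).toAlgebra
  have : IsScalarTower R k E := IsScalarTower.of_algebraMap_eq fun _ => rfl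
  have hten : Algebra.FormallySmooth k (k ⊗[R] A) :=
    formallySmooth_tensor_of_surjective hk π ({ rA with commutes' := hA } : A →ₐ[R] E) hrA
      (kerk.ge (Ideal.mem_span_singleton_self _)) kerA.le hsm'
  obtain ⟨φ⟩ := nonempty_algHom_quotient_pow π hk kerk hten q hq hker f n
  have hlift : ∀ j, ∃ y : ι → B, φ (xs j) = Ideal.Quotient.mk _ (cB y) := by
    intro j
    obtain ⟨y, hy⟩ := Ideal.Quotient.mk_surjective (φ (xs j))
    obtain ⟨z, hz⟩ : ∃ z : ι → B, cB z = y := Filter.Germ.inductionOn y fun z => ⟨z, rfl⟩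
    exact ⟨z, by rw [hz, hy]⟩
  choose y hy using hlift
  let cB' : (ι → B) →ₐ[R] Bm := { cB with commutes' := fun _ => rfl }
  have hS : ∀ P ∈ S, ∀ᶠ i in l, algebraMap R B π ^ (n + 1) ∣
      MvPolynomial.aeval (fun j => y j i) P := by
    intro P hP
    have h1 : Ideal.Quotient.mkₐ R (Ideal.span {algebraMap R Bm π ^ (n + 1)})
        (cB' (MvPolynomial.aeval y P)) = 0 := by
      rw [← AlgHom.comp_apply, ← AlgHom.comp_apply, MvPolynomial.comp_aeval,
        ← map_zero φ, ← hxs P hP, ← AlgHom.comp_apply, MvPolynomial.comp_aeval]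
      congr 2
      ext j
      exact (hy j).symm
    obtain ⟨c, hc⟩ := Ideal.mem_span_singleton.1 (Ideal.Quotient.eq_zero_iff_mem.1 h1)
    revert hc
    refine Filter.Germ.inductionOn c fun c hc => ?_
    have hc' : ∀ᶠ i in l, MvPolynomial.aeval y P i = algebraMap R B π ^ (n + 1) * c i :=
      Filter.Germ.coe_eq.1 hc
    filter_upwards [hc'] with i hi
    refine ⟨c i, ?_⟩
    rw [← hi]
    have := MvPolynomial.comp_aeval_apply y (Pi.evalAlgHom R (fun _ : ι => B) i) P
    exact this.symm
  have hall : ∀ᶠ i in l, ∀ P ∈ S, algebraMap R B π ^ (n + 1) ∣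
      MvPolynomial.aeval (fun j => y j i) P := (Filter.eventually_all_finset S).2 hS
  obtain ⟨i, hi⟩ := hall.exists
  exact ⟨_, hi⟩

end Approximation

end

end Paper

namespace Paper

section Uniformizer

variable {K : Type*} [Field K] {Γ : Type*} [LinearOrderedCommGroupWithZero Γ] {v : Valuation K Γ}
  {π : K}

theorem IsUniformizer.exists_eq_pow (hπ : IsUniformizer v π) {x : K} {n : ℕ}
    (hn : v π ^ n ≤ v x) (hx : v x ≤ 1) : ∃ e : ℕ, v x = v π ^ e := by
  obtain ⟨hπ0, hπ1, hπm⟩ := hπ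
  have hne : π ≠ 0 := by
    rintro rfl
    simp at hπ0
  induction n with
  | zero => exact ⟨0, le_antisymm (by simpa using hx) (by simpa using hn)⟩
  | succ n ih =>
    by_cases h : v π ^ n ≤ v x
    · exact ih h
    · refine ⟨n + 1, le_antisymm ?_ hn⟩
      have h1 : v (x / π ^ n) < 1 := by
        rw [map_div₀, map_pow, div_lt_one₀ (pow_pos hπ0 n)]
        exact not_le.1 h
      have h2 := hπm _ h1
      rw [map_div₀, map_pow, div_le_iff₀ (pow_pos hπ0 n)] at h2
      rwa [pow_succ']

theorem IsUniformizer.exists_eq_zpow (hπ : IsUniformizer v π) {x : K} {n m : ℕ}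
    (hn : v π ^ n ≤ v x) (hm : v π ^ m * v x ≤ 1) : ∃ e : ℤ, v x = v π ^ e := by
  have h1 : v π ^ (n + m) ≤ v (π ^ m * x) := by
    rw [map_mul, map_pow, pow_add, mul_comm]
    gcongr
  obtain ⟨e, he⟩ := hπ.exists_eq_pow h1 (by rwa [map_mul, map_pow])
  refine ⟨(e : ℤ) - m, ?_⟩
  rw [map_mul, map_pow] at he
  rw [zpow_sub₀ hπ.1.ne', zpow_natCast, zpow_natCast, ← he, mul_div_cancel_left₀ _
    (pow_pos hπ.1 m).ne']

theorem ker_resMap {q : ℕ} (hπ : IsUniformizer v (q : K)) :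
    RingHom.ker (resMap v) = Ideal.span {(q : v.valuationSubring)} := by
  have hne : (q : K) ≠ 0 := by
    intro h
    have := hπ.1
    simp [h] at this
  ext x
  rw [RingHom.mem_ker, IsLocalRing.residue_eq_zero_iff, IsLocalRing.mem_maximalIdeal,
    mem_nonunits_iff, Ideal.mem_span_singleton]
  have hunit : ∀ y : v.valuationSubring, ¬ IsUnit y ↔ v (y : K) < 1 := by
    intro y
    have h := (Valuation.valuationSubring v).valuation_lt_one_iff y
    have h1 := (v.isEquiv_valuation_valuationSubring).lt_one_iff_lt_one (x := (y : K))
    rw [h1, ← h, IsLocalRing.mem_maximalIdeal, mem_nonunits_iff]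
  rw [hunit]
  constructor
  · intro h
    refine ⟨⟨(x : K) / q, ?_⟩, Subtype.ext ?_⟩
    · change v _ ≤ 1
      rw [map_div₀, div_le_one₀ hπ.1]
      exact hπ.2.2 _ h
    · push_cast
      rw [mul_div_cancel₀ _ hne]
  · rintro ⟨c, rfl⟩
    push_cast
    rw [map_mul]
    exact mul_lt_one_of_lt_of_le hπ.2.1 c.2

theorem isDiscreteValuationRing_valuationSubring {C : Type*} [Field C] {u : Valuation C Zm0}
    {q : ℕ} (hπ : IsUniformizer u (q : C)) : IsDiscreteValuationRing u.valuationSubring := by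
  refine IsDiscreteValuationRing.ofHasUnitMulPowIrreducibleFactorization ?_
  have hker := ker_resMap hπ
  rw [IsLocalRing.ker_residue] at hker
  have hq0 : (q : u.valuationSubring) ≠ 0 := by
    intro h
    have h1 := congrArg (fun z : u.valuationSubring => (z : C)) h
    have := hπ.1
    push_cast at h1
    simp [h1] at this
  have hprime : Prime (q : u.valuationSubring) := by
    rw [← Ideal.span_singleton_prime hq0, ← hker]
    infer_instance
  refine ⟨q, hprime.irreducible, fun {x} hx => ?_⟩
  have hx0 : (x : C) ≠ 0 := fun h => hx (Subtype.ext h)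
  obtain ⟨n, hn⟩ := exists_pow_lt₀ hπ.2.1 (Units.mk0 (u x) (u.ne_zero_iff.2 hx0))
  obtain ⟨e, he⟩ := hπ.exists_eq_pow hn.le x.2
  have hqe : (q : C) ^ e ≠ 0 := by
    intro h
    rw [← map_pow, h, map_zero, u.zero_iff] at he
    exact hx0 he
  have h1 : u ((x : C) / q ^ e) = 1 := by
    rw [map_div₀, map_pow, he, div_self (pow_pos hπ.1 e).ne']
  refine ⟨e, associated_of_dvd_dvd ⟨⟨(x : C) / q ^ e, h1.le⟩, Subtype.ext ?_⟩
    ⟨⟨((x : C) / q ^ e)⁻¹, ?_⟩, Subtype.ext ?_⟩⟩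
  · push_cast
    rw [mul_div_cancel₀ _ hqe]
  · change u _ ≤ 1
    rw [map_inv₀, h1, inv_one]
  · push_cast
    field_simp

end Uniformizer

end Paper

namespace Paper

section ValuedApproximation

theorem exists_clear_coefficients {C : Type*} [Field C] (R : Subring C) (π : R)
    (hb : ∀ c : C, ∃ n : ℕ, (π : C) ^ n * c ∈ R) {σ : Type*} (Q : MvPolynomial σ C) :
    ∃ (m : ℕ) (P : MvPolynomial σ R),
      MvPolynomial.map R.subtype P = MvPolynomial.C ((π : C) ^ m) * Q := by
  induction Q using MvPolynomial.induction_on with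
  | C c =>
    obtain ⟨n, hn⟩ := hb c
    refine ⟨n, MvPolynomial.C ⟨(π : C) ^ n * c, hn⟩, ?_⟩
    rw [MvPolynomial.map_C, ← map_mul]
    rfl
  | add P Q hP hQ =>
    obtain ⟨m, P', hP'⟩ := hP
    obtain ⟨n, Q', hQ'⟩ := hQ
    refine ⟨n + m, MvPolynomial.C (π ^ n) * P' + MvPolynomial.C (π ^ m) * Q', ?_⟩
    rw [map_add, map_mul, map_mul, hP', hQ', MvPolynomial.map_C, MvPolynomial.map_C, map_pow,
      map_pow, Subring.subtype_apply]
    simp only [map_pow, Subring.subtype_apply]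
    ring
  | mul_X P i hP =>
    obtain ⟨m, P', hP'⟩ := hP
    exact ⟨m, P' * MvPolynomial.X i, by rw [map_mul, hP', MvPolynomial.map_X, mul_assoc]⟩

theorem exists_valued_approximation (p : ℕ)
    (C : Type u) [Field C] (u : Valuation C Zm0) (hπu : IsUniformizer u (p : C))
    (K : Type u) [Field K] [Algebra C K]
    (ΓK : Type u) [LinearOrderedCommGroupWithZero ΓK] (v : Valuation K ΓK)
    (hKC : (v.comap (algebraMap C K)).IsEquiv u) (hπv : IsUniformizer v (p : K))
    (L : Type u) [Field L] [Algebra C L]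
    (ΓL : Type u) [LinearOrderedCommGroupWithZero ΓL] (w : Valuation L ΓL)
    (hLC : (w.comap (algebraMap C L)).IsEquiv u) (hπw : IsUniformizer w (p : L))
    (gK : ResF u →+* ResF v) (hgK : ResCompat u v gK) (hsepK : IsSepExtHom gK)
    (gL : ResF u →+* ResF w) (hgL : ResCompat u w gL)
    (hres : ThRingSub (fun {k} φ => IsExists φ) (ResF v) gK (ResF w) gL)
    (F : IntermediateField C K) (hF : ∀ z ∈ F, ∃ n : ℕ, v p ^ n * v z ≤ 1)
    (T : Finset (MvPolynomial F C))
    (hT : ∀ P ∈ T, v (MvPolynomial.aeval (Subtype.val : F → K) P) ≤ 1) :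
    ∃ ys : F → L, ∀ P ∈ T, w (MvPolynomial.aeval ys P) ≤ 1 ∧
      (MvPolynomial.aeval (Subtype.val : F → K) P = 0 → w (MvPolynomial.aeval ys P) < 1) ∧
      (v (MvPolynomial.aeval (Subtype.val : F → K) P) = 1 → w (MvPolynomial.aeval ys P) = 1) := by
  classical
  let R := u.valuationSubring
  let A := v.valuationSubring
  let B := w.valuationSubring
  have hK1 : ∀ c : C, v (algebraMap C K c) ≤ 1 ↔ u c ≤ 1 := fun c => by
    have := hKC c 1
    simpa using this
  have hL1 : ∀ c : C, w (algebraMap C L c) ≤ 1 ↔ u c ≤ 1 := fun c => by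
    have := hLC c 1
    simpa using this
  let iA : R →+* A := ((algebraMap C K).comp R.subtype).codRestrict A (fun r => (hK1 r).2 r.2)
  let iB : R →+* B := ((algebraMap C L).comp R.subtype).codRestrict B (fun r => (hL1 r).2 r.2)
  let : Algebra R A := iA.toAlgebra
  let : Algebra R B := iB.toAlgebra
  have hiA : ∀ r : R, ((algebraMap R A r : A) : K) = algebraMap C K r := fun r => rfl
  have hiB : ∀ r : R, ((algebraMap R B r : B) : L) = algebraMap C L r := fun r => rfl
  have := isDiscreteValuationRing_valuationSubring hπu
  have : Module.IsTorsionFree R A := by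
    rw [Module.isTorsionFree_iff_algebraMap_injective]
    intro r s hrs
    exact Subtype.ext ((algebraMap C K).injective (congrArg Subtype.val hrs))
  have hflat : Module.Flat R A := inferInstance
  have hkerR : RingHom.ker (algebraMap R (ResF u)) = Ideal.span {(p : R)} := ker_resMap hπu
  have hkerA : RingHom.ker (resMap v) = Ideal.span {algebraMap R A (p : R)} := by
    rw [ker_resMap hπv, map_natCast]
  have hkerB : RingHom.ker (resMap w) = Ideal.span {algebraMap R B (p : R)} := by
    rw [ker_resMap hπw, map_natCast]
  have hsm : gK.FormallySmooth := by
    let : Algebra (ResF u) (ResF v) := gK.toAlgebra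
    exact IsSepExt.formallySmooth hsepK
  have hb : ∀ c : C, ∃ n : ℕ, u (p : C) ^ n * u c ≤ 1 := by
    intro c
    obtain ⟨n, hn⟩ := hF _ (F.algebraMap_mem c)
    refine ⟨n, ?_⟩
    rw [← map_pow, ← map_mul, ← hK1]
    simpa using hn
  have hpK : (p : K) ≠ 0 := fun h => by simpa [h] using hπv.1
  have hpC : (p : C) ≠ 0 := fun h => by simpa [h] using hπu.1
  have hpL : (p : L) ≠ 0 := fun h => by simpa [h] using hπw.1
  have hF' : ∀ a : F, ∃ n : ℕ, v p ^ n * v a ≤ 1 := fun a => hF a a.2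
  choose n hn using hF'
  let α : F → A := fun a => ⟨p ^ n a * a, by
    change v _ ≤ 1
    rw [map_mul, map_pow]
    exact hn a⟩
  let sub : F → MvPolynomial A C := fun a => MvPolynomial.C ((p : C) ^ n a)⁻¹ * MvPolynomial.X (α a)
  have hsubK : ∀ P : MvPolynomial F C, MvPolynomial.aeval (Subtype.val : A → K)
      (MvPolynomial.aeval sub P) = MvPolynomial.aeval (Subtype.val : F → K) P := by
    intro P
    rw [MvPolynomial.comp_aeval_apply]
    congr 2
    ext a
    rw [map_mul, MvPolynomial.algHom_C, MvPolynomial.aeval_X, map_inv₀, map_pow, map_natCast]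
    change ((p : K) ^ n a)⁻¹ * (p ^ n a * a) = a
    rw [inv_mul_cancel_left₀ (pow_ne_zero _ hpK)]
  have hclear : ∀ P : MvPolynomial F C, ∃ (m : ℕ) (P' : MvPolynomial A R),
      MvPolynomial.map R.subtype P' = MvPolynomial.C ((p : C) ^ m) * MvPolynomial.aeval sub P := by
    intro P
    have hb' : ∀ c : C, ∃ n : ℕ, (((p : R.toSubring) : C)) ^ n * c ∈ R.toSubring := by
      intro c
      obtain ⟨n, hn⟩ := hb c
      refine ⟨n, ?_⟩
      change u _ ≤ 1
      push_cast
      rwa [map_mul, map_pow]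
    exact exists_clear_coefficients R.toSubring (p : R.toSubring) hb' (MvPolynomial.aeval sub P)
  choose m P' hP' using hclear
  have hcoeA : ∀ Q : MvPolynomial A R, ((MvPolynomial.aeval (id : A → A) Q : A) : K) =
      MvPolynomial.aeval (Subtype.val : A → K) (MvPolynomial.map R.subtype Q) := by
    intro Q
    change A.subtype _ = _
    rw [MvPolynomial.map_aeval, MvPolynomial.aeval_def, MvPolynomial.eval₂_map]
    rfl
  have hcoeB : ∀ (ys : A → B) (Q : MvPolynomial A R), ((MvPolynomial.aeval ys Q : B) : L) =
      MvPolynomial.aeval (fun a => (ys a : L)) (MvPolynomial.map R.subtype Q) := by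
    intro ys Q
    change B.subtype _ = _
    rw [MvPolynomial.map_aeval, MvPolynomial.aeval_def, MvPolynomial.eval₂_map]
    rfl
  let z : MvPolynomial F C → A := fun P =>
    if h : v (MvPolynomial.aeval (Subtype.val : F → K) P) ≤ 1 then ⟨_, h⟩ else 0
  have hz : ∀ P ∈ T, (z P : K) = MvPolynomial.aeval (Subtype.val : F → K) P := by
    intro P hP
    simp only [z, dif_pos (hT P hP)]
  let r₁ : MvPolynomial F C → MvPolynomial A R := fun P =>
    P' P - MvPolynomial.C ((p : R) ^ m P) * MvPolynomial.X (z P)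
  let r₂ : MvPolynomial F C → MvPolynomial A R := fun P =>
    if IsUnit (z P) then MvPolynomial.X (z P) * MvPolynomial.X (Ring.inverse (z P)) - 1 else 0
  obtain ⟨ys, hys⟩ := exists_approximate_solution (R := R) (A := A) (B := B) (p : R) gK gL
    (resMap v) (resMap w) (fun r => (hgK r _).symm) (fun r => (hgL r _).symm)
    (IsLocalRing.residue_surjective) (IsLocalRing.residue_surjective)
    (IsLocalRing.residue_surjective) hkerR hkerA hkerB hsm hres
    (T.image r₁ ∪ T.image r₂ ∪ {MvPolynomial.X 0}) (id : A → A) (by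
      intro P hP
      simp only [Finset.mem_union, Finset.mem_image, Finset.mem_singleton] at hP
      rcases hP with (⟨Q, hQ, rfl⟩ | ⟨Q, hQ, rfl⟩) | rfl
      · refine Subtype.ext ?_
        rw [hcoeA]
        simp only [r₁]
        rw [map_sub, map_sub, hP', map_mul, hsubK, map_mul, map_mul, MvPolynomial.map_C,
          MvPolynomial.map_X, MvPolynomial.aeval_X, hz Q hQ]
        simp
      · simp only [r₂]
        split_ifs with hu
        · simp [Ring.mul_inverse_cancel _ hu]
        · simp
      · simp) (T.sup m)
  have hdvd : ∀ b : B, algebraMap R B (p : R) ^ (T.sup m + 1) ∣ b →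
      w (b : L) ≤ w (p : L) ^ (T.sup m + 1) := by
    rintro b ⟨c, rfl⟩
    rw [map_natCast]
    push_cast
    rw [map_mul, map_pow]
    exact mul_le_of_le_one_right' c.2
  have hw1 : ∀ k, w (p : L) ^ (k + 1) < 1 := fun k => pow_lt_one₀ zero_le hπw.2.1 (by omega)
  refine ⟨fun a => ((p : L) ^ n a)⁻¹ * ys (α a), fun P hP => ?_⟩
  have hsubL : MvPolynomial.aeval (fun a => ((p : L) ^ n a)⁻¹ * ys (α a) : F → L) P =
      MvPolynomial.aeval (fun a => (ys a : L)) (MvPolynomial.aeval sub P) := by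
    rw [MvPolynomial.comp_aeval_apply]
    congr 2
    ext a
    rw [map_mul, MvPolynomial.algHom_C, MvPolynomial.aeval_X, map_inv₀, map_pow, map_natCast]
  have h1 : w (MvPolynomial.aeval (fun a => ((p : L) ^ n a)⁻¹ * ys (α a) : F → L) P - ys (z P))
      < 1 := by
    have h := hdvd _ (hys (r₁ P) (Finset.mem_union_left _ (Finset.mem_union_left _
      (Finset.mem_image_of_mem r₁ hP))))
    rw [hcoeB] at h
    simp only [r₁] at h
    rw [map_sub, map_sub, hP', map_mul, map_mul, map_mul, MvPolynomial.map_C,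
      MvPolynomial.map_X, MvPolynomial.aeval_X, ← hsubL, MvPolynomial.algHom_C,
      MvPolynomial.algHom_C] at h
    simp only [map_pow, map_natCast] at h
    rw [← mul_sub, map_mul, map_pow] at h
    have hm : m P ≤ T.sup m := Finset.le_sup hP
    obtain ⟨d, hd⟩ := Nat.exists_eq_add_of_le hm
    rw [hd, add_assoc, pow_add] at h
    exact (le_of_mul_le_mul_left h (pow_pos hπw.1 _)).trans_lt (hw1 d)
  have h0 : w (ys 0 : L) < 1 := by
    have h := hdvd _ (hys (MvPolynomial.X 0) (by simp))
    rw [MvPolynomial.aeval_X] at h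
    exact h.trans_lt (hw1 _)
  have hle : ∀ b c : L, w (b - c) < 1 → w c ≤ 1 → w b ≤ 1 := by
    intro b c hbc hc
    rw [← sub_add_cancel b c]
    exact (w.map_add _ _).trans (max_le hbc.le hc)
  have hlt : ∀ b c : L, w (b - c) < 1 → w c < 1 → w b < 1 := by
    intro b c hbc hc
    rw [← sub_add_cancel b c]
    exact w.map_add_lt hbc hc
  have heq : ∀ b c : L, w (b - c) < 1 → w c = 1 → w b = 1 := by
    intro b c hbc hc
    rw [← sub_add_cancel b c, w.map_add_eq_of_lt_right (by rwa [hc]), hc]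
  refine ⟨hle _ _ h1 (ys (z P)).2, fun h => hlt _ _ h1 ?_, fun h => heq _ _ h1 ?_⟩
  · have : z P = 0 := Subtype.ext ((hz P hP).trans h)
    rwa [this]
  · have hzu : IsUnit (z P) := by
      refine IsUnit.of_mul_eq_one ⟨(z P : K)⁻¹, ?_⟩ (Subtype.ext ?_)
      · change v _ ≤ 1
        rw [map_inv₀, hz P hP, h, inv_one]
      · push_cast
        refine mul_inv_cancel₀ fun h0 => ?_
        rw [hz P hP] at h0
        rw [h0, map_zero] at h
        exact zero_ne_one h
    have h2 := hdvd _ (hys (r₂ P) (Finset.mem_union_left _ (Finset.mem_union_right _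
      (Finset.mem_image_of_mem r₂ hP))))
    simp only [r₂, if_pos hzu] at h2
    rw [map_sub, map_mul, MvPolynomial.aeval_X, MvPolynomial.aeval_X, map_one] at h2
    push_cast at h2
    have h3 := heq _ _ (h2.trans_lt (hw1 _)) w.map_one
    rw [map_mul] at h3
    refine le_antisymm (ys (z P)).2 ?_
    rw [← h3]
    exact mul_le_of_le_one_right' (ys _).2

end ValuedApproximation

end Paper

namespace Paper

section SeparatingPresentation

open Polynomial

theorem exists_primitive_of_forall_isIntegral {N K : Type*} [Field N] [Field K] [Algebra N K]
    [CharZero N] (S : Finset K) (hS : ∀ z ∈ S, IsIntegral N z) :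
    ∃ y ∈ IntermediateField.adjoin N (S : Set K), IsIntegral N y ∧
      ∀ z ∈ S, z ∈ IntermediateField.adjoin N {y} := by
  have : FiniteDimensional N (IntermediateField.adjoin N (S : Set K)) :=
    IntermediateField.finiteDimensional_adjoin fun z hz => hS z hz
  obtain ⟨y, hy⟩ := Field.exists_primitive_element N (IntermediateField.adjoin N (S : Set K))
  refine ⟨y, y.2, (IsIntegral.of_finite N y).map (IntermediateField.val _), fun z hz => ?_⟩
  have h : (⟨z, IntermediateField.subset_adjoin _ _ hz⟩ : IntermediateField.adjoin N (S : Set K))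
      ∈ IntermediateField.adjoin N {y} := by
    rw [hy]; trivial
  have h' : z ∈ (IntermediateField.adjoin N {y}).map (IntermediateField.val _) := ⟨_, h, rfl⟩
  rwa [IntermediateField.adjoin_map, Set.image_singleton] at h'

theorem exists_algebraicIndependent_primitive {C K : Type*} [Field C] [Field K] [Algebra C K]
    [CharZero C] (F : IntermediateField C K) (S : Finset K) (hS : ∀ z ∈ S, z ∈ F) :
    ∃ t : Set K, t ⊆ F ∧ AlgebraicIndependent C (Subtype.val : t → K) ∧ ∃ y ∈ F,
      IsIntegral (IntermediateField.adjoin C (Set.range (Subtype.val : t → K))) y ∧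
      ∀ z ∈ S, z ∈ IntermediateField.adjoin
        (IntermediateField.adjoin C (Set.range (Subtype.val : t → K))) {y} := by
  obtain ⟨t, ht⟩ := (AlgebraicIndependent.matroid C K).exists_isBasis (S : Set K)
  rw [AlgebraicIndependent.matroid_isBasis_iff] at ht
  obtain ⟨hind, htS, halg⟩ := ht
  set N := IntermediateField.adjoin C (Set.range (Subtype.val : t → K)) with hN
  have hNF : N ≤ F := by
    rw [hN, IntermediateField.adjoin_le_iff, Subtype.range_val]
    exact fun z hz => hS z (htS hz)
  have hint : ∀ z ∈ S, IsIntegral N z := by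
    intro z hz
    have h := halg z hz
    have hle : Algebra.adjoin C t ≤ N.toSubalgebra := by
      rw [Algebra.adjoin_le_iff, hN, Subtype.range_val]
      exact IntermediateField.subset_adjoin _ _
    let : Algebra (Algebra.adjoin C t) N := (Subalgebra.inclusion hle).toRingHom.toAlgebra
    have : IsScalarTower (Algebra.adjoin C t) N K := IsScalarTower.of_algebraMap_eq fun _ => rfl
    have hinj : Function.Injective (algebraMap (Algebra.adjoin C t) N) :=
      Subalgebra.inclusion_injective hle
    exact (IsAlgebraic.extendScalars hinj h).isIntegral
  have : CharZero N := charZero_of_injective_algebraMap (algebraMap C N).injective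
  obtain ⟨y, hy, hyi, hyS⟩ := exists_primitive_of_forall_isIntegral S hint
  refine ⟨t, fun z hz => hS z (htS hz), hind, y, ?_, hyi, hyS⟩
  have h : IntermediateField.adjoin N (S : Set K) ≤ IntermediateField.extendScalars hNF := by
    rw [IntermediateField.adjoin_le_iff]
    exact fun z hz => hS z hz
  exact h hy

end SeparatingPresentation

end Paper

namespace Paper

section Descent

open Polynomial

variable {L : Type*} [Field L] {Γ : Type*} [LinearOrderedCommGroupWithZero Γ]

theorem exists_root_of_integral_coeff {w : Valuation L Γ} (hw : IsHenselian w) (f : L[X])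
    (hf : ∀ j, w (f.coeff j) ≤ 1) (hf0 : w (f.coeff 0) < 1) (hf1 : w (f.coeff 1) = 1) :
    ∃ y, f.eval y = 0 := by
  have hl : f ∈ Polynomial.lifts w.valuationSubring.subtype :=
    (Polynomial.lifts_iff_coeff_lifts _).2 fun n => ⟨⟨f.coeff n, hf n⟩, rfl⟩
  obtain ⟨g, rfl⟩ := hl
  simp only [coe_mapRingHom, coeff_map] at hf0 hf1
  have hg0 : g.coeff 0 ∈ IsLocalRing.maximalIdeal w.valuationSubring := by
    rw [IsLocalRing.mem_maximalIdeal, mem_nonunits_iff]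
    intro hu
    have := (Valuation.integer.integers w).isUnit_iff_valuation_eq_one.1 hu
    exact hf0.ne this
  have hg1 : IsUnit (g.coeff 1) :=
    (Valuation.integer.integers w).isUnit_iff_valuation_eq_one.2 hf1
  have hg1' : (derivative g).eval 0 = g.coeff 1 := by
    rw [← coeff_zero_eq_eval_zero, coeff_derivative]; simp
  obtain ⟨c, hc⟩ := hg1.exists_right_inv
  obtain ⟨y, hy⟩ := exists_root_of_eval_eq_sq_mul g 0 (c ^ 2 * g.coeff 0)
    (Ideal.mul_mem_left _ _ hg0) (by
      rw [hg1', ← coeff_zero_eq_eval_zero, ← mul_assoc, ← mul_pow, hc, one_pow, one_mul])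
  refine ⟨y, ?_⟩
  have := congrArg w.valuationSubring.subtype hy
  rw [map_zero] at this
  rw [coe_mapRingHom, ← this]
  exact Polynomial.eval_map_apply (f := w.valuationSubring.subtype) (p := g) y

theorem exists_root_of_scaled_coeff {w : Valuation L Γ} (hw : IsHenselian w) (q : L[X])
    (π : L) (hπ : π ≠ 0) (e k : ℤ) (hf : ∀ j : ℕ, w (π ^ (-e - k + j * k) * q.coeff j) ≤ 1)
    (hf0 : w (π ^ (-e - k) * q.coeff 0) < 1) (hf1 : w (π ^ (-e) * q.coeff 1) = 1) :
    ∃ y, q.eval y = 0 := by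
  have hc : ∀ j : ℕ, (C (π ^ (-e - k)) * q.comp (C (π ^ k) * X)).coeff j =
      π ^ (-e - k + j * k) * q.coeff j := by
    intro j
    rw [coeff_C_mul, comp_C_mul_X_coeff, zpow_add₀ hπ, mul_comm (j : ℤ) k, zpow_mul, zpow_natCast]
    ring
  obtain ⟨y, hy⟩ := exists_root_of_integral_coeff hw (C (π ^ (-e - k)) * q.comp (C (π ^ k) * X))
    (fun j => by rw [hc]; exact hf j) (by rw [hc]; simpa using hf0) (by
      rw [hc]; convert hf1 using 4; push_cast; ring)
  refine ⟨π ^ k * y, ?_⟩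
  simpa [zpow_ne_zero, hπ] using hy

theorem exists_algHom_of_residue (p : ℕ)
    (C : Type u) [Field C] (u : Valuation C Zm0) (hchar0 : ringChar C = 0)
    (hπu : IsUniformizer u (p : C))
    (K : Type u) [Field K] [Algebra C K]
    (ΓK : Type u) [LinearOrderedCommGroupWithZero ΓK] (v : Valuation K ΓK)
    (hKC : (v.comap (algebraMap C K)).IsEquiv u) (hπv : IsUniformizer v (p : K))
    (L : Type u) [Field L] [Algebra C L]
    (ΓL : Type u) [LinearOrderedCommGroupWithZero ΓL] (w : Valuation L ΓL)
    (hLC : (w.comap (algebraMap C L)).IsEquiv u) (hLhens : IsHenselian w)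
    (hπw : IsUniformizer w (p : L))
    (gK : ResF u →+* ResF v) (hgK : ResCompat u v gK) (hsepK : IsSepExtHom gK)
    (gL : ResF u →+* ResF w) (hgL : ResCompat u w gL)
    (hres : ThRingSub (fun {k} φ => IsExists φ) (ResF v) gK (ResF w) gL)
    (F : IntermediateField C K) (hF : ∀ z ∈ F, ∃ n : ℕ, v p ^ n * v z ≤ 1)
    (S : Finset K) (hS : ∀ z ∈ S, z ∈ F) :
    Nonempty (Algebra.adjoin C (S : Set K) →ₐ[C] L) := by
  classical
  have : CharZero C := (CharP.ringChar_zero_iff_CharZero C).1 hchar0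
  obtain ⟨t, htF, hind, y, hyF, hyi, hyS⟩ := exists_algebraicIndependent_primitive F S hS
  obtain ⟨d, hd, H, hH, hspec⟩ :=
    exists_specialization (L := L) (Subtype.val : t → K) hind y hyi S hyS
  set N := IntermediateField.adjoin C (Set.range (Subtype.val : t → K))
  have : CharZero N := charZero_of_injective_algebraMap (algebraMap C N).injective
  have hpK : (p : K) ≠ 0 := fun h => by simpa [h] using hπv.1
  have hpC : (p : C) ≠ 0 := fun h => by simpa [h] using hπu.1
  have hpL : (p : L) ≠ 0 := fun h => by simpa [h] using hπw.1
  have hvp0 : v (p : K) ≠ 0 := hπv.1.ne'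
  -- the universal polynomial
  let i : t → F := fun a => ⟨a, htF a.2⟩
  let Q : (MvPolynomial F C)[X] := taylor (MvPolynomial.X ⟨y, hyF⟩)
    (H.map (MvPolynomial.rename i).toRingHom)
  have hQ : ∀ {M : Type u} [Field M] [Algebra C M] (ys : F → M),
      Q.map (MvPolynomial.aeval ys : MvPolynomial F C →ₐ[C] M).toRingHom =
        taylor (ys ⟨y, hyF⟩)
          (H.map (MvPolynomial.aeval (ys ∘ i) : MvPolynomial t C →ₐ[C] M).toRingHom) := by
    intro M _ _ ys
    rw [map_taylor, Polynomial.map_map]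
    congr 1
    · congr 1
      change MvPolynomial.aeval ys (MvPolynomial.X (R := C) _) = _
      rw [MvPolynomial.aeval_X]
    · congr 1
      ext a
      · simp
      · simp
  have hQc : ∀ {M : Type u} [Field M] [Algebra C M] (ys : F → M) (j : ℕ),
      MvPolynomial.aeval ys (Q.coeff j) = (taylor (ys ⟨y, hyF⟩)
        (H.map (MvPolynomial.aeval (ys ∘ i) : MvPolynomial t C →ₐ[C] M).toRingHom)).coeff j := by
    intro M _ _ ys j
    rw [← hQ, coeff_map]
    rfl
  let ev : MvPolynomial F C → K := fun P => MvPolynomial.aeval (Subtype.val : F → K) P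
  have hevF : ∀ P, ev P ∈ F := fun P => by
    have h : ev P = algebraMap F K (MvPolynomial.aeval (id : F → F) P) :=
      (MvPolynomial.aeval_algebraMap_apply K (id : F → F) P)
    rw [h]
    exact SetLike.coe_mem _
  have hpow : ∀ z ∈ F, z ≠ 0 → ∃ e : ℤ, v z = v p ^ e := by
    intro z hz h0
    obtain ⟨n, hn⟩ := hF _ (F.inv_mem hz)
    obtain ⟨m, hm⟩ := hF _ hz
    have hvz : 0 < v z := zero_lt_iff.2 ((Valuation.ne_zero_iff _).2 h0)
    refine hπv.exists_eq_zpow (n := n) (m := m) ?_ hm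
    rwa [map_inv₀, mul_inv_le_iff₀ hvz, one_mul] at hn
  have hevQ : ∀ j, ev (Q.coeff j) = (taylor y
      (H.map (MvPolynomial.aeval (Subtype.val : t → K) : MvPolynomial t C →ₐ[C] K).toRingHom)).coeff
        j := fun j => hQc (Subtype.val : F → K) j
  have hdK : MvPolynomial.aeval (Subtype.val : t → K) d ≠ 0 := fun h =>
    hd ((injective_iff_map_eq_zero _).1 hind d h)
  have hev0 : ev (Q.coeff 0) = 0 := by
    rw [hevQ, taylor_coeff_zero, hH, eval_mul, eval_map_algebraMap, minpoly.aeval, mul_zero]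
  have hev1 : ev (Q.coeff 1) ≠ 0 := by
    rw [hevQ, taylor_coeff_one, hH, derivative_mul, derivative_C, zero_mul, zero_add, eval_mul,
      eval_C, derivative_map, eval_map_algebraMap]
    exact mul_ne_zero hdK ((minpoly.irreducible hyi).separable.aeval_derivative_ne_zero
      (minpoly.aeval _ _))
  have hevd : ev (MvPolynomial.rename i d) = MvPolynomial.aeval (Subtype.val : t → K) d := by
    change MvPolynomial.aeval _ _ = _
    rw [MvPolynomial.aeval_rename]
    rfl
  obtain ⟨e, he⟩ := hpow _ (hevF _) hev1
  obtain ⟨b, hb⟩ := hpow _ (hevF (MvPolynomial.rename i d)) (by rwa [hevd])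
  choose n hn using fun j => hF _ (hevF (Q.coeff j))
  let m : ℕ := (Finset.range (Q.natDegree + 1)).sup n
  let k : ℤ := e.toNat + m
  let T : Finset (MvPolynomial F C) := (Finset.range (Q.natDegree + 2)).image
    (fun j : ℕ => MvPolynomial.C ((p : C) ^ (-e - k + j * k)) * Q.coeff j) ∪
    {MvPolynomial.C ((p : C) ^ (-b)) * MvPolynomial.rename i d}
  have haC : ∀ {M : Type u} [Field M] [Algebra C M] (ys : F → M) (r : ℤ) (P : MvPolynomial F C),
      MvPolynomial.aeval ys (MvPolynomial.C ((p : C) ^ r) * P) =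
        (p : M) ^ r * MvPolynomial.aeval ys P := by
    intro M _ _ ys r P
    rw [map_mul, MvPolynomial.algHom_C, map_zpow₀, map_natCast]
  have hm : ∀ j, v p ^ m * v (ev (Q.coeff j)) ≤ 1 := by
    intro j
    by_cases hj : j ∈ Finset.range (Q.natDegree + 1)
    · refine le_trans ?_ (hn j)
      gcongr ?_ * _
      exact pow_le_pow_right_of_le_one' hπv.2.1.le (Finset.le_sup hj)
    · rw [Finset.mem_range, not_lt] at hj
      rw [coeff_eq_zero_of_natDegree_lt (by omega)]
      simp [ev]
  have hval1 : v (ev (MvPolynomial.C ((p : C) ^ (-e - k + (1 : ℕ) * k)) * Q.coeff 1)) = 1 := by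
    change v (MvPolynomial.aeval _ _) = 1
    rw [haC, map_mul, map_zpow₀]
    change _ * v (ev _) = 1
    rw [he, ← zpow_add₀ hvp0]
    simp
  have hvalb : v (ev (MvPolynomial.C ((p : C) ^ (-b)) * MvPolynomial.rename i d)) = 1 := by
    change v (MvPolynomial.aeval _ _) = 1
    rw [haC, map_mul, map_zpow₀]
    change _ * v (ev _) = 1
    rw [hb, ← zpow_add₀ hvp0]
    simp
  have hT : ∀ P ∈ T, v (ev P) ≤ 1 := by
    intro P hP
    simp only [T, Finset.mem_union, Finset.mem_image, Finset.mem_singleton] at hP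
    rcases hP with ⟨j, -, rfl⟩ | rfl
    · rcases j with _ | _ | j
      · change v (MvPolynomial.aeval _ _) ≤ 1
        rw [haC]
        change v (_ * ev _) ≤ 1
        rw [hev0]; simp
      · exact hval1.le
      · change v (MvPolynomial.aeval _ _) ≤ 1
        rw [haC, map_mul, map_zpow₀]
        refine le_trans ?_ (hm (j + 2))
        gcongr
        · rw [← zpow_natCast]
          refine zpow_le_zpow_right_of_le_one₀ hπv.1 hπv.2.1.le ?_
          have h1 : e ≤ e.toNat := Int.self_le_toNat e
          have h2 : (0 : ℤ) ≤ k := by positivity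
          have h3 : (0 : ℤ) ≤ j * k := by positivity
          push_cast
          simp only [k] at *
          linarith
    · exact hvalb.le
  obtain ⟨ys, hys⟩ := exists_valued_approximation p C u hπu K ΓK v hKC hπv L ΓL w hLC hπw gK hgK
    hsepK gL hgL hres F hF T hT
  have hjT : ∀ j < Q.natDegree + 2,
      MvPolynomial.C ((p : C) ^ (-e - k + j * k)) * Q.coeff j ∈ T := fun j hj =>
    Finset.mem_union_left _ (Finset.mem_image_of_mem _ (Finset.mem_range.2 hj))
  obtain ⟨y', hy'⟩ := exists_root_of_scaled_coeff hLhens (taylor (ys ⟨y, hyF⟩)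
      (H.map (MvPolynomial.aeval (ys ∘ i) : MvPolynomial t C →ₐ[C] L).toRingHom)) (p : L) hpL e k
    (by
      intro j
      rw [← hQc, ← haC]
      by_cases hj : j < Q.natDegree + 2
      · exact (hys _ (hjT j hj)).1
      · rw [coeff_eq_zero_of_natDegree_lt (by omega)]
        simp)
    (by
      have h := (hys _ (hjT 0 (by omega))).2.1 (by
        rw [haC]
        change _ * ev _ = 0
        rw [hev0, mul_zero])
      rw [haC] at h
      rw [← hQc]
      simpa using h)
    (by
      have h := (hys _ (hjT 1 (by omega))).2.2 hval1
      rw [haC] at h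
      rw [← hQc]
      convert h using 4
      push_cast
      ring)
  refine hspec (ys ∘ i) (y' + ys ⟨y, hyF⟩) ?_ ?_
  · intro h0
    have h := (hys _ (Finset.mem_union_right _ (Finset.mem_singleton_self _))).2.2 hvalb
    rw [haC, MvPolynomial.aeval_rename, h0, mul_zero, map_zero] at h
    exact zero_ne_one h
  · rwa [taylor_eval] at hy'

end Descent

end Paper

namespace Paper

section Separating

variable {N E Γ : Type*} [Field N] [Field E] [Algebra N E] [LinearOrderedCommGroupWithZero Γ]

theorem valuation_geom_sum_of_one_lt (v : Valuation E Γ) {z : E} (hz : 1 < v z) (m : ℕ) :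
    v (∑ i ∈ Finset.range (m + 1), z ^ i) = v z ^ m := by
  induction m with
  | zero => simp
  | succ m ih =>
    rw [Finset.sum_range_succ, v.map_add_eq_of_lt_right, map_pow]
    rw [ih, map_pow]
    exact pow_lt_pow_right₀ hz (Nat.lt_succ_self m)

theorem valuation_geom_sum_le_one (v : Valuation E Γ) {z : E} (hz : v z ≤ 1) (m : ℕ) :
    v (∑ i ∈ Finset.range m, z ^ i) ≤ 1 :=
  v.map_sum_le fun i _ => by rw [map_pow]; exact pow_le_one' hz i

theorem valuation_geom_sum_mul_add_one (v : Valuation E Γ) {z : E} (hz : v z ≤ 1) {d : ℕ}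
    (hd : v (∑ i ∈ Finset.range d, z ^ i) < 1) (k : ℕ) :
    v (∑ i ∈ Finset.range (d * k + 1), z ^ i) = 1 := by
  have h : ∀ k, v (∑ i ∈ Finset.range (d * k), z ^ i) < 1 := by
    intro k
    induction k with
    | zero => simp
    | succ k ih =>
      rw [Nat.mul_succ, Finset.sum_range_add]
      refine v.map_add_lt ih ?_
      simp only [pow_add, ← Finset.mul_sum]
      rw [map_mul, map_pow]
      exact mul_lt_one_of_nonneg_of_lt_one_right (pow_le_one' hz _) zero_le hd
  rw [Finset.sum_range_succ', v.map_add_eq_of_lt_right]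
  · simp
  · simp only [pow_succ, ← Finset.sum_mul, map_mul, pow_zero, map_one]
    exact mul_lt_one_of_nonneg_of_lt_one_left zero_le (h k) hz

/-- A geometric sum in `z` of suitable length is a unit for all of finitely many valuations at which
`z` is integral. -/
theorem exists_geom_sum_unit {ι : Type*} (s : Finset ι) (v : ι → Valuation E Γ) (z : E) :
    ∃ m : ℕ, 0 < m ∧ ∀ i ∈ s, v i z ≤ 1 → v i (∑ j ∈ Finset.range (m + 1), z ^ j) = 1 := by
  classical
  let bad : ι → Prop := fun i => ∃ d, 0 < d ∧ v i (∑ j ∈ Finset.range d, z ^ j) < 1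
  let d : ι → ℕ := fun i => if h : bad i then h.choose else 1
  have hd : ∀ i, 0 < d i := fun i => by
    by_cases h : bad i
    · simp only [d, dif_pos h]; exact h.choose_spec.1
    · simp [d, dif_neg h]
  refine ⟨∏ i ∈ s, d i, Finset.prod_pos fun i _ => hd i, fun i hi hz => ?_⟩
  by_cases h : bad i
  · obtain ⟨k, hk⟩ := Finset.dvd_prod_of_mem d hi
    rw [hk]
    refine valuation_geom_sum_mul_add_one _ hz ?_ k
    simp only [d, dif_pos h]
    exact h.choose_spec.2
  · refine le_antisymm (valuation_geom_sum_le_one _ hz _) (not_lt.1 fun hlt => h ⟨_, ?_, hlt⟩)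
    omega

theorem valuation_algEquiv_eq_of_le_one [Finite (E ≃ₐ[N] E)] (v : Valuation E Γ) (σ : E ≃ₐ[N] E)
    (h : ∀ z, v z ≤ 1 → v (σ z) ≤ 1) (z : E) : v (σ z) = v z := by
  have hmono : ∀ x y, v x ≤ v y → v (σ x) ≤ v (σ y) := by
    intro x y hxy
    rcases eq_or_ne y 0 with rfl | hy
    · rw [map_zero, nonpos_iff_eq_zero, map_eq_zero] at hxy
      simp [hxy]
    · have hy' : 0 < v y := zero_lt_iff.2 ((Valuation.ne_zero_iff _).2 hy)
      have hy'' : 0 < v (σ y) := zero_lt_iff.2 ((Valuation.ne_zero_iff _).2 (by simpa using hy))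
      have := h (x / y) (by rw [map_div₀]; exact (div_le_one₀ hy').2 hxy)
      rw [map_div₀, map_div₀] at this
      exact (div_le_one₀ hy'').1 this
  have hn := isOfFinOrder_of_finite σ
  obtain ⟨n, hn0, hn⟩ := isOfFinOrder_iff_pow_eq_one.1 hn
  obtain ⟨n, rfl⟩ := Nat.exists_eq_succ_of_ne_zero hn0.ne'
  have hz : (σ ^ (n + 1)) z = z := by rw [hn]; rfl
  rcases le_total (v z) (v (σ z)) with hle | hle
  · have : ∀ k, v (σ z) ≤ v ((σ ^ (k + 1)) z) := by
      intro k
      induction k with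
      | zero => simp
      | succ k ih => rw [pow_succ', AlgEquiv.mul_apply]; exact hmono _ _ (hle.trans ih)
    exact le_antisymm ((this n).trans_eq (by rw [hz])) hle
  · have : ∀ k, v ((σ ^ (k + 1)) z) ≤ v (σ z) := by
      intro k
      induction k with
      | zero => simp
      | succ k ih => rw [pow_succ', AlgEquiv.mul_apply]; exact hmono _ _ (ih.trans hle)
    exact le_antisymm hle ((this n).trans_eq' (by rw [hz]))

/-- An element which is congruent to `1` at a valuation `v`, fixed by the decomposition group of
`v`, and all of whose other conjugates lie in the maximal ideal. -/
theorem exists_separating_element [Finite (E ≃ₐ[N] E)] (v : Valuation E Γ) :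
    ∃ η : E, v (η - 1) < 1 ∧ ∀ σ : E ≃ₐ[N] E,
      ((∀ x, v (σ x) = v x) → σ η = η) ∧ ((¬ ∀ x, v (σ x) = v x) → v (σ η) < 1) := by
  classical
  have := Fintype.ofFinite (E ≃ₐ[N] E)
  let D : Finset (E ≃ₐ[N] E) := Finset.univ.filter fun σ => ∀ x, v (σ x) = v x
  have hD : ∀ σ, σ ∈ D ↔ ∀ x, v (σ x) = v x := fun σ => by simp [D]
  have hDmul : ∀ σ τ, τ ∈ D → (σ * τ ∈ D ↔ σ ∈ D) := by
    intro σ τ hτ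
    rw [hD] at hτ
    rw [hD, hD]
    refine ⟨fun h x => ?_, fun h x => (h _).trans (hτ x)⟩
    have := h (τ.symm x)
    rw [AlgEquiv.mul_apply, AlgEquiv.apply_symm_apply] at this
    rw [this, ← hτ, AlgEquiv.apply_symm_apply]
  have h1 : ∀ σ, σ ∉ D → ∃ b : E, (∀ τ : E ≃ₐ[N] E, v (τ b) ≤ 1) ∧ v b = 1 ∧ v (σ b) < 1 := by
    intro σ hσ
    obtain ⟨z, hz, hσz⟩ : ∃ z, v z ≤ 1 ∧ 1 < v (σ z) := by
      by_contra! hcon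
      exact hσ ((hD σ).2 (valuation_algEquiv_eq_of_le_one v σ hcon))
    obtain ⟨m, hm, hm'⟩ := exists_geom_sum_unit (Finset.univ : Finset (E ≃ₐ[N] E))
      (fun τ => v.comap (τ : E →+* E)) z
    have hτ : ∀ τ : E ≃ₐ[N] E, v (τ z) ≤ 1 → v (τ (∑ j ∈ Finset.range (m + 1), z ^ j)) = 1 :=
      fun τ => hm' τ (Finset.mem_univ τ)
    have hτ' : ∀ τ : E ≃ₐ[N] E, 1 < v (τ z) →
        v (τ (∑ j ∈ Finset.range (m + 1), z ^ j)) = v (τ z) ^ m := fun τ h => by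
      rw [← valuation_geom_sum_of_one_lt v h, map_sum]
      simp only [map_pow]
    refine ⟨(∑ j ∈ Finset.range (m + 1), z ^ j)⁻¹, fun τ => ?_, ?_, ?_⟩
    · rw [map_inv₀, map_inv₀]
      rcases le_or_gt (v (τ z)) 1 with h | h
      · rw [hτ τ h, inv_one]
      · rw [hτ' τ h]
        exact inv_le_one_of_one_le₀ (one_le_pow₀ h.le)
    · rw [map_inv₀]
      have := hτ 1 hz
      rw [AlgEquiv.one_apply] at this
      rw [this, inv_one]
    · rw [map_inv₀, map_inv₀, hτ' σ hσz]
      exact inv_lt_one_of_one_lt₀ (one_lt_pow₀ hσz hm.ne')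
  choose! b hb hb1 hbσ using h1
  let x₀ : E := ∏ σ ∈ Dᶜ, b σ
  have hx₀ : ∀ τ : E ≃ₐ[N] E, v (τ x₀) ≤ 1 := fun τ => by
    simp only [x₀]
    rw [map_prod, map_prod]
    exact Finset.prod_le_one' fun σ hσ => hb σ (Finset.mem_compl.1 hσ) τ
  have hx₀1 : v x₀ = 1 := by
    simp only [x₀]
    rw [map_prod]
    exact Finset.prod_eq_one fun σ hσ => hb1 σ (Finset.mem_compl.1 hσ)
  have hx₀σ : ∀ σ, σ ∉ D → v (σ x₀) < 1 := fun σ hσ => by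
    simp only [x₀]
    rw [map_prod, map_prod, ← Finset.mul_prod_erase _ _ (Finset.mem_compl.2 hσ)]
    refine mul_lt_one_of_nonneg_of_lt_one_left zero_le (hbσ σ hσ) (Finset.prod_le_one' fun τ hτ => ?_)
    exact hb τ (Finset.mem_compl.1 (Finset.mem_of_mem_erase hτ)) σ
  let x : E := ∏ δ ∈ D, δ x₀
  have hx1 : v x = 1 := by
    simp only [x]
    rw [map_prod]
    exact Finset.prod_eq_one fun δ hδ => ((hD δ).1 hδ x₀).trans hx₀1
  have h1D : (1 : E ≃ₐ[N] E) ∈ D := (hD 1).2 fun x => rfl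
  have hxσ : ∀ σ, σ ∉ D → v (σ x) < 1 := fun σ hσ => by
    simp only [x]
    rw [map_prod, map_prod, ← Finset.mul_prod_erase _ _ h1D]
    refine mul_lt_one_of_nonneg_of_lt_one_left zero_le (hx₀σ σ hσ) (Finset.prod_le_one' fun τ hτ => hx₀ (σ * τ))
  have hxD : ∀ σ, σ ∈ D → σ x = x := fun σ hσ => by
    simp only [x]
    rw [map_prod]
    refine Finset.prod_bij (fun δ _ => σ * δ) (fun δ hδ => (hDmul σ δ hδ).2 hσ)
      (fun a _ b _ h => mul_left_cancel h) (fun δ hδ => ?_) (fun δ _ => rfl)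
    refine ⟨σ⁻¹ * δ, (hDmul _ _ hδ).2 ?_, mul_inv_cancel_left _ _⟩
    rw [hD] at hσ ⊢
    intro y
    rw [← hσ, ← AlgEquiv.mul_apply, mul_inv_cancel]
    rfl
  let s : E := ∑ r ∈ Finset.univ.image (fun σ : E ≃ₐ[N] E => σ x), r
  have hs : ∀ σ : E ≃ₐ[N] E, σ s = s := fun σ => by
    simp only [s]
    rw [map_sum]
    refine Finset.sum_bij (fun r _ => σ r) (fun r hr => ?_) (fun a _ b _ h => σ.injective h)
      (fun r hr => ?_) (fun _ _ => rfl)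
    · obtain ⟨τ, -, rfl⟩ := Finset.mem_image.1 hr
      exact Finset.mem_image.2 ⟨σ * τ, Finset.mem_univ _, rfl⟩
    · obtain ⟨τ, -, rfl⟩ := Finset.mem_image.1 hr
      refine ⟨(σ⁻¹ * τ) x, Finset.mem_image_of_mem _ (Finset.mem_univ _), ?_⟩
      rw [← AlgEquiv.mul_apply, mul_inv_cancel_left]
  have hsx : v (s - x) < 1 := by
    have hmem : x ∈ Finset.univ.image (fun σ : E ≃ₐ[N] E => σ x) :=
      Finset.mem_image.2 ⟨1, Finset.mem_univ _, rfl⟩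
    simp only [s]
    rw [← Finset.add_sum_erase _ _ hmem, add_sub_cancel_left]
    refine v.map_sum_lt one_ne_zero fun r hr => ?_
    obtain ⟨hne, hr⟩ := Finset.mem_erase.1 hr
    obtain ⟨τ, -, rfl⟩ := Finset.mem_image.1 hr
    exact hxσ τ fun hτ => hne (hxD τ hτ)
  have hs1 : v s = 1 := by
    rw [← sub_add_cancel s x, v.map_add_eq_of_lt_right (by rwa [hx1]), hx1]
  have hs0 : s ≠ 0 := fun h => by rw [h, map_zero] at hs1; exact zero_ne_one hs1
  refine ⟨x / s, ?_, fun σ => ⟨fun h => ?_, fun h => ?_⟩⟩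
  · rw [div_sub_one hs0, map_div₀, hs1, div_one, v.map_sub_swap]
    exact hsx
  · rw [map_div₀, hs, hxD σ ((hD σ).2 h)]
  · rw [map_div₀, map_div₀, hs, hs1, div_one]
    exact hxσ σ fun hσ => h ((hD σ).1 hσ)

end Separating

end Paper

namespace Paper

section HenselPrimitive

open Polynomial

variable {Γ : Type*} [LinearOrderedCommGroupWithZero Γ]

theorem coeff_X_sub_C_mul_sub_lt_one {E : Type*} [Field E] (v : Valuation E Γ) (f : E[X]) (m : ℕ)
    (hf : ∀ i, v ((f - X ^ m).coeff i) < 1) (r ζ : E) (hr : v r ≤ 1) (hrζ : v (r - ζ) < 1) (i : ℕ) :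
    v (((X - C r) * f - (X - C ζ) * X ^ m).coeff i) < 1 := by
  have h : (X - C r) * f - (X - C ζ) * X ^ m =
      X * (f - X ^ m) - C r * (f - X ^ m) - C (r - ζ) * X ^ m := by
    rw [C_sub]; ring
  rw [h, coeff_sub, coeff_sub]
  refine v.map_sub_lt (v.map_sub_lt ?_ ?_) ?_
  · rcases i with _ | i
    · simp
    · rw [coeff_X_mul]; exact hf i
  · rw [coeff_C_mul, map_mul]
    exact mul_lt_one_of_nonneg_of_lt_one_right hr zero_le (hf i)
  · rw [coeff_C_mul, coeff_X_pow]
    split_ifs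
    · rwa [mul_one]
    · simp

theorem coeff_multiset_prod_sub_lt_one {E : Type*} [Field E] (v : Valuation E Γ) (s : Multiset E)
    (hs : ∀ r ∈ s, v r < 1) :
    ∀ i, v (((s.map fun r => X - C r).prod - X ^ (Multiset.card s)).coeff i) < 1 := by
  induction s using Multiset.induction_on with
  | empty => intro i; simp
  | cons a s ih =>
    intro i
    have ha := hs a (Multiset.mem_cons_self a s)
    have := coeff_X_sub_C_mul_sub_lt_one v _ _
      (ih fun r hr => hs r (Multiset.mem_cons_of_mem hr)) a 0 ha.le (by simpa using ha) i
    rw [C_0, sub_zero, ← pow_succ'] at this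
    rwa [Multiset.map_cons, Multiset.prod_cons, Multiset.card_cons]

theorem minpoly_eq_of_separating {N E : Type*} [Field N] [Field E] [Algebra N E]
    [IsGalois N E] (v : Valuation E Γ) (η : E) (h1 : v (η - 1) < 1)
    (hη : ∀ σ : E ≃ₐ[N] E, σ η = η ∨ v (σ η) < 1) :
    ∃ (n : ℕ) (e : N[X]), e.degree < (n + 1 : ℕ) ∧ (∀ i, v (algebraMap N E (e.coeff i)) < 1) ∧
      minpoly N η = X ^ (n + 1) - X ^ n + e := by
  have hi : IsIntegral N η := Algebra.IsIntegral.isIntegral η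
  have hs : ((minpoly N η).map (algebraMap N E)).Splits := Normal.splits inferInstance η
  have hm : ((minpoly N η).map (algebraMap N E)).Monic := (minpoly.monic hi).map _
  have hsep : ((minpoly N η).map (algebraMap N E)).Separable :=
    Polynomial.Separable.map (IsGalois.separable N η)
  set P := (minpoly N η).map (algebraMap N E) with hP
  have hmem : η ∈ P.roots := by
    rw [mem_roots hm.ne_zero, IsRoot.def, hP, eval_map_algebraMap, minpoly.aeval]
  obtain ⟨s, hs'⟩ := Multiset.exists_cons_of_mem hmem
  have hnd : P.roots.Nodup := nodup_roots hsep
  have hr : ∀ r ∈ s, v r < 1 := by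
    intro r hr
    have hrr : r ∈ P.roots := hs' ▸ Multiset.mem_cons_of_mem hr
    rw [mem_roots hm.ne_zero, IsRoot.def, hP, eval_map_algebraMap] at hrr
    obtain ⟨σ, rfl⟩ := minpoly.exists_algEquiv_of_root' (Algebra.IsAlgebraic.isAlgebraic η) hrr
    refine (hη σ).resolve_left fun h => ?_
    rw [hs', Multiset.nodup_cons] at hnd
    exact hnd.1 (h ▸ hr)
  have hPe : P = (X - C η) * (s.map fun r => X - C r).prod := by
    rw [hs.eq_prod_roots_of_monic hm, hs', Multiset.map_cons, Multiset.prod_cons]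
  have hvη : v η ≤ 1 := by
    rw [← sub_add_cancel η 1]
    exact (v.map_add _ _).trans (max_le h1.le v.map_one.le)
  have hdeg : (minpoly N η).natDegree = Multiset.card s + 1 := by
    rw [← natDegree_map (algebraMap N E), ← hP, hs.natDegree_eq_card_roots, hs',
      Multiset.card_cons]
  refine ⟨Multiset.card s, minpoly N η - X ^ (Multiset.card s + 1) + X ^ (Multiset.card s), ?_, ?_,
    by ring⟩
  · refine (degree_add_le _ _).trans_lt (max_lt ?_ ?_)
    · have h2 : (minpoly N η).degree = (Multiset.card s + 1 : ℕ) := by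
        rw [degree_eq_natDegree (minpoly.ne_zero hi), hdeg]
      have h3 := degree_sub_lt_left (p := minpoly N η) (q := X ^ (Multiset.card s + 1))
        (by rw [h2, degree_X_pow]) (minpoly.ne_zero hi)
        (by rw [(minpoly.monic hi).leadingCoeff, (monic_X_pow _).leadingCoeff])
      rwa [h2] at h3
    · rw [degree_X_pow]
      exact_mod_cast Nat.lt_succ_self _
  · intro i
    have := coeff_X_sub_C_mul_sub_lt_one v _ _ (coeff_multiset_prod_sub_lt_one v s hr) η 1 hvη h1 i
    rw [← hPe, hP] at this
    rw [← coeff_map]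
    convert this using 3
    simp only [Polynomial.map_add, Polynomial.map_sub, Polynomial.map_pow, map_X, C_1]
    ring

/-- If `K` is an immediate extension of its subfield `N`, finite sets of algebraic elements are
generated by roots of Hensel polynomials. -/
theorem exists_hensel_primitive {N K Ω : Type*} [Field N] [Field K] [Field Ω] [Algebra N K]
    [Algebra K Ω] [Algebra N Ω] [IsScalarTower N K Ω] [IsAlgClosed Ω] [CharZero N] [IsGalois K Ω]
    (v : Valuation Ω Γ) (hinv : ∀ (σ : Ω ≃ₐ[K] Ω) (x : Ω), v (σ x) = v x)
    (hn : ∀ n : ℕ, n ≠ 0 → v (n : Ω) = 1)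
    (himm : ∀ z : K, z ≠ 0 → IsAlgebraic N z →
      ∃ c : N, v (algebraMap K Ω z - algebraMap N Ω c) < v (algebraMap K Ω z))
    (S : Finset K) (hS : ∀ z ∈ S, IsIntegral N z) :
    ∃ η : K, IsIntegral N η ∧ (∀ z ∈ S, z ∈ IntermediateField.adjoin N {η}) ∧
      ∃ (n : ℕ) (e : N[X]), e.degree < (n + 1 : ℕ) ∧ (∀ i, v (algebraMap N Ω (e.coeff i)) < 1) ∧
        minpoly N η = X ^ (n + 1) - X ^ n + e := by
  classical
  let f : N[X] := ∏ z ∈ S, minpoly N z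
  have hf : f ≠ 0 := Finset.prod_ne_zero_iff.2 fun z hz => minpoly.ne_zero (hS z hz)
  let E := IntermediateField.adjoin N (f.rootSet Ω)
  have hE : IsSplittingField N E f :=
    IntermediateField.adjoin_rootSet_isSplittingField (IsAlgClosed.splits _)
  have : Normal N E := Normal.of_isSplittingField f
  have : FiniteDimensional N E := IsSplittingField.finiteDimensional E f
  have : IsGalois N E := ⟨⟩
  have hSE : ∀ z ∈ S, algebraMap K Ω z ∈ E := by
    intro z hz
    refine IntermediateField.subset_adjoin _ _ ((mem_rootSet_of_ne hf).2 ?_)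
    rw [aeval_algebraMap_apply, map_prod, Finset.prod_eq_zero hz (minpoly.aeval _ _), map_zero]
  let vE : Valuation E Γ := v.comap (algebraMap E Ω)
  have hvE : ∀ x : E, vE x = v x := fun x => rfl
  obtain ⟨η, hη1, hη⟩ := exists_separating_element (N := N) vE
  have hres : ∀ (σ : Ω ≃ₐ[K] Ω) (x : E), σ x = ((σ.restrictScalars N).restrictNormal E x : E) :=
    fun σ x => ((σ.restrictScalars N).restrictNormal_commutes E x).symm
  have hresD : ∀ (σ : Ω ≃ₐ[K] Ω) (x : E), vE ((σ.restrictScalars N).restrictNormal E x) = vE x :=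
    fun σ x => by rw [hvE, hvE, ← hres, hinv]
  have hmemK : ∀ x : E, (∀ σ : E ≃ₐ[N] E, (∀ y, vE (σ y) = vE y) → σ x = x) →
      ∃ k : K, algebraMap K Ω k = x := by
    intro x hx
    refine (InfiniteGalois.mem_range_algebraMap_iff_fixed (k := K) (x : Ω)).2 fun σ => ?_
    rw [hres, hx _ (hresD σ)]
  obtain ⟨η', hη'⟩ := hmemK η fun σ hσ => (hη σ).1 hσ
  have hinj : Function.Injective (algebraMap K Ω) := (algebraMap K Ω).injective
  have hmin : minpoly N η' = minpoly N η := by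
    rw [← minpoly.algebraMap_eq hinj η', hη']
    exact minpoly.algebraMap_eq (B := E) (B' := Ω) (algebraMap E Ω).injective η
  have hηi : IsIntegral N η' := by
    rw [← isIntegral_algebraMap_iff hinj, hη']
    exact (IsIntegral.of_finite N η).map (IsScalarTower.toAlgHom N E Ω)
  obtain ⟨n, e, hdeg, he, hmp⟩ := minpoly_eq_of_separating vE η hη1 fun σ => by
    by_cases h : ∀ x, vE (σ x) = vE x
    · exact .inl ((hη σ).1 h)
    · exact .inr ((hη σ).2 h)
  refine ⟨η', hηi, fun z hz => ?_, n, e, hdeg, he, hmin.trans hmp⟩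
  have hfix : ∀ x : E, (∀ σ : E ≃ₐ[N] E, (∀ y, vE (σ y) = vE y) → σ x = x) →
      x ∈ IntermediateField.adjoin N {η} := by
    intro x hx
    rw [← IsGalois.fixedField_fixingSubgroup (IntermediateField.adjoin N {η})]
    rintro ⟨σ, hσ⟩
    refine hx σ fun y => ?_
    by_contra! hcon
    have h1 := (hη σ).2 fun h => hcon (h y)
    have h2 : σ η = η := hσ ⟨η, IntermediateField.mem_adjoin_simple_self N η⟩
    rw [h2] at h1
    have h3 := v.map_sub_lt (x := (η : Ω)) h1 hη1
    simp at h3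
  have hdown : ∀ (x : E) (k : K), algebraMap K Ω k = x → x ∈ IntermediateField.adjoin N {η} →
      k ∈ IntermediateField.adjoin N {η'} := by
    intro x k hk hx
    have h1 : (x : Ω) ∈ (IntermediateField.adjoin N {η}).map (IsScalarTower.toAlgHom N E Ω) :=
      ⟨x, hx, rfl⟩
    have h2 : (IntermediateField.adjoin N {η'}).map (IsScalarTower.toAlgHom N K Ω) =
        (IntermediateField.adjoin N {η}).map (IsScalarTower.toAlgHom N E Ω) := by
      rw [IntermediateField.adjoin_map, IntermediateField.adjoin_map, Set.image_singleton,
        Set.image_singleton]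
      congr 2
    rw [← h2] at h1
    obtain ⟨k', hk', h⟩ := h1
    rwa [← hinj (h.trans hk.symm)]
  -- averaging over the decomposition group
  have := Fintype.ofFinite (E ≃ₐ[N] E)
  let D : Finset (E ≃ₐ[N] E) := Finset.univ.filter fun σ => ∀ x, vE (σ x) = vE x
  have hD : ∀ σ, σ ∈ D ↔ ∀ x, vE (σ x) = vE x := fun σ => by simp [D]
  have hDne : D.card ≠ 0 := Finset.card_ne_zero.2 ⟨1, (hD 1).2 fun _ => rfl⟩
  have : CharZero E := charZero_of_injective_algebraMap (algebraMap N E).injective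
  let avg : E → E := fun x => (∑ σ ∈ D, σ x) / (D.card : E)
  have havg : ∀ x, ∀ σ ∈ D, σ (avg x) = avg x := by
    intro x σ hσ
    simp only [avg]
    rw [map_div₀, map_natCast, map_sum]
    congr 1
    have hσ' := (hD σ).1 hσ
    refine Finset.sum_bij (fun τ _ => σ * τ) (fun τ hτ => (hD _).2 fun y => ?_)
      (fun a _ b _ h => mul_left_cancel h) (fun τ hτ => ?_) (fun _ _ => rfl)
    · rw [AlgEquiv.mul_apply, hσ', (hD τ).1 hτ]
    · refine ⟨σ⁻¹ * τ, (hD _).2 fun y => ?_, mul_inv_cancel_left _ _⟩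
      rw [← hσ', ← AlgEquiv.mul_apply, mul_inv_cancel_left, (hD τ).1 hτ]
  have havgle : ∀ x, vE (avg x) ≤ vE x := by
    intro x
    have h1 : vE (D.card : E) = 1 := by
      rw [hvE]; push_cast; exact hn _ hDne
    simp only [avg]
    rw [map_div₀, h1, div_one]
    exact vE.map_sum_le fun σ hσ => ((hD σ).1 hσ x).le
  let y : E := ⟨_, hSE z hz⟩
  have hy0 : (∀ σ ∈ D, σ y = y) := by
    have hav : avg y = y := by
      by_contra hne
      obtain ⟨k, hk⟩ := hmemK (avg y) fun σ hσ => havg y σ ((hD σ).2 hσ)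
      have hk0 : z - k ≠ 0 := by
        intro h
        rw [sub_eq_zero] at h
        refine hne (Subtype.ext ?_)
        rw [← hk, ← h]
      have hki : IsIntegral N k := by
        rw [← isIntegral_algebraMap_iff hinj, hk]
        exact (IsIntegral.of_finite N (avg y)).map (IsScalarTower.toAlgHom N E Ω)
      obtain ⟨c, hc⟩ := himm (z - k) hk0 ((hS z hz).sub hki).isAlgebraic
      have h1 : avg (y - avg y - algebraMap N E c) = - algebraMap N E c := by
        have h2 : ∑ σ ∈ D, σ (y - avg y - algebraMap N E c) =
            ∑ σ ∈ D, σ y - (D.card : E) * avg y - (D.card : E) * algebraMap N E c := by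
          rw [← nsmul_eq_mul, ← nsmul_eq_mul, ← Finset.sum_const, ← Finset.sum_const,
            ← Finset.sum_sub_distrib, ← Finset.sum_sub_distrib]
          refine Finset.sum_congr rfl fun σ hσ => ?_
          rw [map_sub, map_sub, havg y σ hσ, AlgEquiv.commutes]
        have hc0 : (D.card : E) ≠ 0 := Nat.cast_ne_zero.2 hDne
        change (∑ σ ∈ D, σ (y - avg y - algebraMap N E c)) / (D.card : E) = _
        rw [h2]
        have h3 : (D.card : E) * avg y = ∑ σ ∈ D, σ y := by
          simp only [avg]; field_simp
        rw [h3]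
        field_simp
        ring
      have h2 := havgle (y - avg y - algebraMap N E c)
      rw [h1, vE.map_neg] at h2
      have h3 : vE (y - avg y - algebraMap N E c) < vE (y - avg y) := by
        rw [hvE, hvE]
        push_cast
        rw [← hk]
        rw [(algebraMap K Ω).map_sub] at hc
        exact hc
      have h4 := h2.trans_lt h3
      have h6 : vE (y - avg y) < vE (y - avg y) := by
        conv_lhs => rw [← sub_add_cancel (y - avg y) (algebraMap N E c)]
        exact vE.map_add_lt h3 h4
      exact lt_irrefl _ h6
    intro σ hσ
    rw [← hav]
    exact havg y σ hσ
  exact hdown y z rfl (hfix y fun σ hσ => hy0 σ ((hD σ).2 hσ))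

end HenselPrimitive

end Paper

namespace Paper

section InvariantValuation

open Polynomial

variable {Γ : Type*} [LinearOrderedCommGroupWithZero Γ]

theorem valuation_eval_le_one {Ω : Type*} [Field Ω] (v : Valuation Ω Γ) (f : Polynomial Ω)
    (hf : ∀ i, v (f.coeff i) ≤ 1) {z : Ω} (hz : v z ≤ 1) : v (f.eval z) ≤ 1 := by
  rw [eval_eq_sum_range]
  refine v.map_sum_le fun i _ => ?_
  rw [map_mul, map_pow]
  exact mul_le_one' (hf i) (pow_le_one' hz i)

theorem valuation_coeff_derivative_le_one {Ω : Type*} [Field Ω] (v : Valuation Ω Γ) (f : Polynomial Ω)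
    (hf : ∀ i, v (f.coeff i) ≤ 1) (i : ℕ) : v ((derivative f).coeff i) ≤ 1 := by
  rw [coeff_derivative, map_mul]
  refine mul_le_one' (hf _) ?_
  exact_mod_cast (natCast_mem v.valuationSubring (i + 1))

/-- Integral Taylor expansion to first and second order. -/
theorem exists_binom_expansion {Ω : Type*} [Field Ω] (v : Valuation Ω Γ) (f : Polynomial Ω)
    (hf : ∀ i, v (f.coeff i) ≤ 1) {x y : Ω} (hx : v x ≤ 1) (hy : v y ≤ 1) :
    ∃ k : Ω, v k ≤ 1 ∧ f.eval (x + y) = f.eval x + (derivative f).eval x * y + k * y ^ 2 := by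
  have hl : f ∈ Polynomial.lifts v.valuationSubring.subtype :=
    (Polynomial.lifts_iff_coeff_lifts _).2 fun n => ⟨⟨f.coeff n, hf n⟩, rfl⟩
  obtain ⟨g, rfl⟩ := hl
  obtain ⟨k, hk⟩ := binomExpansion g (⟨x, hx⟩ : v.valuationSubring) ⟨y, hy⟩
  refine ⟨k, k.2, ?_⟩
  have := congrArg v.valuationSubring.subtype hk
  simp only [map_add, map_mul, map_pow, ← eval_map_apply, ← derivative_map] at this
  exact this

theorem valuation_eval_sub_lt_one {Ω : Type*} [Field Ω] (v : Valuation Ω Γ) (f : Polynomial Ω)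
    (hf : ∀ i, v (f.coeff i) ≤ 1) {x z : Ω} (hz : v z ≤ 1) (hxz : v (x - z) < 1) :
    v (f.eval x - f.eval z) < 1 := by
  obtain ⟨k, hk, h⟩ := exists_binom_expansion v f hf hz hxz.le
  rw [add_sub_cancel] at h
  have : f.eval x - f.eval z = ((derivative f).eval z + k * (x - z)) * (x - z) := by
    rw [h]; ring
  rw [this, map_mul]
  refine mul_lt_one_of_nonneg_of_lt_one_right ?_ zero_le hxz
  refine (v.map_add _ _).trans (max_le ?_ ?_)
  · exact valuation_eval_le_one v _ (valuation_coeff_derivative_le_one v f hf) hz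
  · rw [map_mul]; exact mul_le_one' hk hxz.le

theorem exists_root_near {Ω : Type*} [Field Ω] [IsAlgClosed Ω] (v : Valuation Ω Γ) (f : Polynomial Ω)
    {z : Ω} (h0 : v (f.eval z) < 1) (h1 : v ((derivative f).eval z) = 1) :
    ∃ r, f.eval r = 0 ∧ v (r - z) < 1 := by
  by_cases hz0 : f.eval z = 0
  · exact ⟨z, hz0, by simp⟩
  by_contra! hcon
  have hs := (IsAlgClosed.splits f).eval_derivative_div_eval_of_ne_zero hz0
  have hle : v (f.roots.map fun r => 1 / (z - r)).sum ≤ 1 := by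
    refine Multiset.sum_induction (fun y => v y ≤ 1) _
      (fun a b ha hb => (v.map_add _ _).trans (max_le ha hb)) (by simp) ?_
    intro y hy
    obtain ⟨r, hr, rfl⟩ := Multiset.mem_map.1 hy
    have := hcon r (isRoot_of_mem_roots hr)
    rw [one_div, map_inv₀, v.map_sub_swap]
    exact inv_le_one_of_one_le₀ this
  rw [← hs, map_div₀, h1] at hle
  have h0' : 0 < v (f.eval z) := zero_lt_iff.2 ((Valuation.ne_zero_iff _).2 hz0)
  exact absurd ((div_le_one₀ h0').1 hle) (not_le.2 h0)

theorem root_near_unique {Ω : Type*} [Field Ω] (v : Valuation Ω Γ) (f : Polynomial Ω)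
    (hf : ∀ i, v (f.coeff i) ≤ 1) {z r s : Ω} (hz : v z ≤ 1)
    (h1 : v ((derivative f).eval z) = 1) (hr : f.eval r = 0) (hrz : v (r - z) < 1)
    (hs : f.eval s = 0) (hsz : v (s - z) < 1) : r = s := by
  have hr1 : v r ≤ 1 := by
    rw [← sub_add_cancel r z]
    exact (v.map_add _ _).trans (max_le hrz.le hz)
  have hsr : v (s - r) < 1 := by
    rw [← sub_sub_sub_cancel_right s r z]
    exact v.map_sub_lt hsz hrz
  obtain ⟨k, hk, h⟩ := exists_binom_expansion v f hf hr1 hsr.le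
  rw [add_sub_cancel, hr, hs, zero_add] at h
  have hd : v ((derivative f).eval r) = 1 := by
    have := valuation_eval_sub_lt_one v _ (valuation_coeff_derivative_le_one v f hf) hz hrz
    rw [← sub_add_cancel ((derivative f).eval r), v.map_add_eq_of_lt_right, h1]
    rwa [h1]
  have h2 : (s - r) * ((derivative f).eval r + k * (s - r)) = 0 := by rw [h]; ring
  rcases mul_eq_zero.1 h2 with h3 | h3
  · exact (sub_eq_zero.1 h3).symm
  · exfalso
    have h4 : v ((derivative f).eval r + k * (s - r)) = 1 := by
      rw [v.map_add_eq_of_lt_left, hd]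
      rw [hd, map_mul]
      exact mul_lt_one_of_nonneg_of_lt_one_right hk zero_le hsr
    rw [h3, map_zero] at h4
    exact zero_ne_one h4

/-- Hensel's lemma over the fixed field of a group of isometries. -/
theorem exists_root_near_of_invariant {K Ω : Type*} [Field K] [Field Ω] [Algebra K Ω]
    [IsAlgClosed Ω] [IsGalois K Ω] (v : Valuation Ω Γ)
    (hinv : ∀ (σ : Ω ≃ₐ[K] Ω) (x : Ω), v (σ x) = v x) (f : K[X])
    (hf : ∀ i, v (algebraMap K Ω (f.coeff i)) ≤ 1) {z : K} (hz : v (algebraMap K Ω z) ≤ 1)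
    (h0 : v (algebraMap K Ω (f.eval z)) < 1)
    (h1 : v (algebraMap K Ω ((derivative f).eval z)) = 1) :
    ∃ r : K, f.eval r = 0 ∧ v (algebraMap K Ω (r - z)) < 1 := by
  have hf' : ∀ i, v ((f.map (algebraMap K Ω)).coeff i) ≤ 1 := fun i => by rw [coeff_map]; exact hf i
  rw [← eval_map_apply] at h0
  rw [← eval_map_apply, ← derivative_map] at h1
  obtain ⟨r, hr, hrz⟩ := exists_root_near v (f.map (algebraMap K Ω)) h0 h1
  obtain ⟨s, rfl⟩ := (InfiniteGalois.mem_range_algebraMap_iff_fixed (k := K) r).2 fun σ => by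
    refine root_near_unique v _ hf' hz h1 ?_ ?_ hr hrz
    · rw [eval_map_algebraMap] at hr ⊢
      have := aeval_algHom_apply σ.toAlgHom r f
      rw [hr, map_zero] at this
      exact this
    · rw [← AlgEquiv.commutes σ z, ← map_sub, hinv]
      exact hrz
  refine ⟨s, ?_, by rwa [map_sub]⟩
  rw [eval_map_apply] at hr
  exact (algebraMap K Ω).injective (by rw [hr, map_zero])

/-- The form of Hensel's lemma used here: polynomials congruent to `X ^ (n + 1) - X ^ n` have a
root congruent to `1`. -/
def HenselRoots {K : Type*} [Field K] (v : Valuation K Γ) : Prop :=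
  ∀ (n : ℕ) (e : K[X]), e.degree < (n + 1 : ℕ) → (∀ i, v (e.coeff i) < 1) →
    ∃ r : K, (X ^ (n + 1) - X ^ n + e).eval r = 0 ∧ v (r - 1) < 1

theorem IsHenselian.henselRoots {K : Type*} [Field K] {v : Valuation K Γ} (hv : IsHenselian v) :
    HenselRoots v := by
  intro n e hdeg he
  have hl : e ∈ Polynomial.lifts v.valuationSubring.subtype :=
    (Polynomial.lifts_iff_coeff_lifts _).2 fun n => ⟨⟨e.coeff n, (he n).le⟩, rfl⟩
  obtain ⟨g, rfl⟩ := hl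
  rw [coe_mapRingHom] at *
  have hmem : ∀ x : v.valuationSubring, x ∈ IsLocalRing.maximalIdeal v.valuationSubring ↔
      v (x : K) < 1 := fun x => by
    rw [IsLocalRing.mem_maximalIdeal, mem_nonunits_iff, lt_iff_le_and_ne,
      and_iff_right (show v (x : K) ≤ 1 from x.2)]
    exact ((Valuation.integer.integers v).isUnit_iff_valuation_eq_one (x := x)).not
  obtain ⟨s, hs, hs1⟩ := exists_root_of_congruent n g
    (by rwa [degree_map_eq_of_injective Subtype.val_injective] at hdeg)
    (fun i => by rw [hmem]; simpa using he i)
  refine ⟨s, ?_, by simpa using (hmem _).1 hs1⟩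
  have := congrArg v.valuationSubring.subtype hs
  rw [← eval_map_apply] at this
  simpa using this

theorem invariant_of_henselRoots {K Ω : Type*} [Field K] [CharZero K] [Field Ω] [Algebra K Ω]
    [IsAlgClosed Ω] [Algebra.IsAlgebraic K Ω] (v : Valuation Ω Γ)
    (hv : HenselRoots (v.comap (algebraMap K Ω))) (σ : Ω ≃ₐ[K] Ω) (x : Ω) : v (σ x) = v x := by
  have hx : IsIntegral K x := Algebra.IsIntegral.isIntegral x
  let E := IntermediateField.adjoin K ((minpoly K x).rootSet Ω)
  have hE : IsSplittingField K E (minpoly K x) :=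
    IntermediateField.adjoin_rootSet_isSplittingField (IsAlgClosed.splits _)
  have : Normal K E := Normal.of_isSplittingField (minpoly K x)
  have : FiniteDimensional K E := IsSplittingField.finiteDimensional E (minpoly K x)
  have : IsGalois K E := ⟨⟩
  have hxE : x ∈ E := IntermediateField.subset_adjoin _ _
    ((mem_rootSet_of_ne (minpoly.ne_zero hx)).2 (minpoly.aeval _ _))
  let vE : Valuation E Γ := v.comap (algebraMap E Ω)
  obtain ⟨η, hη1, hη⟩ := exists_separating_element (N := K) vE
  obtain ⟨n, e, hdeg, he, hmp⟩ := minpoly_eq_of_separating vE η hη1 fun σ => by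
    by_cases h : ∀ x, vE (σ x) = vE x
    · exact .inl ((hη σ).1 h)
    · exact .inr ((hη σ).2 h)
  obtain ⟨r, hr, -⟩ := hv n e hdeg he
  rw [← hmp] at hr
  have hd : (minpoly K η).degree = 1 :=
    degree_eq_one_of_irreducible_of_root (minpoly.irreducible (IsIntegral.of_finite K η)) hr
  obtain ⟨s, rfl⟩ := minpoly.mem_range_of_degree_eq_one _ _ hd
  have hD : ∀ τ : E ≃ₐ[K] E, ∀ y, vE (τ y) = vE y := by
    intro τ
    by_contra hcon
    have h1 := (hη τ).2 hcon
    have h2 := vE.map_sub_lt h1 hη1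
    simp at h2
  have := hD (σ.restrictNormal E) ⟨x, hxE⟩
  change v (((σ.restrictNormal E) ⟨x, hxE⟩ : E) : Ω) = v x at this
  rw [← this]
  congr 1
  exact (σ.restrictNormal_commutes E ⟨x, hxE⟩).symm

theorem henselRoots_of_invariant {K Ω : Type*} [Field K] [Field Ω] [Algebra K Ω]
    [IsAlgClosed Ω] [IsGalois K Ω] (v : Valuation Ω Γ)
    (hinv : ∀ (σ : Ω ≃ₐ[K] Ω) (x : Ω), v (σ x) = v x) :
    HenselRoots (v.comap (algebraMap K Ω)) := by
  intro n e hdeg he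
  have he1 : ∀ i, v (algebraMap K Ω (e.coeff i)) ≤ 1 := fun i => (he i).le
  have hm1 : v ((algebraMap K Ω) 1) ≤ 1 := by simp
  have hev : ∀ g : K[X], (∀ i, v (algebraMap K Ω (g.coeff i)) < 1) →
      v (algebraMap K Ω (g.eval 1)) < 1 := fun g hg => by
    rw [eval_eq_sum_range, map_sum]
    exact v.map_sum_lt one_ne_zero fun i _ => by simpa using hg i
  have hint : ∀ i, v (algebraMap K Ω ((X ^ (n + 1) - X ^ n + e).coeff i)) ≤ 1 := fun i => by
    rw [coeff_add, coeff_sub, coeff_X_pow, coeff_X_pow, map_add, map_sub]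
    refine (v.map_add _ _).trans (max_le ((v.map_sub _ _).trans (max_le ?_ ?_)) (he1 i))
    · split_ifs <;> simp
    · split_ifs <;> simp
  have h0 : v (algebraMap K Ω ((X ^ (n + 1) - X ^ n + e).eval 1)) < 1 := by
    simpa using hev e he
  have h2 : v (algebraMap K Ω ((derivative e).eval 1)) < 1 := by
    refine hev _ fun i => ?_
    rw [coeff_derivative, map_mul, map_mul]
    refine mul_lt_one_of_nonneg_of_lt_one_left zero_le (he _) ?_
    simpa using natCast_mem v.valuationSubring (i + 1)
  have h1 : v (algebraMap K Ω ((derivative (X ^ (n + 1) - X ^ n + e)).eval 1)) = 1 := by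
    have h3 : (derivative (X ^ (n + 1) - X ^ n + e)).eval 1 = 1 + (derivative e).eval 1 := by
      simp [derivative_X_pow]
    rw [h3, map_add, map_one, v.map_add_eq_of_lt_left, map_one]
    rwa [map_one]
  exact exists_root_near_of_invariant v hinv _ hint hm1 h0 h1

end InvariantValuation

end Paper

namespace Paper

section Specialization

open Polynomial

variable {Γ Γ' : Type*} [LinearOrderedCommGroupWithZero Γ] [LinearOrderedCommGroupWithZero Γ']

/-- Strict inequalities between values of polynomials at `w` can be realised, with respect to `μ`,
at points of the base field. -/
def Specializes {M K : Type*} [Field M] [Field K] [Algebra M K] (w : K) (v : Valuation K Γ)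
    (μ : Valuation M Γ') : Prop :=
  ∀ Φ : Finset (M[X] × M[X]), (∀ q ∈ Φ, v (aeval w q.1) < v (aeval w q.2)) →
    ∃ b : M, ∀ q ∈ Φ, μ (q.1.eval b) < μ (q.2.eval b)

/-- Descent of a minimal polynomial to a smaller base field. -/
theorem minpoly_map_eq_of_lifts {M K : Type*} [Field M] [Field K] [Algebra M K]
    {N₀ N : IntermediateField M K} (hle : N₀ ≤ N) {y : K} (hy : IsIntegral N y)
    (hc : ∀ i, ((minpoly N y).coeff i : K) ∈ N₀) :
    (minpoly N₀ y).map (algebraMap N₀ K) = (minpoly N y).map (algebraMap N K) ∧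
      IsIntegral N₀ y := by
  let ι : N₀ →+* N := (IntermediateField.inclusion hle).toRingHom
  have hl : minpoly N y ∈ Polynomial.lifts ι :=
    (Polynomial.lifts_iff_coeff_lifts _).2 fun i => ⟨⟨_, hc i⟩, Subtype.ext rfl⟩
  obtain ⟨P, hP, -, hPm⟩ := Polynomial.lifts_and_natDegree_eq_and_monic hl (minpoly.monic hy)
  have hcomp : (algebraMap N K).comp ι = algebraMap N₀ K := RingHom.ext fun _ => rfl
  have hPK : P.map (algebraMap N₀ K) = (minpoly N y).map (algebraMap N K) := by
    rw [← hP, Polynomial.map_map, hcomp]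
  have hroot : aeval y P = 0 := by
    rw [aeval_def, ← eval_map, hPK, eval_map, ← aeval_def, minpoly.aeval]
  have hirr : Irreducible P :=
    hPm.irreducible_of_irreducible_map ι P (hP ▸ minpoly.irreducible hy)
  rw [← minpoly.eq_of_irreducible_of_monic hirr hroot hPm]
  exact ⟨hPK, P, hPm, hroot⟩

theorem exists_mem_adjoin_of_forall_mem_adjoin {M K : Type*} [Field M] [Field K] [Algebra M K]
    (T : Set K) (hT : ∀ T₀ : Finset K, (T₀ : Set K) ⊆ T →
      ∃ w ∈ T, ∀ t ∈ T₀, t ∈ IntermediateField.adjoin M {w}) (U : Finset K)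
    (hU : ∀ z ∈ U, z ∈ IntermediateField.adjoin M T) :
    ∃ w ∈ T, ∀ z ∈ U, z ∈ IntermediateField.adjoin M {w} := by
  classical
  have key : ∃ T₀ : Finset K, (T₀ : Set K) ⊆ T ∧
      ∀ z ∈ U, z ∈ IntermediateField.adjoin M (T₀ : Set K) := by
    induction U using Finset.induction_on with
    | empty => exact ⟨∅, by simp, by simp⟩
    | insert a U _ ih =>
      obtain ⟨T₁, h1, h2⟩ := ih fun z hz => hU z (Finset.mem_insert_of_mem hz)
      obtain ⟨T₂, h3, h4⟩ := IntermediateField.exists_finset_of_mem_adjoin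
        (hU a (Finset.mem_insert_self _ _))
      refine ⟨T₁ ∪ T₂, by simp [h1, h3], fun z hz => ?_⟩
      rcases Finset.mem_insert.1 hz with rfl | hz
      · exact IntermediateField.adjoin.mono _ _ _ (by simp) h4
      · exact IntermediateField.adjoin.mono _ _ _ (by simp) (h2 z hz)
  obtain ⟨T₀, h1, h2⟩ := key
  obtain ⟨w, hw, h3⟩ := hT T₀ h1
  exact ⟨w, hw, fun z hz => IntermediateField.adjoin_le_iff.2 h3 (h2 z hz)⟩

theorem mem_adjoin_singleton_of_coeff_mem {M K : Type*} [Field M] [Field K] [Algebra M K]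
    {N N₀ : IntermediateField M K} {y : K} (P : N[X]) (hP : ∀ i, (P.coeff i : K) ∈ N₀) :
    aeval y P ∈ IntermediateField.adjoin N₀ {y} := by
  rw [aeval_eq_sum_range]
  refine sum_mem fun i _ => ?_
  rw [Algebra.smul_def]
  exact mul_mem ((IntermediateField.adjoin N₀ {y}).algebraMap_mem ⟨_, hP i⟩)
    (pow_mem (IntermediateField.mem_adjoin_simple_self _ _) _)

/-- A polynomial in one variable indexed by `Unit`, as a univariate polynomial. -/
noncomputable def polyOfUnit {M : Type*} [Field M] : MvPolynomial Unit M →ₐ[M] M[X] :=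
  MvPolynomial.aeval fun _ => X

theorem aeval_polyOfUnit {M A : Type*} [Field M] [Field A] [Algebra M A] (a : A)
    (q : MvPolynomial Unit M) :
    aeval a (polyOfUnit q) = MvPolynomial.aeval (fun _ : Unit => a) q := by
  have : (aeval a).comp polyOfUnit = MvPolynomial.aeval (R := M) (fun _ : Unit => a) :=
    MvPolynomial.algHom_ext fun i => by simp [polyOfUnit]
  exact DFunLike.congr_fun this q

theorem exists_algHom_of_specializes_aux {M K : Type*} [Field M] [Field K] [Algebra M K]
    (v : Valuation K Γ) (μ : Valuation M Γ') (hμ : HenselRoots μ) (w : K)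
    (hw : Transcendental M w) (hsp : Specializes w v μ) (N₀ : IntermediateField M K)
    (hN₀ : N₀ = IntermediateField.adjoin M (Set.range fun _ : Unit => w))
    (S : Finset K) (η : K) (hη : IsIntegral N₀ η)
    (hS : ∀ z ∈ S, z ∈ IntermediateField.adjoin N₀ {η})
    (n : ℕ) (e : K[X]) (hdeg : e.degree < (n + 1 : ℕ)) (he : ∀ i, v (e.coeff i) < 1)
    (hmp : (minpoly N₀ η).map (algebraMap N₀ K) = X ^ (n + 1) - X ^ n + e) :
    Nonempty (Algebra.adjoin M (S : Set K) →ₐ[M] M) := by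
  classical
  subst hN₀
  have ht : AlgebraicIndependent M fun _ : Unit => w :=
    algebraicIndependent_unique_type_iff.2 hw
  obtain ⟨d, hd, H, hH, hspec⟩ := exists_specialization (L := M) (fun _ : Unit => w) ht η hη S hS
  have hinj : ∀ q : MvPolynomial Unit M, MvPolynomial.aeval (fun _ : Unit => w) q = 0 → q = 0 :=
    fun q h => ht (h.trans (map_zero _).symm)
  let D : K := MvPolynomial.aeval (fun _ : Unit => w) d
  have hD : D ≠ 0 := fun h => hd (hinj _ h)
  have hD0 : 0 < v D := zero_lt_iff.2 ((Valuation.ne_zero_iff _).2 hD)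
  let δ : ℕ → M := fun i => (X ^ (n + 1) - X ^ n : M[X]).coeff i
  have hδ : ∀ i, (X ^ (n + 1) - X ^ n : K[X]).coeff i = algebraMap M K (δ i) := fun i => by
    rw [← coeff_map]; simp
  have hcoeff : ∀ i, MvPolynomial.aeval (fun _ : Unit => w) (H.coeff i) =
      D * (algebraMap M K (δ i) + e.coeff i) := fun i => by
    have := congrArg (fun P : K[X] => P.coeff i) hH
    simp only [hmp, coeff_map, coeff_C_mul, coeff_add, hδ] at this
    exact this
  let q : ℕ → MvPolynomial Unit M := fun i => H.coeff i - MvPolynomial.C (δ i) * d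
  have hq : ∀ i, MvPolynomial.aeval (fun _ : Unit => w) (q i) = D * e.coeff i := fun i => by
    simp only [q, map_sub, map_mul, hcoeff, MvPolynomial.aeval_C]
    change _ - _ * D = _
    ring
  obtain ⟨b, hb⟩ := hsp ((Finset.range (n + 1)).image fun i => (polyOfUnit (q i), polyOfUnit d))
    fun z hz => by
      obtain ⟨i, -, rfl⟩ := Finset.mem_image.1 hz
      rw [aeval_polyOfUnit, aeval_polyOfUnit, hq, map_mul]
      exact mul_lt_of_lt_one_right hD0 (he i)
  let ev : MvPolynomial Unit M →ₐ[M] M := MvPolynomial.aeval fun _ : Unit => b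
  have hb' : ∀ i ≤ n, μ (ev (q i)) < μ (ev d) := fun i hi => by
    have := hb _ (Finset.mem_image.2 ⟨i, Finset.mem_range.2 (Nat.lt_succ_of_le hi), rfl⟩)
    rwa [← coe_aeval_eq_eval, aeval_polyOfUnit, aeval_polyOfUnit] at this
  have hd0 : 0 < μ (ev d) := zero_le.trans_lt (hb' 0 (Nat.zero_le n))
  have hd' : ev d ≠ 0 := (Valuation.ne_zero_iff _).1 hd0.ne'
  have hbig : ∀ i, n + 1 ≤ i → q i = 0 := fun i hi => by
    refine hinj _ ?_
    rw [hq, (degree_lt_iff_coeff_zero _ _).1 hdeg i hi, mul_zero]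
  have hHq : ∀ i, ev (H.coeff i) = ev (q i) + δ i * ev d := fun i => by
    simp [q, ev]
  let e' : M[X] := C (ev d)⁻¹ * H.map ev.toRingHom - (X ^ (n + 1) - X ^ n)
  have he' : ∀ i, e'.coeff i = (ev d)⁻¹ * ev (q i) := fun i => by
    have h1 : (H.map ev.toRingHom).coeff i = ev (H.coeff i) := coeff_map _ _
    change (C (ev d)⁻¹ * H.map ev.toRingHom - (X ^ (n + 1) - X ^ n)).coeff i = _
    rw [coeff_sub, coeff_C_mul, h1, hHq]
    change _ - δ i = _
    field_simp
    ring
  obtain ⟨r, hr, -⟩ := hμ n e' ((degree_lt_iff_coeff_zero _ _).2 fun i hi => by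
      rw [he', hbig i hi, map_zero, mul_zero]) fun i => by
    rw [he', map_mul, map_inv₀, inv_mul_lt_one₀ hd0]
    by_cases hi : i ≤ n
    · exact hb' i hi
    · rw [hbig i (by omega), map_zero, map_zero]
      exact hd0
  refine hspec (fun _ => b) r hd' ?_
  rw [add_sub_cancel, eval_mul, eval_C] at hr
  exact (mul_eq_zero.1 hr).resolve_left (inv_ne_zero hd')

/-- The base field `M` is a field of representatives for the residue field of `K`, and `K` has
divisible value group and is "henselian" with respect to `Ω`. -/
structure ResidueSplit (M K : Type*) {Ω : Type*} [Field M] [Field K] [Field Ω] [Algebra M K]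
    [Algebra K Ω] (v : Valuation Ω Γ) : Prop where
  inv : ∀ (σ : Ω ≃ₐ[K] Ω) (x : Ω), v (σ x) = v x
  nat : ∀ n : ℕ, n ≠ 0 → v (n : Ω) = 1
  res : ∀ z : K, v (algebraMap K Ω z) ≤ 1 →
    ∃ c : M, v (algebraMap K Ω (z - algebraMap M K c)) < 1
  div : ∀ z : K, z ≠ 0 → ∀ n : ℕ, n ≠ 0 →
    ∃ y : K, v (algebraMap K Ω y) ^ n = v (algebraMap K Ω z)
  rac : ∀ z : K, IsAlgebraic M z → ∃ c : M, algebraMap M K c = z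

variable {M K Ω : Type*} [Field M] [Field K] [Field Ω] [Algebra M K] [Algebra K Ω]
  [IsAlgClosed Ω] [CharZero M] [IsGalois K Ω]

theorem ResidueSplit.exists_algHom {v : Valuation Ω Γ} (h : ResidueSplit M K v) (T : Set K)
    (hT : ∀ T₀ : Finset K, (T₀ : Set K) ⊆ T →
      ∃ w ∈ T, ∀ t ∈ T₀, t ∈ IntermediateField.adjoin M {w})
    (htr : ∀ w ∈ T, Transcendental M w) (μ : Valuation M Γ') (hμ : HenselRoots μ)
    (hsp : ∀ w ∈ T, Specializes w (v.comap (algebraMap K Ω)) μ)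
    (himm : ∀ z : K, z ≠ 0 → IsAlgebraic (IntermediateField.adjoin M T) z →
      ∃ c ∈ IntermediateField.adjoin M T, v (algebraMap K Ω (z - c)) < v (algebraMap K Ω z))
    (S : Finset K) (hS : ∀ z ∈ S, IsAlgebraic (IntermediateField.adjoin M T) z) :
    Nonempty (Algebra.adjoin M (S : Set K) →ₐ[M] M) := by
  classical
  have : CharZero K := charZero_of_injective_algebraMap (algebraMap M K).injective
  obtain ⟨η, hη, hSη, n, e, hdeg, he, hmp⟩ := exists_hensel_primitive
    (N := IntermediateField.adjoin M T) v h.inv h.nat (fun z hz hza => by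
      obtain ⟨c, hc, h1⟩ := himm z hz hza
      refine ⟨⟨c, hc⟩, ?_⟩
      rwa [map_sub] at h1) S fun z hz => (hS z hz).isIntegral
  have hpol : ∀ z ∈ S, ∃ P : Polynomial (IntermediateField.adjoin M T), aeval η P = z := by
    intro z hz
    have h1 := hSη z hz
    rw [← IntermediateField.mem_toSubalgebra,
      IntermediateField.adjoin_simple_toSubalgebra_of_isAlgebraic hη.isAlgebraic,
      Algebra.adjoin_singleton_eq_range_aeval] at h1
    exact h1
  choose! P hP using hpol
  let coeffsK : Polynomial (IntermediateField.adjoin M T) → Finset K := fun Q =>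
    Q.support.image fun i => (Q.coeff i : K)
  have hcoe : ∀ (N₀ : IntermediateField M K) (Q : Polynomial (IntermediateField.adjoin M T)),
      (∀ z ∈ coeffsK Q, z ∈ N₀) → ∀ i, (Q.coeff i : K) ∈ N₀ := fun N₀ Q hQ i => by
    by_cases hi : Q.coeff i = 0
    · rw [hi]; exact N₀.zero_mem
    · exact hQ _ (Finset.mem_image_of_mem _ (mem_support_iff.2 hi))
  obtain ⟨w, hw, hwU⟩ := exists_mem_adjoin_of_forall_mem_adjoin T hT
    (coeffsK (minpoly _ η) ∪ S.biUnion fun z => coeffsK (P z)) fun z hz => by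
      rcases Finset.mem_union.1 hz with hz | hz
      · obtain ⟨i, -, rfl⟩ := Finset.mem_image.1 hz
        exact SetLike.coe_mem _
      · obtain ⟨y, -, hz⟩ := Finset.mem_biUnion.1 hz
        obtain ⟨i, -, rfl⟩ := Finset.mem_image.1 hz
        exact SetLike.coe_mem _
  have hle : IntermediateField.adjoin M {w} ≤ IntermediateField.adjoin M T :=
    IntermediateField.adjoin.mono _ _ _ (Set.singleton_subset_iff.2 hw)
  obtain ⟨hmp0, hη0⟩ := minpoly_map_eq_of_lifts hle hη
    (hcoe _ _ fun z hz => hwU z (Finset.mem_union_left _ hz))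
  refine exists_algHom_of_specializes_aux (v.comap (algebraMap K Ω)) μ hμ w (htr w hw) (hsp w hw)
    (IntermediateField.adjoin M {w}) (by rw [Set.range_const]) S η hη0 (fun z hz => ?_)
    n (e.map (algebraMap _ K)) (degree_map_le.trans_lt hdeg) (fun i => ?_) ?_
  · rw [← hP z hz]
    exact mem_adjoin_singleton_of_coeff_mem _ (hcoe _ _ fun y hy =>
      hwU y (Finset.mem_union_right _ (Finset.mem_biUnion.2 ⟨z, hz, hy⟩)))
  · rw [coeff_map]
    exact he i
  · rw [hmp0, hmp]
    simp

end Specialization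

end Paper

namespace Paper

section StepBasics

open Polynomial

variable {Γ : Type*} [LinearOrderedCommGroupWithZero Γ]
variable {M K Ω : Type*} [Field M] [Field K] [Field Ω] [Algebra M K] [Algebra K Ω]
  [IsAlgClosed Ω] [IsGalois K Ω]

theorem valuation_eq_one_of_sub_lt_one {F : Type*} [Field F] (v : Valuation F Γ) {z : F}
    (h : v (z - 1) < 1) : v z = 1 := by
  have := v.map_add_eq_of_lt_right (x := z - 1) (y := 1) (by rwa [map_one])
  rwa [sub_add_cancel, map_one] at this

theorem ResidueSplit.exists_pow_eq {v : Valuation Ω Γ} (h : ResidueSplit M K v) {n : ℕ}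
    (hn : n ≠ 0) {a : K} (ha : v (algebraMap K Ω (a - 1)) < 1) :
    ∃ t : K, t ^ n = a ∧ v (algebraMap K Ω (t - 1)) < 1 := by
  have ha1 : v (algebraMap K Ω a) = 1 :=
    valuation_eq_one_of_sub_lt_one v (by rwa [map_sub, map_one] at ha)
  obtain ⟨t, ht, ht1⟩ := exists_root_near_of_invariant v h.inv (X ^ n - C a) (z := 1)
    (fun i => by
      rw [coeff_sub, coeff_X_pow, coeff_C, map_sub]
      refine (v.map_sub _ _).trans (max_le ?_ ?_)
      · split_ifs <;> simp
      · split_ifs <;> simp [ha1]) (by simp)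
    (by rw [← v.map_neg, ← map_neg]; simpa using ha) (by simpa [derivative_X_pow] using h.nat n hn)
  exact ⟨t, sub_eq_zero.1 (by simpa using ht), ht1⟩

theorem ResidueSplit.exists_unit_approx {v : Valuation Ω Γ} (h : ResidueSplit M K v) {z : K}
    (hz : v (algebraMap K Ω z) = 1) : ∃ c : M, c ≠ 0 ∧
      v (algebraMap K Ω (algebraMap M K c)) = 1 ∧
      v (algebraMap K Ω (z * (algebraMap M K c)⁻¹ - 1)) < 1 := by
  obtain ⟨c, hc⟩ := h.res z hz.le
  have hc1 : v (algebraMap K Ω (algebraMap M K c)) = 1 := by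
    have := v.map_sub_eq_of_lt_right (x := algebraMap K Ω (z - algebraMap M K c))
      (y := algebraMap K Ω z) (by rwa [hz])
    rw [← map_sub, sub_sub_cancel_left, map_neg, v.map_neg, hz] at this
    exact this
  have hc0 : c ≠ 0 := by
    rintro rfl
    simp at hc1
  have hc0' : algebraMap M K c ≠ 0 := by simpa using hc0
  refine ⟨c, hc0, hc1, ?_⟩
  have : z * (algebraMap M K c)⁻¹ - 1 = (z - algebraMap M K c) * (algebraMap M K c)⁻¹ := by
    field_simp
  rw [this, map_mul, map_mul, map_inv₀, map_inv₀, hc1, inv_one, mul_one]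
  exact hc

/-- Up to constants of value one, every element has roots of all orders. -/
theorem ResidueSplit.exists_pow_eq_mul {v : Valuation Ω Γ} (h : ResidueSplit M K v) {n : ℕ}
    (hn : n ≠ 0) {z : K} (hz : z ≠ 0) : ∃ (y : K) (c : M), c ≠ 0 ∧
      v (algebraMap K Ω (algebraMap M K c)) = 1 ∧ y ^ n = algebraMap M K c * z := by
  obtain ⟨y, hy⟩ := h.div z hz n hn
  have hvz : v (algebraMap K Ω z) ≠ 0 := by simpa using hz
  have hy0 : y ≠ 0 := by
    rintro rfl
    simp [hn] at hy
    exact hvz hy.symm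
  obtain ⟨c, hc0, hc1, hc⟩ := h.exists_unit_approx (z := z / y ^ n) (by
    rw [map_div₀, map_div₀, map_pow, map_pow, hy, div_self hvz])
  obtain ⟨t, ht, -⟩ := h.exists_pow_eq hn hc
  have hc0' : algebraMap M K c ≠ 0 := by simpa using hc0
  refine ⟨y * t, c⁻¹, inv_ne_zero hc0, by simp [hc1], ?_⟩
  rw [mul_pow, ht, map_inv₀]
  field_simp

theorem ResidueSplit.exists_pow_eq_mul_base {v : Valuation Ω Γ} (h : ResidueSplit M K v) {n : ℕ}
    (hn : n ≠ 0) {a : M} (ha : a ≠ 0) : ∃ b : M,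
      v (algebraMap K Ω (algebraMap M K b)) ^ n = v (algebraMap K Ω (algebraMap M K a)) := by
  obtain ⟨y, c, -, hc, hy⟩ := h.exists_pow_eq_mul (z := algebraMap M K a) hn (by simpa using ha)
  obtain ⟨b, rfl⟩ := h.rac y (by
    refine IsAlgebraic.of_pow (Nat.pos_of_ne_zero hn) ?_
    rw [hy, ← map_mul]
    exact isAlgebraic_algebraMap _)
  refine ⟨b, ?_⟩
  rw [← map_pow, ← map_pow, hy, map_mul, map_mul, hc, one_mul]

theorem ResidueSplit.exists_approx_root [CharZero M] [Algebra M Ω] [IsScalarTower M K Ω] {v : Valuation Ω Γ}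
    (h : ResidueSplit M K v) {a : Ω} (ha : IsAlgebraic M a) : ∃ b : M, ∀ x : K,
      v (algebraMap K Ω (x - algebraMap M K b)) ≤ v (algebraMap K Ω x - a) := by
  have haK : IsIntegral K a := Algebra.IsIntegral.isIntegral a
  have hm := minpoly.monic haK
  let P := (minpoly K a).map (algebraMap K Ω)
  have hP : P.Splits := IsAlgClosed.splits P
  have hsum : P.nextCoeff = -P.roots.sum := hP.nextCoeff_eq_neg_sum_roots_of_monic (hm.map _)
  have hroots : ∀ r ∈ P.roots, ∃ σ : Ω ≃ₐ[K] Ω, σ a = r := fun r hr => by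
    have : IsConjRoot K r a := (isConjRoot_iff_mem_minpoly_aroots haK).2 hr |>.symm
    exact isConjRoot_iff_exists_algEquiv.1 this
  have hcard : Multiset.card P.roots = (minpoly K a).natDegree := by
    rw [← hP.natDegree_eq_card_roots, natDegree_map]
  set n := (minpoly K a).natDegree with hn
  have hn0 : n ≠ 0 := (minpoly.natDegree_pos haK).ne'
  have hnc : P.nextCoeff = algebraMap K Ω (minpoly K a).nextCoeff :=
    nextCoeff_map_eq _ _
  have halg : IsAlgebraic M (minpoly K a).nextCoeff := by
    rw [← isAlgebraic_algebraMap_iff (R := M) (algebraMap K Ω).injective, ← hnc, hsum]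
    refine IsAlgebraic.neg (Multiset.sum_induction (fun y => IsAlgebraic M y) _
      (fun _ _ => IsAlgebraic.add) isAlgebraic_zero ?_)
    intro r hr
    obtain ⟨σ, rfl⟩ := hroots r hr
    exact ha.algHom (σ.toAlgHom.restrictScalars M)
  obtain ⟨s, hs⟩ := h.rac _ halg
  have hnM : (n : M) ≠ 0 := Nat.cast_ne_zero.2 hn0
  refine ⟨-s / n, fun x => ?_⟩
  have hx : v (algebraMap K Ω (x - algebraMap M K (-s / n))) =
      v ((P.roots.map fun r => algebraMap K Ω x - r).sum) := by
    rw [Multiset.sum_map_sub, Multiset.map_const', Multiset.sum_replicate, hcard, Multiset.map_id',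
      ← neg_neg P.roots.sum, ← hsum, hnc, ← hs, ← one_mul (v _), ← h.nat n hn0, ← map_mul,
      nsmul_eq_mul]
    congr 1
    have hnΩ : (n : Ω) ≠ 0 := fun h0 => by
      have := h.nat n hn0
      simp [h0] at this
    simp only [map_sub, map_div₀, map_neg, map_natCast]
    field_simp
  rw [hx]
  refine Multiset.sum_induction (fun y => v y ≤ v (algebraMap K Ω x - a)) _
    (fun _ _ h1 h2 => (v.map_add _ _).trans (max_le h1 h2)) (by simp) ?_
  intro y hy
  obtain ⟨r, hr, rfl⟩ := Multiset.mem_map.1 hy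
  obtain ⟨σ, rfl⟩ := hroots r hr
  have : algebraMap K Ω x - σ a = σ (algebraMap K Ω x - a) := by simp
  rw [this, h.inv]

end StepBasics

end Paper

namespace Paper

section StepImmediate

open Polynomial

variable {Γ : Type*} [LinearOrderedCommGroupWithZero Γ]

theorem exists_dominant_term {F ι : Type*} [Field F] (v : Valuation F Γ) (c : ι → F)
    (s : Finset ι) (hs : s.Nonempty) (hinj : ∀ i ∈ s, ∀ j ∈ s, v (c i) = v (c j) → i = j) :
    ∃ j ∈ s, (∀ i ∈ s, i ≠ j → v (c i) < v (c j)) ∧ v (∑ i ∈ s, c i) = v (c j) := by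
  classical
  obtain ⟨j, hj, hmax⟩ := s.exists_max_image (fun i => v (c i)) hs
  have hlt : ∀ i ∈ s, i ≠ j → v (c i) < v (c j) := fun i hi hij =>
    (hmax i hi).lt_of_ne fun h => hij (hinj i hi j hj h)
  refine ⟨j, hj, hlt, v.map_sum_eq_of_lt hj fun i hi => ?_⟩
  rw [Finset.mem_sdiff, Finset.mem_singleton] at hi
  exact hlt i hi.1 hi.2

theorem exists_pow_eq_of_isAlgebraic {N K : Type*} [Field N] [Field K] [Algebra N K]
    (v : Valuation K Γ) {z : K} (hz : z ≠ 0) (ha : IsAlgebraic N z) :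
    ∃ (n : ℕ) (c : N), n ≠ 0 ∧ c ≠ 0 ∧ v z ^ n = v (algebraMap N K c) := by
  obtain ⟨P, hP0, hP⟩ := ha
  by_contra! hcon
  have hvz : v z ≠ 0 := (Valuation.ne_zero_iff _).2 hz
  have key : ∀ i j, i < j → P.coeff i ≠ 0 → P.coeff j ≠ 0 →
      v (algebraMap N K (P.coeff i) * z ^ i) ≠ v (algebraMap N K (P.coeff j) * z ^ j) := by
    intro i j hij hi hj he
    have hvj : v (algebraMap N K (P.coeff j)) ≠ 0 := by simpa using hj
    refine hcon (j - i) (P.coeff i / P.coeff j) (Nat.sub_ne_zero_of_lt hij) (div_ne_zero hi hj) ?_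
    obtain ⟨k, rfl⟩ := Nat.exists_eq_add_of_lt hij
    rw [map_mul, map_mul, map_pow, map_pow, add_assoc, pow_add, mul_left_comm,
      mul_comm _ (v z ^ i)] at he
    have he' := mul_left_cancel₀ (pow_ne_zero _ hvz) he
    rw [map_div₀, map_div₀, he', add_assoc, Nat.add_sub_cancel_left, ← add_assoc,
      mul_div_cancel_left₀ _ hvj]
  obtain ⟨j, hj, -, h⟩ := exists_dominant_term v
    (fun i => algebraMap N K (P.coeff i) * z ^ i) P.support
    (Finset.nonempty_iff_ne_empty.2 fun h => hP0 (support_eq_empty.1 h)) fun i hi j hj he => by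
      rcases lt_trichotomy i j with hij | hij | hij
      · exact absurd he (key i j hij (mem_support_iff.1 hi) (mem_support_iff.1 hj))
      · exact hij
      · exact absurd he.symm (key j i hij (mem_support_iff.1 hj) (mem_support_iff.1 hi))
  have h0 : ∑ i ∈ P.support, algebraMap N K (P.coeff i) * z ^ i = 0 := by
    rwa [aeval_def, eval₂_eq_sum, Polynomial.sum] at hP
  rw [h0, map_zero, eq_comm] at h
  have := mem_support_iff.1 hj
  simp [hz, this] at h

variable {M K Ω : Type*} [Field M] [Field K] [Field Ω] [Algebra M K] [Algebra K Ω]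
  [IsAlgClosed Ω] [IsGalois K Ω]

theorem ResidueSplit.exists_approx_of_valuation_eq {v : Valuation Ω Γ} (h : ResidueSplit M K v)
    {z y : K} (hy : y ≠ 0) (hzy : v (algebraMap K Ω z) = v (algebraMap K Ω y)) :
    ∃ c : M, v (algebraMap K Ω (z - y * algebraMap M K c)) < v (algebraMap K Ω z) := by
  have hvy : v (algebraMap K Ω y) ≠ 0 := by simpa using hy
  obtain ⟨c, hc⟩ := h.res (z / y) (by rw [map_div₀, map_div₀, hzy, div_self hvy])
  refine ⟨c, ?_⟩
  have : z - y * algebraMap M K c = y * (z / y - algebraMap M K c) := by field_simp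
  rw [this, map_mul, map_mul, hzy]
  exact mul_lt_of_lt_one_right (zero_lt_iff.2 hvy) hc

theorem ResidueSplit.henselRoots {v : Valuation Ω Γ} (h : ResidueSplit M K v) :
    HenselRoots ((v.comap (algebraMap K Ω)).comap (algebraMap M K)) := by
  intro n e hdeg he
  obtain ⟨r, hr, hr1⟩ := henselRoots_of_invariant v h.inv n (e.map (algebraMap M K))
    (degree_map_le.trans_lt hdeg) fun i => by rw [coeff_map]; exact he i
  have hmap : X ^ (n + 1) - X ^ n + e.map (algebraMap M K) =
      (X ^ (n + 1) - X ^ n + e).map (algebraMap M K) := by simp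
  have hmonic : (X ^ (n + 1) - X ^ n + e).Monic := by
    rw [sub_add]
    refine monic_X_pow_add (n := n + 1) (p := -(X ^ n - e)) ?_ |> fun h => by
      rwa [← sub_eq_add_neg] at h
    rw [degree_neg]
    refine (degree_sub_le _ _).trans_lt (max_lt ?_ hdeg)
    exact (degree_X_pow_le n).trans_lt (by exact_mod_cast Nat.lt_succ_self n)
  rw [hmap] at hr
  obtain ⟨s, rfl⟩ := h.rac r ⟨_, hmonic.ne_zero, by rwa [aeval_def, ← eval_map]⟩
  refine ⟨s, ?_, ?_⟩
  · rw [eval_map_apply] at hr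
    exact (algebraMap M K).injective (by rw [hr, map_zero])
  · simpa using hr1

theorem exists_forall_sub_lt {v : Valuation K Γ} {x : K}
    (hx : ∀ b : M, ∃ b' : M, v (x - algebraMap M K b') < v (x - algebraMap M K b))
    (s : Finset M) : ∃ b' : M, ∀ b ∈ s, v (x - algebraMap M K b') < v (x - algebraMap M K b) := by
  classical
  rcases s.eq_empty_or_nonempty with rfl | hs
  · exact ⟨0, by simp⟩
  · obtain ⟨b, -, hb⟩ := s.exists_min_image (fun b => v (x - algebraMap M K b)) hs
    obtain ⟨b', hb'⟩ := hx b
    exact ⟨b', fun c hc => hb'.trans_le (hb c hc)⟩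

theorem ResidueSplit.exists_forall_eval_eq [Algebra M Ω] [IsScalarTower M K Ω] [CharZero M]
    {v : Valuation Ω Γ} (h : ResidueSplit M K v) {x : K}
    (hx : ∀ b : M, ∃ b' : M, v (algebraMap K Ω (x - algebraMap M K b')) <
      v (algebraMap K Ω (x - algebraMap M K b))) (f : M[X]) :
    ∃ b₀ : M, ∀ b : M, v (algebraMap K Ω (x - algebraMap M K b)) ≤
      v (algebraMap K Ω (x - algebraMap M K b₀)) →
      v (algebraMap K Ω (aeval x f)) = v (algebraMap K Ω (algebraMap M K (f.eval b))) := by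
  classical
  by_cases hf : f = 0
  · exact ⟨0, by simp [hf]⟩
  have hroot : ∀ a ∈ (f.map (algebraMap M Ω)).roots.toFinset, ∃ b : M, ∀ x : K,
      v (algebraMap K Ω (x - algebraMap M K b)) ≤ v (algebraMap K Ω x - a) := fun a ha => by
    refine h.exists_approx_root ⟨f, hf, ?_⟩
    rw [Multiset.mem_toFinset, mem_roots (map_ne_zero hf), IsRoot, eval_map] at ha
    exact ha
  choose! β hβ using hroot
  obtain ⟨b₀, hb₀⟩ := exists_forall_sub_lt (v := v.comap (algebraMap K Ω)) hx
    ((f.map (algebraMap M Ω)).roots.toFinset.image β)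
  refine ⟨b₀, fun b hb => ?_⟩
  have hval : ∀ y : Ω, v ((f.map (algebraMap M Ω)).eval y) =
      v (f.map (algebraMap M Ω)).leadingCoeff *
        ((f.map (algebraMap M Ω)).roots.map fun a => v (y - a)).prod := fun y => by
    rw [(IsAlgClosed.splits (f.map (algebraMap M Ω))).eval_eq_prod_roots, map_mul,
      map_multiset_prod, Multiset.map_map]
    rfl
  have h1 : algebraMap K Ω (aeval x f) =
      (f.map (algebraMap M Ω)).eval (algebraMap K Ω x) := by
    rw [eval_map_algebraMap, aeval_algebraMap_apply]
  have h2 : algebraMap K Ω (algebraMap M K (f.eval b)) =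
      (f.map (algebraMap M Ω)).eval (algebraMap K Ω (algebraMap M K b)) := by
    rw [← IsScalarTower.algebraMap_apply, ← IsScalarTower.algebraMap_apply, eval_map_apply]
  rw [h1, h2, hval, hval]
  congr 2
  refine Multiset.map_congr rfl fun a ha => ?_
  have ha' := Multiset.mem_toFinset.2 ha
  have hlt : v (algebraMap K Ω (x - algebraMap M K b)) < v (algebraMap K Ω x - a) :=
    (hb.trans_lt (hb₀ _ (Finset.mem_image_of_mem _ ha'))).trans_le (hβ a ha' x)
  have := v.map_sub_eq_of_lt_left hlt
  have he : algebraMap K Ω (algebraMap M K b) - a =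
      (algebraMap K Ω x - a) - algebraMap K Ω (x - algebraMap M K b) := by
    rw [(algebraMap K Ω).map_sub]
    ring
  rw [he, this]

theorem ResidueSplit.exists_algHom_immediate [CharZero M] {v : Valuation Ω Γ}
    (h : ResidueSplit M K v) {x : K}
    (hx : ∀ b : M, ∃ b' : M, v (algebraMap K Ω (x - algebraMap M K b')) <
      v (algebraMap K Ω (x - algebraMap M K b)))
    (S : Finset K) (hS : ∀ z ∈ S, IsAlgebraic (IntermediateField.adjoin M {x}) z) :
    Nonempty (Algebra.adjoin M (S : Set K) →ₐ[M] M) := by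
  classical
  letI : Algebra M Ω := ((algebraMap K Ω).comp (algebraMap M K)).toAlgebra
  have : IsScalarTower M K Ω := IsScalarTower.of_algebraMap_eq fun _ => rfl
  choose β hβ using h.exists_forall_eval_eq hx
  have htr : Transcendental M x := fun ha => by
    obtain ⟨c, rfl⟩ := h.rac x ha
    obtain ⟨b', hb'⟩ := hx c
    simp at hb'
  refine h.exists_algHom {x} (fun T₀ hT₀ => ⟨x, rfl, fun t ht => ?_⟩) ?_ _ h.henselRoots ?_ ?_ S hS
  · rw [Set.mem_singleton_iff.1 (hT₀ ht)]
    exact IntermediateField.mem_adjoin_simple_self _ _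
  · rintro _ rfl
    exact htr
  · rintro _ rfl Φ hΦ
    obtain ⟨b, hb⟩ := exists_forall_sub_lt (v := v.comap (algebraMap K Ω)) hx
      (Φ.image (fun q => β q.1) ∪ Φ.image (fun q => β q.2))
    refine ⟨b, fun q hq => ?_⟩
    have h1 := hβ q.1 b (hb _ (Finset.mem_union_left _ (Finset.mem_image_of_mem _ hq))).le
    have h2 := hβ q.2 b (hb _ (Finset.mem_union_right _ (Finset.mem_image_of_mem _ hq))).le
    have h3 := hΦ q hq
    simp only [Valuation.comap_apply] at h3 ⊢
    rwa [← h1, ← h2]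
  · intro z hz hza
    obtain ⟨n, c, hn, hc, hzc⟩ := exists_pow_eq_of_isAlgebraic (v.comap (algebraMap K Ω)) hz hza
    have hval : ∀ f : M[X], ∃ a : M, v (algebraMap K Ω (aeval x f)) =
        v (algebraMap K Ω (algebraMap M K a)) := fun f => ⟨_, hβ f _ le_rfl⟩
    obtain ⟨r, s, hrs⟩ := (IntermediateField.mem_adjoin_simple_iff M (c : K)).1 c.2
    obtain ⟨a, ha⟩ := hval r
    obtain ⟨a', ha'⟩ := hval s
    have hvc : v (algebraMap K Ω z) ^ n = v (algebraMap K Ω (algebraMap M K (a / a'))) := by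
      have h1 : v (algebraMap K Ω z) ^ n = v (algebraMap K Ω (c : K)) := hzc
      rw [h1, hrs, map_div₀, map_div₀, map_div₀, map_div₀, map_div₀, ha, ha']
    have hz0 : v (algebraMap K Ω z) ≠ 0 := by simpa using hz
    have ha0 : a / a' ≠ 0 := fun h0 => by
      rw [h0] at hvc
      simp [hn] at hvc
      exact hz hvc
    obtain ⟨m, hm⟩ := h.exists_pow_eq_mul_base hn ha0
    have hzm : v (algebraMap K Ω z) = v (algebraMap K Ω (algebraMap M K m)) :=
      (pow_left_inj₀ zero_le zero_le hn).1 (hvc.trans hm.symm)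
    have hm0 : algebraMap M K m ≠ 0 := fun h0 => by
      rw [h0, map_zero, map_zero] at hzm
      exact hz0 hzm
    obtain ⟨d, hd⟩ := h.exists_approx_of_valuation_eq hm0 hzm
    refine ⟨algebraMap M K (m * d), IntermediateField.algebraMap_mem _ _, ?_⟩
    rwa [map_mul]

end StepImmediate

end Paper

namespace Paper

section StepCut

open Polynomial

variable {Γ Γ' : Type*} [LinearOrderedCommGroupWithZero Γ] [LinearOrderedCommGroupWithZero Γ']
variable {M K Ω : Type*} [Field M] [Field K] [Field Ω] [Algebra M K] [Algebra K Ω]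

/-- The version of `Specializes` for monomials. -/
def SpecializesMonomials (w : K) (v : Valuation K Γ) (μ : Valuation M Γ') : Prop :=
  ∀ Ψ : Finset ((M × ℕ) × (M × ℕ)),
    (∀ q ∈ Ψ, v (algebraMap M K q.1.1 * w ^ q.1.2) < v (algebraMap M K q.2.1 * w ^ q.2.2)) →
    ∃ b : M, ∀ q ∈ Ψ, μ (q.1.1 * b ^ q.1.2) < μ (q.2.1 * b ^ q.2.2)

theorem eq_of_valuation_monomial_eq {v : Valuation K Γ} {w : K} (hw0 : w ≠ 0)
    (hw : ∀ (k : ℕ) (m : M), k ≠ 0 → v w ^ k ≠ v (algebraMap M K m)) {a c : M} {i j : ℕ}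
    (ha : a ≠ 0) (hc : c ≠ 0)
    (he : v (algebraMap M K a * w ^ i) = v (algebraMap M K c * w ^ j)) : i = j := by
  have hvw : v w ≠ 0 := (Valuation.ne_zero_iff _).2 hw0
  have key : ∀ (i j : ℕ) (a c : M), i < j → c ≠ 0 →
      v (algebraMap M K a * w ^ i) ≠ v (algebraMap M K c * w ^ j) := by
    intro i j a c hij hc he
    have hvc : v (algebraMap M K c) ≠ 0 := by simpa using hc
    obtain ⟨k, rfl⟩ := Nat.exists_eq_add_of_lt hij
    rw [map_mul, map_mul, map_pow, map_pow, add_assoc, pow_add, mul_left_comm,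
      mul_comm _ (v w ^ i)] at he
    have he' := mul_left_cancel₀ (pow_ne_zero _ hvw) he
    refine hw (k + 1) (a / c) (Nat.succ_ne_zero k) ?_
    rw [map_div₀, map_div₀, he', mul_div_cancel_left₀ _ hvc]
  rcases lt_trichotomy i j with hij | hij | hij
  · exact absurd he (key i j a c hij hc)
  · exact hij
  · exact absurd he.symm (key j i c a hij ha)

theorem exists_dominant_monomial {v : Valuation K Γ} {w : K} (hw0 : w ≠ 0)
    (hw : ∀ (k : ℕ) (m : M), k ≠ 0 → v w ^ k ≠ v (algebraMap M K m)) {f : M[X]} (hf : f ≠ 0) :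
    ∃ j ∈ f.support, (∀ i ∈ f.support, i ≠ j →
      v (algebraMap M K (f.coeff i) * w ^ i) < v (algebraMap M K (f.coeff j) * w ^ j)) ∧
      v (aeval w f) = v (algebraMap M K (f.coeff j) * w ^ j) := by
  obtain ⟨j, hj, h1, h2⟩ := exists_dominant_term v
    (fun i => algebraMap M K (f.coeff i) * w ^ i) f.support
    (Finset.nonempty_iff_ne_empty.2 fun h => hf (support_eq_empty.1 h)) fun i hi j hj he =>
      eq_of_valuation_monomial_eq hw0 hw (mem_support_iff.1 hi) (mem_support_iff.1 hj) he
  refine ⟨j, hj, h1, ?_⟩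
  rw [← h2, aeval_def, eval₂_eq_sum, Polynomial.sum]

theorem SpecializesMonomials.specializes {v : Valuation K Γ} {μ : Valuation M Γ'} {w : K}
    (hw0 : w ≠ 0) (hw : ∀ (k : ℕ) (m : M), k ≠ 0 → v w ^ k ≠ v (algebraMap M K m))
    (h : SpecializesMonomials w v μ) : Specializes w v μ := by
  classical
  intro Φ hΦ
  have hne : ∀ q ∈ Φ, q.2 ≠ 0 := fun q hq h0 => by
    have := hΦ q hq
    rw [h0, map_zero, map_zero] at this
    exact not_lt_zero this
  have hdom : ∀ q ∈ Φ, ∃ j ∈ q.2.support, (∀ i ∈ q.2.support, i ≠ j →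
      v (algebraMap M K (q.2.coeff i) * w ^ i) < v (algebraMap M K (q.2.coeff j) * w ^ j)) ∧
      v (aeval w q.2) = v (algebraMap M K (q.2.coeff j) * w ^ j) := fun q hq =>
    exists_dominant_monomial hw0 hw (hne q hq)
  choose! J hJ hJlt hJeq using hdom
  obtain ⟨b, hb⟩ := h (Φ.biUnion fun q =>
    (q.1.support.image fun i => ((q.1.coeff i, i), (q.2.coeff (J q), J q))) ∪
    ((q.2.support.erase (J q)).image fun i => ((q.2.coeff i, i), (q.2.coeff (J q), J q))) ∪
    {((0, 0), (q.2.coeff (J q), J q))}) (by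
      intro z hz
      obtain ⟨q, hq, hz⟩ := Finset.mem_biUnion.1 hz
      rcases Finset.mem_union.1 hz with hz | hz
      rcases Finset.mem_union.1 hz with hz | hz
      · obtain ⟨i, hi, rfl⟩ := Finset.mem_image.1 hz
        have hq1 : q.1 ≠ 0 := fun h0 => by simp [h0] at hi
        obtain ⟨j, hj, h1, h2⟩ := exists_dominant_monomial hw0 hw hq1
        have h3 := hΦ q hq
        rw [h2, hJeq q hq] at h3
        refine lt_of_le_of_lt ?_ h3
        by_cases hij : i = j
        · rw [hij]
        · exact (h1 i hi hij).le
      · obtain ⟨i, hi, rfl⟩ := Finset.mem_image.1 hz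
        exact hJlt q hq i (Finset.mem_of_mem_erase hi) (Finset.ne_of_mem_erase hi)
      · rw [Finset.mem_singleton.1 hz, map_zero, zero_mul, map_zero, zero_lt_iff,
          Valuation.ne_zero_iff]
        have := mem_support_iff.1 (hJ q hq)
        simp [hw0, this])
  refine ⟨b, fun q hq => ?_⟩
  have hb1 : ∀ i ∈ q.1.support, μ (q.1.coeff i * b ^ i) < μ (q.2.coeff (J q) * b ^ J q) :=
    fun i hi => hb ((q.1.coeff i, i), (q.2.coeff (J q), J q)) (Finset.mem_biUnion.2
      ⟨q, hq, Finset.mem_union_left _ (Finset.mem_union_left _ (Finset.mem_image.2 ⟨i, hi, rfl⟩))⟩)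
  have hb2 : ∀ i ∈ q.2.support, i ≠ J q →
      μ (q.2.coeff i * b ^ i) < μ (q.2.coeff (J q) * b ^ J q) := fun i hi hij =>
    hb ((q.2.coeff i, i), (q.2.coeff (J q), J q)) (Finset.mem_biUnion.2
      ⟨q, hq, Finset.mem_union_left _ (Finset.mem_union_right _
        (Finset.mem_image.2 ⟨i, Finset.mem_erase.2 ⟨hij, hi⟩, rfl⟩))⟩)
  have hb3 : 0 < μ (q.2.coeff (J q) * b ^ J q) := by
    have := hb ((0, 0), (q.2.coeff (J q), J q)) (Finset.mem_biUnion.2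
      ⟨q, hq, Finset.mem_union_right _ (Finset.mem_singleton_self _)⟩)
    simpa using this
  have hev : μ (q.2.eval b) = μ (q.2.coeff (J q) * b ^ J q) := by
    rw [eval_eq_sum, Polynomial.sum]
    refine μ.map_sum_eq_of_lt (hJ q hq) fun i hi => ?_
    rw [Finset.mem_sdiff, Finset.mem_singleton] at hi
    exact hb2 i hi.1 hi.2
  rw [hev, eval_eq_sum, Polynomial.sum]
  exact μ.map_sum_lt hb3.ne' hb1

theorem exists_monomial_neighbourhood {v : Valuation K Γ} {w : K} (hw0 : w ≠ 0)
    (hdiv : ∀ a : M, a ≠ 0 → ∀ n : ℕ, n ≠ 0 →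
      ∃ b : M, v (algebraMap M K b) ^ n = v (algebraMap M K a))
    {hi₀ : M} (hhi : v w < v (algebraMap M K hi₀)) {a c : M} {i j : ℕ}
    (hlt : v (algebraMap M K a * w ^ i) < v (algebraMap M K c * w ^ j)) :
    ∃ lo hi : M, v (algebraMap M K lo) < v w ∧ v w < v (algebraMap M K hi) ∧
      ∀ b : M, v (algebraMap M K lo) < v (algebraMap M K b) →
        v (algebraMap M K b) < v (algebraMap M K hi) →
        v (algebraMap M K (a * b ^ i)) < v (algebraMap M K (c * b ^ j)) := by
  have hvw : v w ≠ 0 := (Valuation.ne_zero_iff _).2 hw0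
  have hvw0 : 0 < v w := zero_lt_iff.2 hvw
  have hc : c ≠ 0 := by
    rintro rfl
    simp at hlt
  have hvc : 0 < v (algebraMap M K c) := zero_lt_iff.2 (by simpa using hc)
  by_cases ha : a = 0
  · refine ⟨0, hi₀, by simpa using hvw0, hhi, fun b hb _ => ?_⟩
    rw [map_zero, map_zero] at hb
    rw [ha, zero_mul, map_zero, map_zero, map_mul, map_mul, map_pow, map_pow]
    exact mul_pos hvc (pow_pos hb _)
  have hva : 0 < v (algebraMap M K a) := zero_lt_iff.2 (by simpa using ha)
  simp only [map_mul, map_pow] at hlt ⊢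
  rcases lt_trichotomy i j with hij | rfl | hij
  · obtain ⟨k, rfl⟩ := Nat.exists_eq_add_of_lt hij
    obtain ⟨r, hr⟩ := hdiv (a / c) (div_ne_zero ha hc) (k + 1) (Nat.succ_ne_zero k)
    rw [map_div₀, map_div₀] at hr
    have hiff : ∀ x : Γ, 0 < x → (v (algebraMap M K a) * x ^ i <
        v (algebraMap M K c) * x ^ (i + k + 1) ↔ v (algebraMap M K r) < x) := fun x hx => by
      rw [← pow_lt_pow_iff_left₀ (a := v (algebraMap M K r)) (n := k + 1) zero_le zero_le
        (Nat.succ_ne_zero k), hr, div_lt_iff₀ hvc,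
        add_assoc, pow_add, mul_left_comm, mul_comm _ (x ^ i), mul_lt_mul_iff_right₀ (pow_pos hx _),
        mul_comm]
    refine ⟨r, hi₀, (hiff _ hvw0).1 hlt, hhi, fun b hb _ => ?_⟩
    exact (hiff _ (zero_le.trans_lt hb)).2 hb
  · refine ⟨0, hi₀, by simpa using hvw0, hhi, fun b hb _ => ?_⟩
    rw [map_zero, map_zero] at hb
    exact mul_lt_mul_of_pos_right (lt_of_mul_lt_mul_right hlt zero_le) (pow_pos hb _)
  · obtain ⟨k, rfl⟩ := Nat.exists_eq_add_of_lt hij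
    obtain ⟨r, hr⟩ := hdiv (c / a) (div_ne_zero hc ha) (k + 1) (Nat.succ_ne_zero k)
    rw [map_div₀, map_div₀] at hr
    have hiff : ∀ x : Γ, 0 < x → (v (algebraMap M K a) * x ^ (j + k + 1) <
        v (algebraMap M K c) * x ^ j ↔ x < v (algebraMap M K r)) := fun x hx => by
      rw [← pow_lt_pow_iff_left₀ (b := v (algebraMap M K r)) (n := k + 1) zero_le zero_le
        (Nat.succ_ne_zero k), hr, lt_div_iff₀ hva, add_assoc, pow_add, mul_left_comm,
        mul_comm (v (algebraMap M K c)) (x ^ j), mul_lt_mul_iff_right₀ (pow_pos hx _), mul_comm]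
    refine ⟨0, r, by simpa using hvw0, (hiff _ hvw0).1 hlt, fun b hb hb' => ?_⟩
    rw [map_zero, map_zero] at hb
    exact (hiff _ hb).2 hb'

/-- Over a base with nontrivial divisible value group, cuts can be approximated. -/
theorem specializesMonomials_of_divisible {v : Valuation K Γ} {w : K} (hw0 : w ≠ 0)
    (hdiv : ∀ a : M, a ≠ 0 → ∀ n : ℕ, n ≠ 0 →
      ∃ b : M, v (algebraMap M K b) ^ n = v (algebraMap M K a))
    {hi₀ : M} (hhi : v w < v (algebraMap M K hi₀)) {ε : M} (hε0 : ε ≠ 0)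
    (hε : v (algebraMap M K ε) < 1) :
    SpecializesMonomials w v (v.comap (algebraMap M K)) := by
  classical
  intro Ψ
  have key : (∀ q ∈ Ψ, v (algebraMap M K q.1.1 * w ^ q.1.2) <
      v (algebraMap M K q.2.1 * w ^ q.2.2)) →
      ∃ lo hi : M, v (algebraMap M K lo) < v w ∧ v w < v (algebraMap M K hi) ∧
      ∀ b : M, v (algebraMap M K lo) < v (algebraMap M K b) →
        v (algebraMap M K b) < v (algebraMap M K hi) → ∀ q ∈ Ψ,
        v (algebraMap M K (q.1.1 * b ^ q.1.2)) < v (algebraMap M K (q.2.1 * b ^ q.2.2)) := by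
    induction Ψ using Finset.induction_on with
    | empty =>
      exact fun _ => ⟨0, hi₀, by simpa [zero_lt_iff] using hw0, hhi, by simp⟩
    | insert q Ψ _ ih =>
      intro hΨ
      obtain ⟨lo, hi, h1, h2, h3⟩ := ih fun z hz => hΨ z (Finset.mem_insert_of_mem hz)
      obtain ⟨lo', hi', h1', h2', h3'⟩ := exists_monomial_neighbourhood hw0 hdiv hhi
        (hΨ q (Finset.mem_insert_self _ _))
      obtain ⟨lo'', hlo, hlo', hlo''⟩ : ∃ l : M, v (algebraMap M K lo) ≤ v (algebraMap M K l) ∧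
          v (algebraMap M K lo') ≤ v (algebraMap M K l) ∧ v (algebraMap M K l) < v w := by
        rcases le_total (v (algebraMap M K lo)) (v (algebraMap M K lo')) with h | h
        · exact ⟨lo', h, le_rfl, h1'⟩
        · exact ⟨lo, le_rfl, h, h1⟩
      obtain ⟨hi'', hhi, hhi', hhi''⟩ : ∃ l : M, v (algebraMap M K l) ≤ v (algebraMap M K hi) ∧
          v (algebraMap M K l) ≤ v (algebraMap M K hi') ∧ v w < v (algebraMap M K l) := by
        rcases le_total (v (algebraMap M K hi)) (v (algebraMap M K hi')) with h | h
        · exact ⟨hi, le_rfl, h, h2⟩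
        · exact ⟨hi', h, le_rfl, h2'⟩
      refine ⟨lo'', hi'', hlo'', hhi'', fun b hb hb' z hz => ?_⟩
      rcases Finset.mem_insert.1 hz with rfl | hz
      · exact h3' b (hlo'.trans_lt hb) (hb'.trans_le hhi')
      · exact h3 b (hlo.trans_lt hb) (hb'.trans_le hhi) z hz
  intro hΨ
  obtain ⟨lo, hi, h1, h2, h3⟩ := key hΨ
  have hvhi : 0 < v (algebraMap M K hi) := zero_le.trans_lt h2
  by_cases hlo : lo = 0
  · refine ⟨hi * ε, h3 _ ?_ ?_⟩
    · rw [hlo, map_zero, map_zero, map_mul, map_mul]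
      exact mul_pos hvhi (zero_lt_iff.2 (by simpa using hε0))
    · rw [map_mul, map_mul]
      exact mul_lt_of_lt_one_right hvhi hε
  · have hhi0 : hi ≠ 0 := by
      rintro rfl
      simp at hvhi
    obtain ⟨b, hb⟩ := hdiv (lo * hi) (mul_ne_zero hlo hhi0) 2 two_ne_zero
    have hvlo : 0 < v (algebraMap M K lo) := zero_lt_iff.2 (by simpa using hlo)
    have hlh := h1.trans h2
    refine ⟨b, h3 b ?_ ?_⟩
    · rw [← pow_lt_pow_iff_left₀ zero_le zero_le two_ne_zero, hb, map_mul, map_mul, sq]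
      exact mul_lt_mul_of_pos_left hlh hvlo
    · rw [← pow_lt_pow_iff_left₀ zero_le zero_le two_ne_zero, hb, map_mul, map_mul, sq]
      exact mul_lt_mul_of_pos_right hlh hvhi

/-- Over a trivially valued base, an infinitesimal can be approximated with respect to any
archimedean valuation. -/
theorem specializesMonomials_of_trivial {v : Valuation K Γ} {w : K}
    (htriv : ∀ m : M, m ≠ 0 → v (algebraMap M K m) = 1) (hw0 : w ≠ 0) (hw1 : v w < 1)
    {μ : Valuation M Γ'} {π : M} (hπ0 : π ≠ 0) (hπ1 : μ π < 1)
    (harch : ∀ a : M, a ≠ 0 → ∃ N : ℕ, μ π ^ N < μ a) :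
    SpecializesMonomials w v μ := by
  classical
  have hvw : 0 < v w := zero_lt_iff.2 ((Valuation.ne_zero_iff _).2 hw0)
  have hvπ : 0 < μ π := zero_lt_iff.2 ((Valuation.ne_zero_iff _).2 hπ0)
  intro Ψ hΨ
  have hq : ∀ q ∈ Ψ, ∃ N : ℕ, ∀ k ≥ N,
      μ (q.1.1 * (π ^ k) ^ q.1.2) < μ (q.2.1 * (π ^ k) ^ q.2.2) := by
    rintro ⟨⟨a, i⟩, ⟨c, j⟩⟩ hq
    have hlt := hΨ _ hq
    dsimp only at hlt ⊢
    have hc : c ≠ 0 := by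
      rintro rfl
      simp at hlt
    have hvc : 0 < μ c := zero_lt_iff.2 ((Valuation.ne_zero_iff _).2 hc)
    by_cases ha : a = 0
    · refine ⟨0, fun k _ => ?_⟩
      rw [ha, zero_mul, map_zero, map_mul, map_pow, map_pow]
      exact mul_pos hvc (pow_pos (pow_pos hvπ _) _)
    have hva : 0 < μ a := zero_lt_iff.2 ((Valuation.ne_zero_iff _).2 ha)
    rw [map_mul, map_mul, htriv a ha, htriv c hc, one_mul, one_mul, map_pow, map_pow,
      pow_lt_pow_iff_right_of_lt_one₀ hvw hw1] at hlt
    obtain ⟨N, hN⟩ := harch (c / a) (div_ne_zero hc ha)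
    refine ⟨N, fun k hk => ?_⟩
    obtain ⟨l, rfl⟩ := Nat.exists_eq_add_of_lt hlt
    rw [map_div₀, lt_div_iff₀ hva] at hN
    simp only [map_mul, map_pow]
    rw [add_assoc, pow_add, mul_left_comm, mul_comm (μ c)]
    refine mul_lt_mul_of_pos_left ?_ (pow_pos (pow_pos hvπ _) _)
    refine lt_of_le_of_lt ?_ hN
    rw [mul_comm]
    refine mul_le_mul_left ?_ _
    rw [← pow_mul]
    refine pow_le_pow_of_le_one zero_le hπ1.le (hk.trans ?_)
    exact Nat.le_mul_of_pos_right _ (Nat.succ_pos l)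
  choose! N hN using hq
  exact ⟨π ^ Ψ.sup N, fun q hq => hN q hq _ (Finset.le_sup hq)⟩

end StepCut

end Paper

namespace Paper

section StepRoots

open Polynomial

variable {Γ Γ' : Type*} [LinearOrderedCommGroupWithZero Γ] [LinearOrderedCommGroupWithZero Γ']

/-- The elements of `K` which are roots of multiples of `x` by nonzero constants from `M`. -/
def rootsOfMultiples (M : Type*) {K : Type*} [Field M] [Field K] [Algebra M K] (x : K) : Set K :=
  {w | ∃ n : ℕ, n ≠ 0 ∧ ∃ f : M, f ≠ 0 ∧ w ^ n = algebraMap M K f * x}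

variable {M K Ω : Type*} [Field M] [Field K] [Field Ω] [Algebra M K] [Algebra K Ω]

theorem self_mem_rootsOfMultiples (x : K) : x ∈ rootsOfMultiples M x :=
  ⟨1, one_ne_zero, 1, one_ne_zero, by simp⟩

theorem ne_zero_of_mem_rootsOfMultiples {x w : K} (hx : x ≠ 0) (hw : w ∈ rootsOfMultiples M x) :
    w ≠ 0 := by
  obtain ⟨n, hn, f, hf, hwf⟩ := hw
  rintro rfl
  rw [zero_pow hn] at hwf
  exact mul_ne_zero (by simpa using hf) hx hwf.symm

variable [IsAlgClosed Ω] [IsGalois K Ω]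

theorem ResidueSplit.pow_ne_of_mem_rootsOfMultiples {v : Valuation Ω Γ} (h : ResidueSplit M K v)
    {x w : K} (hx0 : x ≠ 0)
    (hx : ∀ m : M, v (algebraMap K Ω (algebraMap M K m)) ≠ v (algebraMap K Ω x))
    (hw : w ∈ rootsOfMultiples M x) (k : ℕ) (m : M) (hk : k ≠ 0) :
    v (algebraMap K Ω w) ^ k ≠ v (algebraMap K Ω (algebraMap M K m)) := by
  intro he
  have hw0 := ne_zero_of_mem_rootsOfMultiples hx0 hw
  obtain ⟨n, hn, f, hf, hwf⟩ := hw
  have hm : m ≠ 0 := by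
    rintro rfl
    simp [hk, hw0] at he
  obtain ⟨b, hb⟩ := h.exists_pow_eq_mul_base hk (a := m ^ n / f ^ k)
    (div_ne_zero (pow_ne_zero _ hm) (pow_ne_zero _ hf))
  refine hx b ((pow_left_inj₀ zero_le zero_le hk).1 ?_)
  have hvf : v (algebraMap K Ω (algebraMap M K f)) ^ k ≠ 0 := pow_ne_zero _ (by simpa using hf)
  rw [hb]
  simp only [map_div₀, map_pow]
  rw [div_eq_iff hvf, ← he, ← pow_mul, mul_comm k n, pow_mul, ← mul_pow]
  congr 1
  rw [← map_mul, ← map_mul, mul_comm, ← hwf, map_pow, map_pow]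

theorem ResidueSplit.mem_adjoin_of_pow_eq {v : Valuation Ω Γ} (h : ResidueSplit M K v)
    {y z : K} {n : ℕ} (hn : n ≠ 0) (hz : z ≠ 0) {c : M} (hc : z ^ n = algebraMap M K c * y ^ n)
    {N : IntermediateField M K} (hy : y ∈ N) : z ∈ N := by
  have hy0 : y ≠ 0 := by
    rintro rfl
    rw [zero_pow hn, mul_zero] at hc
    exact hz (pow_eq_zero_iff hn |>.1 hc)
  obtain ⟨d, hd⟩ := h.rac (z / y) (by
    refine IsAlgebraic.of_pow (Nat.pos_of_ne_zero hn) ?_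
    rw [div_pow, hc, mul_div_cancel_right₀ _ (pow_ne_zero _ hy0)]
    exact isAlgebraic_algebraMap _)
  have : z = algebraMap M K d * y := by rw [hd]; field_simp
  rw [this]
  exact mul_mem (N.algebraMap_mem _) hy

theorem ResidueSplit.directed_rootsOfMultiples {v : Valuation Ω Γ} (h : ResidueSplit M K v)
    {x : K} (hx0 : x ≠ 0) (T₀ : Finset K) (hT₀ : (T₀ : Set K) ⊆ rootsOfMultiples M x) :
    ∃ w ∈ rootsOfMultiples M x, ∀ t ∈ T₀, t ∈ IntermediateField.adjoin M {w} := by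
  classical
  induction T₀ using Finset.induction_on with
  | empty => exact ⟨x, self_mem_rootsOfMultiples x, by simp⟩
  | insert t T₀ _ ih =>
    rw [Finset.coe_insert, Set.insert_subset_iff] at hT₀
    obtain ⟨w, hw, hT⟩ := ih hT₀.2
    have hw0 := ne_zero_of_mem_rootsOfMultiples hx0 hw
    have ht0 := ne_zero_of_mem_rootsOfMultiples hx0 hT₀.1
    obtain ⟨n₁, hn₁, f₁, hf₁, h₁⟩ := hw
    obtain ⟨n₂, hn₂, f₂, hf₂, h₂⟩ := hT₀.1
    obtain ⟨y, c, hc0, -, hy⟩ := h.exists_pow_eq_mul (mul_ne_zero hn₁ hn₂) hx0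
    have hc0' : algebraMap M K c ≠ 0 := by simpa using hc0
    have hmem := IntermediateField.mem_adjoin_simple_self M y
    have hwy : w ∈ IntermediateField.adjoin M {y} :=
      h.mem_adjoin_of_pow_eq (y := y ^ n₂) (c := f₁ / c) hn₁ hw0 (by
        rw [← pow_mul, mul_comm n₂, hy, h₁, map_div₀]
        field_simp) (pow_mem hmem _)
    have hty : t ∈ IntermediateField.adjoin M {y} :=
      h.mem_adjoin_of_pow_eq (y := y ^ n₁) (c := f₂ / c) hn₂ ht0 (by
        rw [← pow_mul, hy, h₂, map_div₀]
        field_simp) (pow_mem hmem _)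
    refine ⟨y, ⟨_, mul_ne_zero hn₁ hn₂, c, hc0, hy⟩, fun s hs => ?_⟩
    rcases Finset.mem_insert.1 hs with rfl | hs
    · exact hty
    · exact IntermediateField.adjoin_simple_le_iff.2 hwy (hT s hs)

theorem ResidueSplit.immediate_rootsOfMultiples {v : Valuation Ω Γ} (h : ResidueSplit M K v)
    {x : K} (hx0 : x ≠ 0)
    (hx : ∀ m : M, v (algebraMap K Ω (algebraMap M K m)) ≠ v (algebraMap K Ω x))
    {z : K} (hz : z ≠ 0)
    (ha : IsAlgebraic (IntermediateField.adjoin M (rootsOfMultiples M x)) z) :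
    ∃ c ∈ IntermediateField.adjoin M (rootsOfMultiples M x),
      v (algebraMap K Ω (z - c)) < v (algebraMap K Ω z) := by
  classical
  obtain ⟨n, c, hn, hc0, hc⟩ := exists_pow_eq_of_isAlgebraic (v.comap (algebraMap K Ω)) hz ha
  obtain ⟨w, hw, hcw⟩ := exists_mem_adjoin_of_forall_mem_adjoin (rootsOfMultiples M x)
    (h.directed_rootsOfMultiples hx0) {(c : K)} (by simp)
  have hw0 := ne_zero_of_mem_rootsOfMultiples hx0 hw
  obtain ⟨r, s, hrs⟩ := (IntermediateField.mem_adjoin_simple_iff M _).1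
    (hcw _ (Finset.mem_singleton_self _))
  have hc0' : (c : K) ≠ 0 := by simpa using hc0
  rw [hrs] at hc0'
  have hr0 : r ≠ 0 := by
    rintro rfl
    simp at hc0'
  have hs0 : s ≠ 0 := by
    rintro rfl
    simp at hc0'
  have hpow := h.pow_ne_of_mem_rootsOfMultiples hx0 hx hw
  obtain ⟨i, hi, -, hri⟩ := exists_dominant_monomial (v := v.comap (algebraMap K Ω)) hw0
    hpow hr0
  obtain ⟨j, hj, -, hsj⟩ := exists_dominant_monomial (v := v.comap (algebraMap K Ω)) hw0
    hpow hs0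
  have hri0 : algebraMap M K (r.coeff i) ≠ 0 := by simpa using mem_support_iff.1 hi
  have hsj0 : algebraMap M K (s.coeff j) ≠ 0 := by simpa using mem_support_iff.1 hj
  have hunit : v (algebraMap K Ω (z ^ n * (algebraMap M K (s.coeff j) * w ^ j) /
      (algebraMap M K (r.coeff i) * w ^ i))) = 1 := by
    have h1 : v (algebraMap K Ω z) ^ n =
        v (algebraMap K Ω (algebraMap M K (r.coeff i) * w ^ i)) /
        v (algebraMap K Ω (algebraMap M K (s.coeff j) * w ^ j)) := by
      have e1 : algebraMap (IntermediateField.adjoin M (rootsOfMultiples M x)) K c = c := rfl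
      rw [e1, hrs, map_div₀, hri, hsj] at hc
      exact hc
    have h2 : v (algebraMap K Ω (algebraMap M K (r.coeff i) * w ^ i)) ≠ 0 := by
      simp [hw0, mem_support_iff.1 hi]
    have h3 : v (algebraMap K Ω (algebraMap M K (s.coeff j) * w ^ j)) ≠ 0 := by
      simp [hw0, mem_support_iff.1 hj]
    rw [map_div₀, map_div₀, map_mul, map_mul, map_pow, map_pow, h1, div_mul_cancel₀ _ h3,
      div_self h2]
  obtain ⟨c₁, hc₁, hc₁v, hc₁'⟩ := h.exists_unit_approx hunit
  have hc₁0 : algebraMap M K c₁ ≠ 0 := by simpa using hc₁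
  obtain ⟨t, ht, ht1⟩ := h.exists_pow_eq hn hc₁'
  have hvt : v (algebraMap K Ω t) = 1 :=
    valuation_eq_one_of_sub_lt_one v (by rwa [map_sub, map_one] at ht1)
  have ht0 : t ≠ 0 := by
    rintro rfl
    simp at hvt
  obtain ⟨w', c₂, hc₂, -, hw'⟩ := h.exists_pow_eq_mul hn hw0
  have hc₂0 : algebraMap M K c₂ ≠ 0 := by simpa using hc₂
  have hw'T : w' ∈ rootsOfMultiples M x := by
    obtain ⟨k, hk, f, hf, hwf⟩ := hw
    refine ⟨n * k, mul_ne_zero hn hk, c₂ ^ k * f, mul_ne_zero (pow_ne_zero _ hc₂) hf, ?_⟩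
    rw [pow_mul, hw', mul_pow, hwf, map_mul, map_pow, mul_assoc]
  have hw'0 := ne_zero_of_mem_rootsOfMultiples hx0 hw'T
  have hw'mem := IntermediateField.subset_adjoin M _ hw'T
  have hmem : z / t ∈ IntermediateField.adjoin M (rootsOfMultiples M x) := by
    refine h.mem_adjoin_of_pow_eq (y := w' ^ i / w' ^ j)
      (c := c₁ * r.coeff i / s.coeff j * c₂ ^ j / c₂ ^ i) hn (div_ne_zero hz ht0) ?_
      (div_mem (pow_mem hw'mem _) (pow_mem hw'mem _))
    have e1 : (w' ^ i / w' ^ j) ^ n = (w' ^ n) ^ i / (w' ^ n) ^ j := by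
      rw [div_pow, ← pow_mul, ← pow_mul, ← pow_mul, ← pow_mul, mul_comm i, mul_comm j]
    rw [e1, hw', div_pow, ht]
    simp only [map_div₀, map_mul, map_pow, mul_pow]
    field_simp
  obtain ⟨d, hd⟩ := h.exists_approx_of_valuation_eq (z := z) (y := z / t) (div_ne_zero hz ht0)
    (by rw [map_div₀, map_div₀, hvt, div_one])
  exact ⟨_, mul_mem hmem (IntermediateField.algebraMap_mem _ d), hd⟩

/-- The valuation on `M` induced from `Ω` is nontrivial, or it is trivial and `M` carries another
henselian archimedean valuation. -/
def HenselBase (M : Type*) {K Ω : Type*} [Field M] [Field K] [Field Ω] [Algebra M K] [Algebra K Ω]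
    (v : Valuation Ω Γ) (μ : Valuation M Γ') : Prop :=
  (∃ ε : M, ε ≠ 0 ∧ v (algebraMap K Ω (algebraMap M K ε)) < 1) ∨
    ((∀ m : M, m ≠ 0 → v (algebraMap K Ω (algebraMap M K m)) = 1) ∧ HenselRoots μ ∧
      ∃ π : M, π ≠ 0 ∧ μ π < 1 ∧ ∀ a : M, a ≠ 0 → ∃ N : ℕ, μ π ^ N < μ a)

theorem ResidueSplit.exists_algHom_cut [CharZero M] {v : Valuation Ω Γ} (h : ResidueSplit M K v)
    {μ : Valuation M Γ'} (hμ : HenselBase M (K := K) v μ) {x : K} (hx0 : x ≠ 0)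
    (hx1 : v (algebraMap K Ω x) < 1)
    (hx : ∀ m : M, v (algebraMap K Ω (algebraMap M K m)) ≠ v (algebraMap K Ω x))
    (S : Finset K) (hS : ∀ z ∈ S, IsAlgebraic (IntermediateField.adjoin M {x}) z) :
    Nonempty (Algebra.adjoin M (S : Set K) →ₐ[M] M) := by
  have hle : IntermediateField.adjoin M {x} ≤ IntermediateField.adjoin M (rootsOfMultiples M x) :=
    IntermediateField.adjoin_simple_le_iff.2
      (IntermediateField.subset_adjoin M _ (self_mem_rootsOfMultiples x))
  have hS' : ∀ z ∈ S, IsAlgebraic (IntermediateField.adjoin M (rootsOfMultiples M x)) z := by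
    intro z hz
    letI := (IntermediateField.inclusion hle).toAlgebra
    have : IsScalarTower (IntermediateField.adjoin M {x})
      (IntermediateField.adjoin M (rootsOfMultiples M x)) K :=
      IsScalarTower.of_algebraMap_eq fun _ => rfl
    exact (hS z hz).extendScalars (IntermediateField.inclusion hle).injective
  have hpow := fun w hw => h.pow_ne_of_mem_rootsOfMultiples hx0 hx (w := w) hw
  have htr : ∀ w ∈ rootsOfMultiples M x, Transcendental M w := fun w hw ha => by
    obtain ⟨c, rfl⟩ := h.rac w ha
    exact hpow _ hw 1 c one_ne_zero (pow_one _)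
  have himm := fun z hz ha => h.immediate_rootsOfMultiples hx0 hx (z := z) hz ha
  have hdir := h.directed_rootsOfMultiples (M := M) hx0
  rcases hμ with ⟨ε, hε0, hε⟩ | ⟨htriv, hμ, π, hπ0, hπ1, harch⟩
  · refine h.exists_algHom _ hdir htr _ h.henselRoots (fun w hw => ?_) himm S hS'
    have hw0 := ne_zero_of_mem_rootsOfMultiples hx0 hw
    refine SpecializesMonomials.specializes hw0 (hpow w hw) ?_
    obtain ⟨n, hn, f, hf, hwf⟩ := hw
    obtain ⟨b, hb⟩ := h.exists_pow_eq_mul_base hn hf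
    refine specializesMonomials_of_divisible (hi₀ := b) hw0
      (fun a ha n hn => h.exists_pow_eq_mul_base hn ha) ?_ hε0 hε
    refine (pow_lt_pow_iff_left₀ zero_le zero_le hn).1 ?_
    change v (algebraMap K Ω w) ^ n < v (algebraMap K Ω (algebraMap M K b)) ^ n
    rw [hb, ← map_pow, ← map_pow, hwf, map_mul, map_mul]
    exact mul_lt_of_lt_one_right (zero_lt_iff.2 (by simpa using hf)) hx1
  · refine h.exists_algHom _ hdir htr _ hμ (fun w hw => ?_) himm S hS'
    have hw0 := ne_zero_of_mem_rootsOfMultiples hx0 hw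
    refine SpecializesMonomials.specializes hw0 (hpow w hw) ?_
    obtain ⟨n, hn, f, hf, hwf⟩ := hw
    refine specializesMonomials_of_trivial htriv hw0 ?_ hπ0 hπ1 harch
    change v (algebraMap K Ω w) < 1
    rw [← pow_lt_one_iff_of_nonneg zero_le hn, ← map_pow, ← map_pow, hwf, map_mul, map_mul,
      htriv f hf, one_mul]
    exact hx1

/-- One step of the chain: retracting the algebraic elements over `M(x)`. -/
theorem ResidueSplit.exists_algHom_simple [CharZero M] {v : Valuation Ω Γ} (h : ResidueSplit M K v)
    {μ : Valuation M Γ'} (hμ : HenselBase M (K := K) v μ) (x : K)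
    (S : Finset K) (hS : ∀ z ∈ S, IsAlgebraic (IntermediateField.adjoin M {x}) z) :
    Nonempty (Algebra.adjoin M (S : Set K) →ₐ[M] M) := by
  by_cases himm : ∀ b : M, ∃ b' : M, v (algebraMap K Ω (x - algebraMap M K b')) <
      v (algebraMap K Ω (x - algebraMap M K b))
  · exact h.exists_algHom_immediate himm S hS
  push Not at himm
  obtain ⟨b, hb⟩ := himm
  by_cases hxb : x = algebraMap M K b
  · have hbot : IntermediateField.adjoin M {x} = ⊥ := by
      rw [IntermediateField.adjoin_simple_eq_bot_iff, hxb]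
      exact IntermediateField.algebraMap_mem _ _
    have hle : Algebra.adjoin M (S : Set K) ≤ ⊥ := by
      rw [Algebra.adjoin_le_iff]
      intro z hz
      have hz' := hS z hz
      rw [hbot] at hz'
      have : IsAlgebraic M z := by
        refine (hz'.restrictScalars (R := M) (S := (⊥ : IntermediateField M K)))
      obtain ⟨c, hc⟩ := h.rac z this
      exact Algebra.mem_bot.2 ⟨c, hc⟩
    exact ⟨(Algebra.botEquiv M K).toAlgHom.comp (Subalgebra.inclusion hle)⟩
  have hy0 : x - algebraMap M K b ≠ 0 := sub_ne_zero.2 hxb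
  have hy : ∀ m : M, v (algebraMap K Ω (algebraMap M K m)) ≠
      v (algebraMap K Ω (x - algebraMap M K b)) := by
    intro m hm
    have hm0 : algebraMap M K m ≠ 0 := by
      intro h0
      rw [h0, map_zero, map_zero] at hm
      exact hy0 ((map_eq_zero _).1 ((Valuation.zero_iff _).1 hm.symm))
    obtain ⟨c, hc⟩ := h.exists_approx_of_valuation_eq hm0 hm.symm
    refine (hb (b + m * c)).not_gt ?_
    rwa [map_add, map_mul, ← sub_sub]
  have hone : v (algebraMap K Ω (x - algebraMap M K b)) ≠ 1 := fun h1 => hy 1 (by rw [h1]; simp)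
  have hmem : ∀ y : K, x - algebraMap M K b ∈ IntermediateField.adjoin M {y} →
      ∀ z ∈ S, IsAlgebraic (IntermediateField.adjoin M {y}) z := by
    intro y hy z hz
    have hle : IntermediateField.adjoin M {x} ≤ IntermediateField.adjoin M {y} := by
      rw [IntermediateField.adjoin_simple_le_iff]
      have := add_mem hy (IntermediateField.algebraMap_mem _ b)
      rwa [sub_add_cancel] at this
    letI := (IntermediateField.inclusion hle).toAlgebra
    have : IsScalarTower (IntermediateField.adjoin M {x})
      (IntermediateField.adjoin M {y}) K := IsScalarTower.of_algebraMap_eq fun _ => rfl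
    exact (hS z hz).extendScalars (IntermediateField.inclusion hle).injective
  rcases lt_or_gt_of_ne hone with h1 | h1
  · exact h.exists_algHom_cut hμ hy0 h1 hy S
      (hmem _ (IntermediateField.mem_adjoin_simple_self _ _))
  · refine h.exists_algHom_cut hμ (inv_ne_zero hy0) ?_ (fun m hm => ?_) S (hmem _ ?_)
    · rw [map_inv₀, map_inv₀]
      exact inv_lt_one_of_one_lt₀ h1
    · refine hy m⁻¹ ?_
      rw [map_inv₀, map_inv₀, map_inv₀, hm, map_inv₀, map_inv₀, inv_inv]
    · have := inv_mem (IntermediateField.mem_adjoin_simple_self M (x - algebraMap M K b)⁻¹)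
      rwa [inv_inv] at this

end StepRoots

end Paper

namespace Paper

section Chain

open Polynomial

theorem exists_algHom_adjoin_trans {C B D L : Type*} [CommRing C] [CommRing B] [CommRing D]
    [CommRing L] [Algebra C B] [Algebra C D] [Algebra C L] (S : Finset B)
    (f : Algebra.adjoin C (S : Set B) →ₐ[C] D)
    (hD : ∀ S : Finset D, Nonempty (Algebra.adjoin C (S : Set D) →ₐ[C] L)) :
    Nonempty (Algebra.adjoin C (S : Set B) →ₐ[C] L) := by
  classical
  let S₁ : Finset D := S.attach.image fun b : {b // b ∈ S} => f ⟨b, Algebra.subset_adjoin b.2⟩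
  obtain ⟨ρ⟩ := hD S₁
  have hle : f.range ≤ Algebra.adjoin C (S₁ : Set D) := by
    rw [← Algebra.map_top, ← Algebra.adjoin_adjoin_coe_preimage, AlgHom.map_adjoin]
    refine Algebra.adjoin_mono ?_
    rintro _ ⟨b, hb, rfl⟩
    exact Finset.mem_coe.2 (Finset.mem_image.2 ⟨⟨b, hb⟩, Finset.mem_attach _ _, rfl⟩)
  exact ⟨ρ.comp ((Subalgebra.inclusion hle).comp f.rangeRestrict)⟩

theorem exists_algHom_restrict {F K : Type*} [Field F] [Field K] [Algebra F K] [DecidableEq K]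
    {M M' : IntermediateField F K} (S : Finset M')
    (ρ : Algebra.adjoin M ((S.image (fun s : M' => (s : K)) : Finset K) : Set K) →ₐ[M] M) :
    Nonempty (Algebra.adjoin F (S : Set M') →ₐ[F] M) := by
  let B : Subalgebra F K := (Algebra.adjoin M
    ((S.image (fun s : M' => (s : K)) : Finset K) : Set K)).restrictScalars F
  have hB : (Algebra.adjoin F (S : Set M')).map M'.val ≤ B := by
    rw [AlgHom.map_adjoin, Algebra.adjoin_le_iff]
    rintro _ ⟨s, hs, rfl⟩
    have : (s : K) ∈ Algebra.adjoin M ((S.image (fun s : M' => (s : K)) : Finset K) : Set K) :=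
      Algebra.subset_adjoin (Finset.mem_coe.2 (Finset.mem_image.2 ⟨s, hs, rfl⟩))
    exact this
  let f : Algebra.adjoin F (S : Set M') →ₐ[F] B :=
    (M'.val.comp (Algebra.adjoin F (S : Set M')).val).codRestrict B fun s =>
      hB ⟨s, s.2, rfl⟩
  let g : B →ₐ[F] M := ρ.restrictScalars F
  exact ⟨g.comp f⟩

variable {Γ Γ' : Type*} [LinearOrderedCommGroupWithZero Γ] [LinearOrderedCommGroupWithZero Γ']

theorem HenselRoots.comap_ringEquiv {M N : Type*} [Field M] [Field N] {μ : Valuation N Γ}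
    (h : HenselRoots μ) (σ : M ≃+* N) : HenselRoots (μ.comap (σ : M →+* N)) := by
  intro n e hdeg he
  obtain ⟨r, hr, hr1⟩ := h n (e.map (σ : M →+* N)) (degree_map_le.trans_lt hdeg) fun i => by
    rw [coeff_map]; exact he i
  have hmap : X ^ (n + 1) - X ^ n + e.map (σ : M →+* N) =
      (X ^ (n + 1) - X ^ n + e).map (σ : M →+* N) := by simp
  refine ⟨σ.symm r, ?_, ?_⟩
  · refine σ.injective ?_
    rw [map_zero, ← hr, hmap]
    have := Polynomial.hom_eval₂ (X ^ (n + 1) - X ^ n + e) (RingHom.id M) (σ : M →+* N) (σ.symm r)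
    rw [RingHom.comp_id] at this
    rw [eval_map, ← RingEquiv.coe_toRingHom σ, eval, this]
    simp
  · simpa using hr1

variable {F K Ω : Type*} [Field F] [Field K] [Field Ω] [Algebra F K] [Algebra K Ω]

theorem ResidueSplit.intermediateField {v : Valuation Ω Γ} (h : ResidueSplit F K v)
    {M : IntermediateField F K} (hM : ∀ z : K, IsAlgebraic M z → z ∈ M) : ResidueSplit M K v where
  inv := h.inv
  nat := h.nat
  res z hz := by
    obtain ⟨c, hc⟩ := h.res z hz
    exact ⟨algebraMap F M c, hc⟩
  div := h.div
  rac z hz := ⟨⟨z, hM z hz⟩, rfl⟩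

variable [IsAlgClosed Ω] [CharZero F] [IsGalois K Ω]

theorem ResidueSplit.exists_algHom_simple_intermediateField {v : Valuation Ω Γ}
    (h : ResidueSplit F K v)
    {μ : Valuation F Γ'} (hμ : HenselRoots μ) {π : F} (hπ0 : π ≠ 0) (hπ1 : μ π < 1)
    (harch : ∀ a : F, a ≠ 0 → ∃ N : ℕ, μ π ^ N < μ a)
    {M : IntermediateField F K} (hM : ∀ z : K, IsAlgebraic M z → z ∈ M) (x : K)
    (S : Finset K) (hS : ∀ z ∈ S, IsAlgebraic (IntermediateField.adjoin M {x}) z) :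
    Nonempty (Algebra.adjoin M (S : Set K) →ₐ[M] M) := by
  have : CharZero M := charZero_of_injective_algebraMap (algebraMap F M).injective
  have hspl := h.intermediateField hM
  by_cases hex : ∃ ε : M, ε ≠ 0 ∧ v (algebraMap K Ω (algebraMap M K ε)) < 1
  · exact hspl.exists_algHom_simple (μ := v.comap ((algebraMap K Ω).comp (algebraMap M K)))
      (Or.inl hex) x S hS
  · push Not at hex
    have htriv' : ∀ m : M, m ≠ 0 → v (algebraMap K Ω (algebraMap M K m)) = 1 := by
      intro m hm
      refine le_antisymm ?_ (hex m hm)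
      have := hex m⁻¹ (inv_ne_zero hm)
      rw [map_inv₀, map_inv₀, map_inv₀] at this
      rwa [one_le_inv₀ (zero_lt_iff.2 (by simpa using hm))] at this
    have hsurj : Function.Surjective (algebraMap F M) := by
      intro m
      by_cases hm : m = 0
      · exact ⟨0, by rw [hm, map_zero]⟩
      obtain ⟨c, hc⟩ := h.res (algebraMap M K m) (htriv' m hm).le
      refine ⟨c, ?_⟩
      by_contra hne
      have := htriv' (m - algebraMap F M c) (sub_ne_zero.2 fun h => hne h.symm)
      rw [map_sub (algebraMap M K)] at this
      exact hc.ne this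
    let σ : F ≃+* M := RingEquiv.ofBijective (algebraMap F M) ⟨(algebraMap F M).injective, hsurj⟩
    refine hspl.exists_algHom_simple (μ := μ.comap (σ.symm : M →+* F))
      (Or.inr ⟨htriv', hμ.comap_ringEquiv σ.symm, σ π, by simpa using hπ0, by simpa using hπ1,
        fun a ha => ?_⟩) x S hS
    obtain ⟨N, hN⟩ := harch (σ.symm a) (by simpa using ha)
    exact ⟨N, by simpa using hN⟩

/-- `F` is existentially closed in `K`. -/
theorem ResidueSplit.exists_algHom_adjoin {v : Valuation Ω Γ} (h : ResidueSplit F K v)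
    {μ : Valuation F Γ'} (hμ : HenselRoots μ) {π : F} (hπ0 : π ≠ 0) (hπ1 : μ π < 1)
    (harch : ∀ a : F, a ≠ 0 → ∃ N : ℕ, μ π ^ N < μ a) (S : Finset K) :
    Nonempty (Algebra.adjoin F (S : Set K) →ₐ[F] F) := by
  classical
  have key : ∀ T : Finset K, ∃ M : IntermediateField F K, (∀ z : K, IsAlgebraic M z → z ∈ M) ∧
      (∀ z ∈ T, z ∈ M) ∧ ∀ S : Finset M, Nonempty (Algebra.adjoin F (S : Set M) →ₐ[F] F) := by
    intro T
    induction T using Finset.induction_on with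
    | empty =>
      refine ⟨⊥, fun z hz => ?_, by simp, fun S => ⟨?_⟩⟩
      · have hz' : IsAlgebraic F z := hz.restrictScalars (S := (⊥ : IntermediateField F K)) F
        obtain ⟨c, rfl⟩ := h.rac z hz'
        exact IntermediateField.algebraMap_mem _ c
      · exact (IntermediateField.botEquiv F K).toAlgHom.comp (Algebra.adjoin F _).val
    | insert x T _ ih =>
      obtain ⟨M, hM, hTM, hec⟩ := ih
      have : IsScalarTower F (IntermediateField.adjoin M {x}) K :=
        IsScalarTower.of_algebraMap_eq fun _ => rfl
      let N := algebraicClosure (IntermediateField.adjoin M {x}) K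
      let M' : IntermediateField F K := N.restrictScalars F
      have hmem : ∀ z : K, z ∈ M' ↔ IsAlgebraic (IntermediateField.adjoin M {x}) z := fun z =>
        mem_algebraicClosure_iff
      refine ⟨M', fun z hz => ?_, fun z hz => ?_, fun S => ?_⟩
      · have h1 : IsAlgebraic N z := hz
        have h2 : z ∈ algebraicClosure N K := mem_algebraicClosure_iff.2 h1
        rw [algebraicClosure.algebraicClosure_eq_bot, IntermediateField.mem_bot] at h2
        obtain ⟨y, rfl⟩ := h2
        exact y.2
      · rw [hmem]
        have : z ∈ IntermediateField.adjoin M {x} := by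
          rcases Finset.mem_insert.1 hz with rfl | hz
          · exact IntermediateField.mem_adjoin_simple_self M z
          · exact IntermediateField.algebraMap_mem _ (⟨z, hTM z hz⟩ : M)
        exact isAlgebraic_algebraMap (⟨z, this⟩ : IntermediateField.adjoin M {x})
      · obtain ⟨ρ⟩ := h.exists_algHom_simple_intermediateField hμ hπ0 hπ1 harch hM x
          (S.image (fun s : M' => (s : K))) fun z hz => by
            obtain ⟨s, -, rfl⟩ := Finset.mem_image.1 hz
            exact (hmem _).1 s.2
        obtain ⟨f⟩ := exists_algHom_restrict S ρ
        exact exists_algHom_adjoin_trans S f hec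
  obtain ⟨M, -, hSM, hM⟩ := key S
  have hle : Algebra.adjoin F (S : Set K) ≤ M.toSubalgebra := Algebra.adjoin_le_iff.2 hSM
  exact exists_algHom_adjoin_trans S (Subalgebra.inclusion hle) hM

end Chain

end Paper

namespace Paper

section MaximalResidue

open Polynomial

variable {Γ Γ' : Type*} [LinearOrderedCommGroupWithZero Γ] [LinearOrderedCommGroupWithZero Γ']
variable {F K Ω : Type*} [Field F] [Field K] [Field Ω] [Algebra F K] [Algebra K Ω]
  [Algebra F Ω]

/-- Every element of the valuation ring of `N` is congruent to a constant from `F`. -/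
def SameResidue (F : Type*) [Field F] [Algebra F Ω] (v : Valuation Ω Γ)
    (N : IntermediateField K Ω) : Prop :=
  ∀ z ∈ N, v z ≤ 1 → ∃ c : F, v (z - algebraMap F Ω c) < 1

theorem exists_maximal_sameResidue (v : Valuation Ω Γ)
    (h : SameResidue F v (⊥ : IntermediateField K Ω)) :
    ∃ N : IntermediateField K Ω, Maximal (SameResidue F v) N := by
  obtain ⟨N, -, hN⟩ := zorn_le_nonempty₀ {N : IntermediateField K Ω | SameResidue F v N}
    (fun c hc hchain N hN => by
      refine ⟨sSup c, ?_, fun z hz => le_sSup hz⟩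
      intro z hz hz1
      have : Nonempty c := ⟨⟨N, hN⟩⟩
      rw [sSup_eq_iSup', ← SetLike.mem_coe, IntermediateField.coe_iSup_of_directed
        hchain.directed] at hz
      obtain ⟨M, hzM⟩ := Set.mem_iUnion.1 hz
      exact hc M.2 z hzM hz1) ⊥ h
  exact ⟨N, hN⟩

/-- Adjoining a root of minimal order of a value does not change residues. -/
theorem SameResidue.adjoin_root {v : Valuation Ω Γ} {N : IntermediateField K Ω}
    (h : SameResidue F v N) {β : Ω} {m : ℕ} (hm : m ≠ 0) (hβ0 : β ≠ 0) (hβ : β ^ m ∈ N)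
    (hmin : ∀ k, k ≠ 0 → k < m → ∀ z ∈ N, v β ^ k ≠ v z) :
    SameResidue F v ((IntermediateField.adjoin N {β}).restrictScalars K) := by
  classical
  have hvβ : v β ≠ 0 := (Valuation.ne_zero_iff _).2 hβ0
  let q : Polynomial N := X ^ m - C ⟨β ^ m, hβ⟩
  have hq : q.Monic := monic_X_pow_sub_C _ hm
  have hqβ : aeval β q = 0 := by
    simp only [q, map_sub, map_pow, aeval_X, aeval_C]
    exact sub_self _
  have hint : IsIntegral N β := ⟨q, hq, hqβ⟩
  have hkey : ∀ i j (a c : N), i < j → j < m → c ≠ 0 →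
      v ((a : Ω) * β ^ i) ≠ v ((c : Ω) * β ^ j) := by
    intro i j a c hij hj hc he
    have hvc : v (c : Ω) ≠ 0 := by simpa using hc
    obtain ⟨k, rfl⟩ := Nat.exists_eq_add_of_lt hij
    rw [map_mul, map_mul, map_pow, map_pow, add_assoc, pow_add, mul_left_comm,
      mul_comm _ (v β ^ i)] at he
    have he' := mul_left_cancel₀ (pow_ne_zero _ hvβ) he
    refine hmin (k + 1) (Nat.succ_ne_zero k) (by omega) (a / c) (div_mem a.2 c.2) ?_
    rw [map_div₀, he', mul_div_cancel_left₀ _ hvc]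
  intro z hz hz1
  have hz' : z ∈ Algebra.adjoin N {β} := by
    rw [← IntermediateField.adjoin_simple_toSubalgebra_of_isAlgebraic hint.isAlgebraic]
    exact hz
  obtain ⟨p, rfl⟩ := Algebra.adjoin_mem_exists_aeval N β hz'
  obtain ⟨r, hr, hrp⟩ : ∃ r : Polynomial N, r.natDegree < m ∧ aeval β r = aeval β p := by
    refine ⟨p %ₘ q, ?_, ?_⟩
    · have := natDegree_modByMonic_lt p hq (fun h1 => by
        have := congrArg natDegree h1
        rw [natDegree_X_pow_sub_C, natDegree_one] at this
        exact hm this)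
      rwa [natDegree_X_pow_sub_C] at this
    · exact aeval_modByMonic_eq_self_of_root hqβ
  rw [← hrp] at hz1 ⊢
  by_cases hlt : v (aeval β r) < 1
  · exact ⟨0, by simpa using hlt⟩
  have hz1' : v (aeval β r) = 1 := le_antisymm hz1 (not_lt.1 hlt)
  have hr0 : r ≠ 0 := by
    rintro rfl
    simp at hz1'
  have hsum : aeval β r = ∑ i ∈ r.support, (r.coeff i : Ω) * β ^ i := by
    rw [aeval_def, eval₂_eq_sum, Polynomial.sum]
    rfl
  have hdeg : ∀ i ∈ r.support, i < m := fun i hi =>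
    (le_natDegree_of_mem_supp i hi).trans_lt hr
  obtain ⟨j, hj, h1, h2⟩ := exists_dominant_term v (fun i => (r.coeff i : Ω) * β ^ i) r.support
    (Finset.nonempty_iff_ne_empty.2 fun h => hr0 (support_eq_empty.1 h)) fun i hi j hj he => by
      rcases lt_trichotomy i j with hij | hij | hij
      · exact absurd he (hkey i j _ _ hij (hdeg j hj) (mem_support_iff.1 hj))
      · exact hij
      · exact absurd he.symm (hkey j i _ _ hij (hdeg i hi) (mem_support_iff.1 hi))
  rw [← hsum, hz1'] at h2
  have hj0 : j = 0 := by
    by_contra hj0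
    have := hkey 0 j 1 (r.coeff j) (Nat.pos_of_ne_zero hj0) (hdeg j hj) (mem_support_iff.1 hj)
    refine this ?_
    rw [← h2]
    simp
  subst hj0
  rw [pow_zero, mul_one] at h1 h2
  obtain ⟨c, hc⟩ := h (r.coeff 0) (r.coeff 0).2 h2.ge
  refine ⟨c, ?_⟩
  have hrest : v (aeval β r - r.coeff 0) < 1 := by
    have : aeval β r - r.coeff 0 = ∑ i ∈ r.support.erase 0, (r.coeff i : Ω) * β ^ i := by
      rw [hsum, ← Finset.add_sum_erase _ _ hj, pow_zero, mul_one, add_sub_cancel_left]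
    rw [this]
    refine v.map_sum_lt one_ne_zero fun i hi => ?_
    rw [h2]
    exact h1 i (Finset.mem_of_mem_erase hi) (Finset.ne_of_mem_erase hi)
  have : aeval β r - algebraMap F Ω c = (aeval β r - r.coeff 0) + (r.coeff 0 - algebraMap F Ω c) := by
    ring
  rw [this]
  exact v.map_add_lt hrest hc

/-- A valuation which is trivial on `F` is trivial on the elements algebraic over `F`. -/
theorem valuation_eq_one_of_isAlgebraic {v : Valuation Ω Γ}
    (htriv : ∀ m : F, m ≠ 0 → v (algebraMap F Ω m) = 1) {z : Ω} (hz : z ≠ 0)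
    (ha : IsAlgebraic F z) : v z = 1 := by
  obtain ⟨n, c, hn, hc, he⟩ := exists_pow_eq_of_isAlgebraic v hz ha
  rw [htriv c hc] at he
  exact (pow_eq_one_iff_of_nonneg zero_le hn).1 he

variable [IsAlgClosed Ω]

theorem exists_pow_eq_of_maximal_sameResidue {v : Valuation Ω Γ} {N : IntermediateField K Ω}
    (h : Maximal (SameResidue F v) N) {z : Ω} (hzN : z ∈ N) (hz : z ≠ 0) {n : ℕ} (hn : n ≠ 0) :
    ∃ y ∈ N, v y ^ n = v z := by
  classical
  obtain ⟨α, hα⟩ := IsAlgClosed.exists_pow_nat_eq z (Nat.pos_of_ne_zero hn)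
  have hex : ∃ m, m ≠ 0 ∧ ∃ y ∈ N, v α ^ m = v y := ⟨n, hn, z, hzN, by rw [← map_pow, hα]⟩
  obtain ⟨hm, y, hy, hαy⟩ := Nat.find_spec hex
  set m := Nat.find hex
  obtain ⟨β, hβ⟩ := IsAlgClosed.exists_pow_nat_eq y (Nat.pos_of_ne_zero hm)
  have hα0 : α ≠ 0 := by
    rintro rfl
    rw [zero_pow hn] at hα
    exact hz hα.symm
  have hvβ : v β = v α := by
    refine (pow_left_inj₀ zero_le zero_le hm).1 ?_
    rw [hαy, ← map_pow, hβ]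
  have hβ0 : β ≠ 0 := by
    rintro rfl
    rw [map_zero] at hvβ
    exact hα0 ((Valuation.zero_iff _).1 hvβ.symm)
  have hres := h.1.adjoin_root hm hβ0 (by rwa [hβ]) (fun k hk hkm z hz he =>
    Nat.find_min hex hkm ⟨hk, z, hz, by rw [← hvβ, he]⟩)
  have hle : N ≤ (IntermediateField.adjoin N {β}).restrictScalars K := fun y hy =>
    IntermediateField.algebraMap_mem (IntermediateField.adjoin N {β}) (⟨y, hy⟩ : N)
  refine ⟨β, h.2 hres hle (IntermediateField.mem_adjoin_simple_self N β), ?_⟩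
  rw [hvβ, ← map_pow, hα]

variable [IsScalarTower F K Ω]

theorem exists_residueSplit {v : Valuation Ω Γ} (hinv : ∀ (σ : Ω ≃ₐ[K] Ω) (x : Ω), v (σ x) = v x)
    (hnat : ∀ n : ℕ, n ≠ 0 → v (n : Ω) = 1)
    (hres : ∀ z : K, v (algebraMap K Ω z) ≤ 1 →
      ∃ c : F, v (algebraMap K Ω (z - algebraMap F K c)) < 1)
    (htriv : ∀ m : F, m ≠ 0 → v (algebraMap F Ω m) = 1) :
    ∃ N : IntermediateField K Ω, ResidueSplit F N v := by
  have hbot : SameResidue F v (⊥ : IntermediateField K Ω) := by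
    intro z hz hz1
    obtain ⟨y, rfl⟩ := IntermediateField.mem_bot.1 hz
    obtain ⟨c, hc⟩ := hres y hz1
    refine ⟨c, ?_⟩
    rwa [map_sub, ← IsScalarTower.algebraMap_apply] at hc
  obtain ⟨N, hN⟩ := exists_maximal_sameResidue v hbot
  have : IsScalarTower F N Ω := IsScalarTower.of_algebraMap_eq fun _ => rfl
  refine ⟨N, fun σ x => hinv (σ.restrictScalars K) x, hnat, fun z hz => ?_,
    fun z hz n hn => ?_, fun z hz => ?_⟩
  · obtain ⟨c, hc⟩ := hN.1 z z.2 hz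
    exact ⟨c, hc⟩
  · obtain ⟨y, hy, hyz⟩ := exists_pow_eq_of_maximal_sameResidue hN z.2
      (by simpa using hz) hn
    exact ⟨⟨y, hy⟩, hyz⟩
  · have hz' : IsAlgebraic F (z : Ω) := hz.algebraMap (A := Ω)
    have hz1 : v (z : Ω) ≤ 1 := by
      by_cases hz0 : (z : Ω) = 0
      · simp [hz0]
      · exact (valuation_eq_one_of_isAlgebraic htriv hz0 hz').le
    obtain ⟨c, hc⟩ := hN.1 z z.2 hz1
    refine ⟨c, Subtype.ext ?_⟩
    by_contra hne
    refine hc.ne (valuation_eq_one_of_isAlgebraic htriv (sub_ne_zero.2 fun h => hne h.symm)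
      (hz'.sub (isAlgebraic_algebraMap c)))

theorem exists_algHom_adjoin_of_sameResidue [CharZero F] [Algebra.IsAlgebraic K Ω]
    {v : Valuation Ω Γ} (hinv : ∀ (σ : Ω ≃ₐ[K] Ω) (x : Ω), v (σ x) = v x)
    (hnat : ∀ n : ℕ, n ≠ 0 → v (n : Ω) = 1)
    (hres : ∀ z : K, v (algebraMap K Ω z) ≤ 1 →
      ∃ c : F, v (algebraMap K Ω (z - algebraMap F K c)) < 1)
    (htriv : ∀ m : F, m ≠ 0 → v (algebraMap F Ω m) = 1)
    {μ : Valuation F Γ'} (hμ : HenselRoots μ) {π : F} (hπ0 : π ≠ 0) (hπ1 : μ π < 1)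
    (harch : ∀ a : F, a ≠ 0 → ∃ N : ℕ, μ π ^ N < μ a) (S : Finset K) :
    Nonempty (Algebra.adjoin F (S : Set K) →ₐ[F] F) := by
  have : CharZero K := charZero_of_injective_algebraMap (algebraMap F K).injective
  obtain ⟨N, hN⟩ := exists_residueSplit hinv hnat hres htriv
  have : CharZero N := charZero_of_injective_algebraMap (algebraMap K N).injective
  have : Algebra.IsAlgebraic N Ω := Algebra.IsAlgebraic.tower_top (K := K) N
  have : IsAlgClosure N Ω := ⟨inferInstance, inferInstance⟩
  have : IsGalois N Ω := IsAlgClosure.isGalois N Ω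
  exact exists_algHom_adjoin_trans S
    ((IsScalarTower.toAlgHom F K N).comp (Algebra.adjoin F (S : Set K)).val)
    (hN.exists_algHom_adjoin hμ hπ0 hπ1 harch)

end MaximalResidue

end Paper

namespace Paper

section Coarsening

open Polynomial

variable {K : Type*} [Field K] {Γ : Type*} [LinearOrderedCommGroupWithZero Γ]

/-- The valuation ring obtained from that of `v` by inverting `π`. -/
def coarsening (v : Valuation K Γ) (π : K) (hπ : v π ≤ 1) : ValuationSubring K where
  carrier := {z | ∃ n : ℕ, v π ^ n * v z ≤ 1}
  mul_mem' := by
    rintro a b ⟨m, hm⟩ ⟨n, hn⟩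
    refine ⟨m + n, ?_⟩
    rw [pow_add, map_mul, mul_mul_mul_comm]
    exact mul_le_one' hm hn
  one_mem' := ⟨0, by simp⟩
  add_mem' := by
    rintro a b ⟨m, hm⟩ ⟨n, hn⟩
    refine ⟨m + n, ?_⟩
    rw [← map_pow, ← map_mul, mul_add]
    refine (v.map_add _ _).trans (max_le ?_ ?_)
    · rw [map_mul, map_pow, pow_add, mul_right_comm]
      exact mul_le_one' hm (pow_le_one' hπ n)
    · rw [map_mul, map_pow, pow_add, mul_assoc]
      exact mul_le_one' (pow_le_one' hπ m) hn
  zero_mem' := ⟨0, by simp⟩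
  neg_mem' := by
    rintro a ⟨m, hm⟩
    exact ⟨m, by rwa [Valuation.map_neg]⟩
  mem_or_inv_mem' := by
    intro a
    rcases le_total (v a) 1 with h | h
    · exact Or.inl ⟨0, by simpa using h⟩
    · refine Or.inr ⟨0, ?_⟩
      rw [pow_zero, one_mul, map_inv₀]
      exact inv_le_one_of_one_le₀ h

theorem mem_coarsening {v : Valuation K Γ} {π : K} {hπ : v π ≤ 1} {z : K} :
    z ∈ coarsening v π hπ ↔ ∃ n : ℕ, v π ^ n * v z ≤ 1 := Iff.rfl

theorem coarsening_valuation_lt_one_iff {v : Valuation K Γ} {π : K} {hπ : v π ≤ 1} (h0 : π ≠ 0)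
    {z : K} : (coarsening v π hπ).valuation z < 1 ↔ ∀ n : ℕ, v z < v π ^ n := by
  have hvπ : 0 < v π := zero_lt_iff.2 ((Valuation.ne_zero_iff _).2 h0)
  rcases eq_or_ne z 0 with rfl | hz
  · simpa using fun n => pow_pos hvπ n
  have hvz : 0 < v z := zero_lt_iff.2 ((Valuation.ne_zero_iff _).2 hz)
  have hwz : 0 < (coarsening v π hπ).valuation z :=
    zero_lt_iff.2 ((Valuation.ne_zero_iff _).2 hz)
  rw [← one_lt_inv₀ hwz, ← map_inv₀, ← not_le, ValuationSubring.valuation_le_one_iff,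
    mem_coarsening, not_exists]
  refine forall_congr' fun n => ?_
  rw [map_inv₀, mul_inv_le_iff₀ hvz, one_mul, not_le]

theorem HenselRoots.coarsening {v : Valuation K Γ} (hv : HenselRoots v) {π : K} {hπ : v π ≤ 1}
    (h0 : π ≠ 0) : HenselRoots (coarsening v π hπ).valuation := by
  intro n e hdeg he
  have he' : ∀ i k, v (e.coeff i) < v π ^ k := fun i => (coarsening_valuation_lt_one_iff h0).1 (he i)
  obtain ⟨r, hr, hr1⟩ := hv n e hdeg fun i => by simpa using he' i 0
  refine ⟨r, hr, (coarsening_valuation_lt_one_iff h0).2 fun k => ?_⟩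
  have hvr : v r = 1 := valuation_eq_one_of_sub_lt_one v hr1
  have hk : v π ^ k ≠ 0 := pow_ne_zero _ ((Valuation.ne_zero_iff _).2 h0)
  have h1 : v (r ^ n * (r - 1)) = v (r - 1) := by rw [map_mul, map_pow, hvr, one_pow, one_mul]
  have h2 : r ^ n * (r - 1) = - e.eval r := by
    simp only [eval_add, eval_sub, eval_pow, eval_X] at hr
    linear_combination hr
  rw [← h1, h2, Valuation.map_neg, eval_eq_sum_range]
  refine v.map_sum_lt hk fun i _ => ?_
  rw [map_mul, map_pow, hvr, one_pow, mul_one]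
  exact he' i k

theorem exists_valuation_comap_isEquiv (A : ValuationSubring K) (Ω : Type*) [Field Ω]
    [Algebra K Ω] : ∃ B : ValuationSubring Ω,
      (B.valuation.comap (algebraMap K Ω)).IsEquiv A.valuation := by
  obtain ⟨B, hB, hloc⟩ :=
    IsLocalRing.exists_factor_valuationRing ((algebraMap K Ω).comp A.subtype)
  refine ⟨B, Valuation.isEquiv_of_val_le_one fun {z} => ?_⟩
  rw [Valuation.comap_apply, ValuationSubring.valuation_le_one_iff,
    ValuationSubring.valuation_le_one_iff]
  refine ⟨fun hz => ?_, fun hz => hB ⟨z, hz⟩⟩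
  by_contra hzA
  have hz0 : z ≠ 0 := by
    rintro rfl
    exact hzA A.zero_mem
  have hinv : z⁻¹ ∈ A := (A.mem_or_inv_mem z).resolve_left hzA
  have hu : IsUnit ((((algebraMap K Ω).comp A.subtype).codRestrict B.toSubring hB) ⟨z⁻¹, hinv⟩) := by
    refine IsUnit.of_mul_eq_one ⟨algebraMap K Ω z, hz⟩ (Subtype.ext ?_)
    change algebraMap K Ω z⁻¹ * algebraMap K Ω z = 1
    rw [← map_mul, inv_mul_cancel₀ hz0, map_one]
  obtain ⟨c, hc⟩ := (hloc.map_nonunit _ hu).exists_right_inv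
  have hc' : z⁻¹ * (c : K) = 1 := congrArg Subtype.val hc
  refine hzA ?_
  have : z = c := by
    field_simp at hc'
    exact hc'.symm
  rw [this]
  exact c.2

theorem HenselRoots.of_isEquiv {Γ' : Type*} [LinearOrderedCommGroupWithZero Γ']
    {v : Valuation K Γ} {w : Valuation K Γ'} (hv : HenselRoots v) (h : w.IsEquiv v) :
    HenselRoots w := by
  intro n e hdeg he
  obtain ⟨r, hr, hr1⟩ := hv n e hdeg fun i => h.lt_one_iff_lt_one.1 (he i)
  exact ⟨r, hr, h.lt_one_iff_lt_one.2 hr1⟩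

theorem HenselRoots.comap_of_isAlgClosedIn {F : Type*} [Field F] [Algebra F K]
    {v : Valuation K Γ} (hv : HenselRoots v)
    (hF : ∀ z : K, IsAlgebraic F z → ∃ c : F, algebraMap F K c = z) :
    HenselRoots (v.comap (algebraMap F K)) := by
  intro n e hdeg he
  obtain ⟨r, hr, hr1⟩ := hv n (e.map (algebraMap F K)) ((degree_map_le).trans_lt hdeg)
    (fun i => by rw [coeff_map]; exact he i)
  have hmap : X ^ (n + 1) - X ^ n + e.map (algebraMap F K) =
      (X ^ (n + 1) - X ^ n + e).map (algebraMap F K) := by simp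
  have hne : X ^ (n + 1) - X ^ n + e ≠ 0 := by
    intro h
    have h1 := congrArg (fun q => v (algebraMap F K (coeff q (n + 1)))) h
    have h2 : e.coeff (n + 1) = 0 := coeff_eq_zero_of_degree_lt hdeg
    simp [coeff_X_pow, h2] at h1
  rw [hmap] at hr
  obtain ⟨c, rfl⟩ := hF r ⟨_, hne, by rwa [aeval_def, ← eval_map]⟩
  refine ⟨c, ?_, ?_⟩
  · rw [eval_map_apply] at hr
    exact (algebraMap F K).injective (by rw [hr, map_zero])
  · rwa [Valuation.comap_apply, map_sub, map_one]

/-- A field has a maximal subfield contained in a given valuation ring. -/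
theorem exists_maximal_le_valuationSubring (C : Type*) [Field C] [Algebra C K]
    (A : ValuationSubring K) (hC : ∀ c : C, algebraMap C K c ∈ A) :
    ∃ F : IntermediateField C K, Maximal (fun F : IntermediateField C K => ∀ z ∈ F, z ∈ A) F := by
  obtain ⟨N, -, hN⟩ := zorn_le_nonempty₀ {N : IntermediateField C K | ∀ z ∈ N, z ∈ A}
    (fun c hc hchain N hN => by
      refine ⟨sSup c, ?_, fun z hz => le_sSup hz⟩
      intro z hz
      have : Nonempty c := ⟨⟨N, hN⟩⟩
      rw [sSup_eq_iSup', ← SetLike.mem_coe, IntermediateField.coe_iSup_of_directed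
        hchain.directed] at hz
      obtain ⟨M, hzM⟩ := Set.mem_iUnion.1 hz
      exact hc M.2 z hzM) ⊥ (by
      intro z hz
      obtain ⟨c, rfl⟩ := IntermediateField.mem_bot.1 hz
      exact hC c)
  exact ⟨N, hN⟩

end Coarsening

end Paper

namespace Paper

section MaximalTrivial

open Polynomial

variable {C K : Type*} [Field C] [Field K] [Algebra C K] {A : ValuationSubring K}
  {F : IntermediateField C K}

theorem valuation_eq_one_of_le_valuationSubring (hF : ∀ z ∈ F, z ∈ A) {m : K} (hm : m ∈ F)
    (h0 : m ≠ 0) : A.valuation m = 1 := by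
  refine le_antisymm ((A.valuation_le_one_iff m).2 (hF m hm)) ?_
  have := (A.valuation_le_one_iff _).2 (hF m⁻¹ (F.inv_mem hm))
  rw [map_inv₀] at this
  exact (inv_le_one₀ (zero_lt_iff.2 ((Valuation.ne_zero_iff _).2 h0))).1 this

theorem mem_of_adjoin_le_valuationSubring
    (hF : Maximal (fun F : IntermediateField C K => ∀ z ∈ F, z ∈ A) F) {z : K}
    (hz : ∀ y ∈ IntermediateField.adjoin F {z}, y ∈ A) : z ∈ F := by
  have hle : F ≤ (IntermediateField.adjoin F {z}).restrictScalars C := fun y hy =>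
    IntermediateField.algebraMap_mem (IntermediateField.adjoin F {z}) (⟨y, hy⟩ : F)
  exact hF.2 hz hle (IntermediateField.mem_adjoin_simple_self F z)

theorem mem_of_isAlgebraic_of_maximal
    (hF : Maximal (fun F : IntermediateField C K => ∀ z ∈ F, z ∈ A) F) {z : K}
    (hz : IsAlgebraic F z) : z ∈ F := by
  refine mem_of_adjoin_le_valuationSubring hF fun y hy => ?_
  rcases eq_or_ne y 0 with rfl | hy0
  · exact A.zero_mem
  have : Algebra.IsAlgebraic F (IntermediateField.adjoin F {z}) :=
    IntermediateField.isAlgebraic_adjoin_simple hz.isIntegral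
  have hya : IsAlgebraic F y :=
    (Algebra.IsAlgebraic.isAlgebraic (R := F) (⟨y, hy⟩ : IntermediateField.adjoin F {z})).algebraMap
  rw [← A.valuation_le_one_iff]
  exact (valuation_eq_one_of_isAlgebraic (F := F) (v := A.valuation) (fun m hm =>
    valuation_eq_one_of_le_valuationSubring hF.1 m.2 (by simpa using hm)) hy0 hya).le

theorem exists_sub_lt_one_of_maximal [CharZero K] {Ω : Type*} [Field Ω] [Algebra K Ω]
    [IsAlgClosed Ω] [IsGalois K Ω] {Γ : Type*} [LinearOrderedCommGroupWithZero Γ]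
    {W : Valuation Ω Γ} (hinv : ∀ (σ : Ω ≃ₐ[K] Ω) (x : Ω), W (σ x) = W x)
    (hWA : (W.comap (algebraMap K Ω)).IsEquiv A.valuation)
    (hF : Maximal (fun F : IntermediateField C K => ∀ z ∈ F, z ∈ A) F) {z : K} (hz : z ∈ A) :
    ∃ c ∈ F, A.valuation (z - c) < 1 := by
  classical
  have hmem : ∀ g : Polynomial F, aeval z g ∈ A := fun g => by
    rw [aeval_eq_sum_range]
    refine sum_mem fun i _ => ?_
    rw [Algebra.smul_def]
    exact mul_mem (hF.1 _ (g.coeff i).2) (pow_mem hz i)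
  by_cases hall : ∀ g : Polynomial F, g ≠ 0 → A.valuation (aeval z g) = 1
  · refine ⟨z, mem_of_adjoin_le_valuationSubring hF fun y hy => ?_, by simp⟩
    obtain ⟨r, s, rfl⟩ := (IntermediateField.mem_adjoin_simple_iff F y).1 hy
    rcases eq_or_ne s 0 with rfl | hs
    · simp [A.zero_mem]
    rw [← A.valuation_le_one_iff, map_div₀, hall s hs, div_one]
    exact (A.valuation_le_one_iff _).2 (hmem r)
  · push Not at hall
    have hex : ∃ n, ∃ g : Polynomial F, g.natDegree = n ∧ g ≠ 0 ∧ A.valuation (aeval z g) ≠ 1 := by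
      obtain ⟨g, hg0, hg⟩ := hall
      exact ⟨_, g, rfl, hg0, hg⟩
    obtain ⟨g, hgn, hg0, hg⟩ := Nat.find_spec hex
    have hmin : ∀ q : Polynomial F, q ≠ 0 → q.natDegree < g.natDegree →
        A.valuation (aeval z q) = 1 := by
      intro q hq hqd
      by_contra hcon
      exact Nat.find_min hex (hqd.trans_eq hgn) ⟨q, rfl, hq, hcon⟩
    have hd : g.natDegree ≠ 0 := by
      intro h
      rw [eq_C_of_natDegree_eq_zero h] at hg hg0
      rw [aeval_C] at hg
      exact hg (valuation_eq_one_of_le_valuationSubring hF.1 (g.coeff 0).2 (by simpa using hg0))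
    have hg' : derivative g ≠ 0 := fun h => hd (derivative_eq_zero.1 h)
    have h1 : A.valuation (aeval z (derivative g)) = 1 :=
      hmin _ hg' (natDegree_derivative_lt hd)
    have h0 : A.valuation (aeval z g) < 1 :=
      lt_of_le_of_ne ((A.valuation_le_one_iff _).2 (hmem g)) hg
    have hev : ∀ q : Polynomial F, (q.map (algebraMap F K)).eval z = aeval z q := fun q => by
      rw [aeval_def, ← eval_map]
    have h1' : ∀ {y : K}, A.valuation y = 1 → W (algebraMap K Ω y) = 1 := fun {y} hy =>
      hWA.eq_one_iff_eq_one.2 hy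
    obtain ⟨r, hr, hr1⟩ := exists_root_near_of_invariant W hinv (g.map (algebraMap F K)) (z := z)
      (fun i => hWA.le_one_iff_le_one.2 ((A.valuation_le_one_iff _).2 (by
        rw [coeff_map]; exact hF.1 _ (g.coeff i).2)))
      (hWA.le_one_iff_le_one.2 ((A.valuation_le_one_iff _).2 hz))
      (hWA.lt_one_iff_lt_one.2 (by rwa [hev]))
      (h1' (by rwa [derivative_map, hev]))
    refine ⟨r, mem_of_isAlgebraic_of_maximal hF ⟨g, hg0, by rwa [aeval_def, ← eval_map]⟩, ?_⟩
    rw [Valuation.map_sub_swap]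
    exact hWA.lt_one_iff_lt_one.1 hr1

end MaximalTrivial

end Paper

namespace Paper

section Final

open Polynomial

/-- The valued field `K` retracts locally onto a subfield on which inverting `π` kills the
valuation. -/
theorem exists_intermediateField_retraction {C K : Type*} [Field C] [Field K] [CharZero K]
    [Algebra C K] {Γ : Type*} [LinearOrderedCommGroupWithZero Γ] {v : Valuation K Γ}
    (hv : HenselRoots v) (p : ℕ) (hp0 : (p : K) ≠ 0) (hp : v (p : K) < 1)
    (hC : ∀ c : C, ∃ n : ℕ, v (p : K) ^ n * v (algebraMap C K c) ≤ 1) :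
    ∃ F : IntermediateField C K, (∀ z ∈ F, ∃ n : ℕ, v (p : K) ^ n * v z ≤ 1) ∧
      ∀ S : Finset K, Nonempty (Algebra.adjoin F (S : Set K) →ₐ[F] F) := by
  let A := coarsening v (p : K) hp.le
  let Ω := AlgebraicClosure K
  obtain ⟨F, hF⟩ := exists_maximal_le_valuationSubring C A hC
  obtain ⟨B, hB⟩ := exists_valuation_comap_isEquiv A Ω
  have hAv : HenselRoots A.valuation := hv.coarsening hp0
  have hinv : ∀ (σ : Ω ≃ₐ[K] Ω) (x : Ω), B.valuation (σ x) = B.valuation x :=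
    invariant_of_henselRoots B.valuation (hAv.of_isEquiv hB)
  have htriv : ∀ m : F, m ≠ 0 → B.valuation (algebraMap F Ω m) = 1 := fun m hm => by
    rw [IsScalarTower.algebraMap_apply F K Ω]
    exact hB.eq_one_iff_eq_one.2
      (valuation_eq_one_of_le_valuationSubring hF.1 m.2 (by simpa using hm))
  have hvp : 0 < v (p : K) := zero_lt_iff.2 ((Valuation.ne_zero_iff _).2 hp0)
  refine ⟨F, hF.1, fun S => ?_⟩
  refine exists_algHom_adjoin_of_sameResidue (F := F) (Ω := Ω) (v := B.valuation)
    (μ := v.comap (algebraMap F K)) (π := (p : F)) hinv ?_ ?_ htriv ?_ ?_ ?_ ?_ S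
  · intro n hn
    have := htriv (n : F) (by exact_mod_cast hn)
    rwa [map_natCast] at this
  · intro z hz
    have hzA : z ∈ A := (A.valuation_le_one_iff z).1 (hB.le_one_iff_le_one.1 hz)
    obtain ⟨c, hc, hcz⟩ := exists_sub_lt_one_of_maximal hinv hB hF hzA
    exact ⟨⟨c, hc⟩, hB.lt_one_iff_lt_one.2 hcz⟩
  · exact hv.comap_of_isAlgClosedIn fun z hz => ⟨⟨z, mem_of_isAlgebraic_of_maximal hF hz⟩, rfl⟩
  · intro h
    apply hp0
    have := congrArg (algebraMap F K) h
    rwa [map_natCast, map_zero] at this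
  · rw [Valuation.comap_apply, map_natCast]
    exact hp
  · intro a ha
    have ha' : (a : K) ≠ 0 := by simpa using ha
    obtain ⟨n, hn⟩ := hF.1 _ (F.inv_mem a.2)
    refine ⟨n + 1, ?_⟩
    rw [Valuation.comap_apply, Valuation.comap_apply, map_natCast]
    change v (p : K) ^ (n + 1) < v (a : K)
    have hva : 0 < v (a : K) := zero_lt_iff.2 ((Valuation.ne_zero_iff _).2 ha')
    rw [map_inv₀, mul_inv_le_iff₀ hva, one_mul] at hn
    refine lt_of_lt_of_le ?_ hn
    rw [pow_succ]
    exact mul_lt_of_lt_one_right (pow_pos hvp n) hp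

/-- In a field with uniformizer `π`, a solution of `Y ^ 2 - Y = π a ^ 2` forces `a` to be
integral. -/
theorem IsUniformizer.le_one_of_sq_sub_eq {L : Type*} [Field L] {Γ : Type*}
    [LinearOrderedCommGroupWithZero Γ] {w : Valuation L Γ} {π : L} (hπ : IsUniformizer w π)
    {a y : L} (h : y ^ 2 - y = π * a ^ 2) : w a ≤ 1 := by
  obtain ⟨h0, h1, hmin⟩ := hπ
  by_contra! ha
  have ha0 : 0 < w a := zero_lt_one.trans ha
  have ha' : a ≠ 0 := (Valuation.ne_zero_iff w).1 ha0.ne'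
  have hinv : 1 ≤ w π * w a := by
    have := hmin a⁻¹ (by rw [map_inv₀]; exact inv_lt_one_of_one_lt₀ ha)
    rwa [map_inv₀, inv_le_iff_one_le_mul₀ ha0] at this
  have hbig : 1 < w (y ^ 2 - y) := by
    rw [h, map_mul, map_pow, sq, ← mul_assoc]
    exact ha.trans_le (le_mul_of_one_le_left zero_le hinv)
  have hy : 1 < w y := by
    by_contra! hy
    refine hbig.not_ge ((w.map_sub _ _).trans (max_le ?_ hy))
    rw [map_pow]
    exact pow_le_one₀ zero_le hy
  have hy2 : w (y ^ 2 - y) = w y ^ 2 := by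
    rw [← map_pow]
    refine Valuation.map_sub_eq_of_lt_left _ ?_
    rw [map_pow]
    exact lt_self_pow₀ hy one_lt_two
  rw [h] at hy2
  have hsq : w (y / a) ^ 2 = w π := by
    rw [map_div₀, div_pow, ← hy2, map_mul, map_pow, mul_div_cancel_right₀ _ (pow_ne_zero _ ha0.ne')]
  have hlt : w (y / a) < 1 := by
    by_contra! hge
    exact h1.not_ge (hsq ▸ one_le_pow₀ hge)
  have hle := hmin _ hlt
  have : w π ≤ w π ^ 2 := hsq.symm.le.trans (pow_le_pow_left₀ zero_le hle 2)
  exact (pow_lt_self_of_lt_one₀ h0 h1 one_lt_two).not_ge this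

theorem IsHenselian.exists_sq_sub_eq {K : Type*} [Field K] {Γ : Type*}
    [LinearOrderedCommGroupWithZero Γ] {v : Valuation K Γ} (hv : IsHenselian v) {b : K}
    (hb : v b < 1) : ∃ y : K, y ^ 2 - y = b := by
  obtain ⟨y, hy⟩ := exists_root_of_integral_coeff hv (X ^ 2 - X - C b) (fun j => by
      rw [coeff_sub, coeff_sub, coeff_X_pow, coeff_X, coeff_C]
      refine (v.map_sub _ _).trans (max_le ((v.map_sub _ _).trans (max_le ?_ ?_)) ?_)
      · split_ifs <;> simp
      · split_ifs <;> simp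
      · split_ifs
        · exact hb.le
        · simp)
    (by simpa using hb) (by simp [coeff_X_pow])
  exact ⟨y, by simpa [sub_eq_zero] using hy⟩

/-- Homomorphisms between henselian fields with uniformizer `p` respect integrality, when defined
on sufficiently many elements. -/
theorem exists_finset_mem_Oset_iff (p : ℕ) {C K L : Type*} [Field C] [Field K] [Field L]
    [Algebra C K] [Algebra C L] {Γ Γ' : Type*} [LinearOrderedCommGroupWithZero Γ]
    [LinearOrderedCommGroupWithZero Γ'] {v : Valuation K Γ} {w : Valuation L Γ'}
    (hv : IsHenselian v) (hπv : IsUniformizer v (p : K)) (hπw : IsUniformizer w (p : L)) (a : K) :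
    ∃ S : Finset K, ∀ (D : Subalgebra C K) (_ : (S : Set K) ⊆ D) (ρ : D →ₐ[C] L) (ha : a ∈ D),
      a ∈ Oset v ↔ ρ ⟨a, ha⟩ ∈ Oset w := by
  classical
  have hsol : ∀ b : K, v b ≤ 1 → ∃ y : K, y ^ 2 - y = p * b ^ 2 := fun b hb => by
    refine hv.exists_sq_sub_eq ?_
    rw [map_mul, map_pow]
    exact (mul_le_of_le_one_right zero_le (pow_le_one₀ zero_le hb)).trans_lt hπv.2.1
  have htrans : ∀ (b y : K) (_ : y ^ 2 - y = p * b ^ 2) (D : Subalgebra C K) (_ : y ∈ D)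
      (hb : b ∈ D) (ρ : D →ₐ[C] L), w (ρ ⟨b, hb⟩) ≤ 1 := by
    intro b y hy D hyD hb ρ
    refine hπw.le_one_of_sq_sub_eq (y := ρ ⟨y, hyD⟩) ?_
    rw [← map_pow, ← map_sub, ← map_natCast ρ, ← map_pow, ← map_mul]
    exact congrArg ρ (Subtype.ext hy)
  by_cases ha : v a ≤ 1
  · obtain ⟨y, hy⟩ := hsol a ha
    refine ⟨{y}, fun D hD ρ haD => iff_of_true ha (htrans a y hy D (hD (by simp)) haD ρ)⟩
  · have hp0 : (p : K) ≠ 0 := (Valuation.ne_zero_iff v).1 hπv.1.ne'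
    have ha1 : 1 < v a := not_le.1 ha
    have ha0 : a ≠ 0 := (Valuation.ne_zero_iff v).1 (zero_lt_one.trans ha1).ne'
    have hb : v (a⁻¹ / p) ≤ 1 := by
      rw [map_div₀, div_le_one₀ hπv.1]
      refine hπv.2.2 _ ?_
      rw [map_inv₀]
      exact inv_lt_one_of_one_lt₀ ha1
    obtain ⟨y, hy⟩ := hsol _ hb
    refine ⟨{a⁻¹ / p, y}, fun D hD ρ haD => iff_of_false ha ?_⟩
    have hbD : a⁻¹ / p ∈ D := hD (by simp)
    have h1 := htrans _ y hy D (hD (by simp)) hbD ρ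
    have h2 : ρ ⟨a⁻¹ / p, hbD⟩ * p * ρ ⟨a, haD⟩ = 1 := by
      rw [← map_natCast ρ, ← map_mul, ← map_mul, ← map_one ρ]
      refine congrArg ρ (Subtype.ext ?_)
      change a⁻¹ / p * p * a = 1
      field_simp
    have h3 := congrArg w h2
    rw [map_mul, map_mul, map_one] at h3
    intro hw
    have : w (ρ ⟨a⁻¹ / p, hbD⟩) * w (p : L) * w (ρ ⟨a, haD⟩) < 1 :=
      (mul_le_of_le_one_right zero_le hw).trans_lt
        ((mul_le_of_le_one_left zero_le h1).trans_lt hπw.2.1)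
    exact this.ne h3

end Final

end Paper

namespace Paper

theorem exists_algHom_adjoin_of_algebra {C F K : Type*} [Field C] [Field K] [Field F]
    [Algebra C K] [Algebra C F] [Algebra F K] [IsScalarTower C F K] (S : Finset K)
    (hret : Nonempty (Algebra.adjoin F (S : Set K) →ₐ[F] F)) :
    Nonempty (Algebra.adjoin C (S : Set K) →ₐ[C] F) := by
  obtain ⟨ρ⟩ := hret
  have hle : Algebra.adjoin C (S : Set K) ≤ (Algebra.adjoin F (S : Set K)).restrictScalars C :=
    Algebra.adjoin_le_iff.2 fun x hx => by
      have h : x ∈ Algebra.adjoin F (S : Set K) := Algebra.subset_adjoin hx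
      exact h
  exact ⟨(ρ.restrictScalars C).comp (Subalgebra.inclusion hle)⟩

theorem exists_algHom_adjoin_of_injective {C F K L : Type*} [Field C] [Field K] [Field F]
    [Field L] [Algebra C K] [Algebra C F] [Algebra C L] (ι : F →ₐ[C] K) (T : Finset F)
    (hL : ∀ T : Finset K, (∀ z ∈ T, z ∈ ι.range) →
      Nonempty (Algebra.adjoin C (T : Set K) →ₐ[C] L)) :
    Nonempty (Algebra.adjoin C (T : Set F) →ₐ[C] L) := by
  classical
  let g : Algebra.adjoin C (T : Set F) →ₐ[C] K := ι.comp (Algebra.adjoin C (T : Set F)).val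
  have hg : ∀ x, g x ∈ Algebra.adjoin C ((T.image ι : Finset K) : Set K) := fun x => by
    rw [Finset.coe_image, ← AlgHom.map_adjoin]
    exact ⟨x, x.2, rfl⟩
  obtain ⟨τ⟩ := hL (T.image ι) fun z hz => by
    obtain ⟨y, -, rfl⟩ := Finset.mem_image.1 hz
    exact ⟨y, rfl⟩
  exact ⟨τ.comp (g.codRestrict _ hg)⟩

/-- Homomorphisms from finitely generated subalgebras of `K` to `L`, obtained by retracting to
an intermediate field. -/
theorem exists_algHom_adjoin_of_retraction {C K L : Type*} [Field C] [Field K] [Field L]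
    [Algebra C K] [Algebra C L] (F : IntermediateField C K) (S : Finset K)
    (hret : Nonempty (Algebra.adjoin F (S : Set K) →ₐ[F] F))
    (hL : ∀ T : Finset K, (∀ z ∈ T, z ∈ F) →
      Nonempty (Algebra.adjoin C (T : Set K) →ₐ[C] L)) :
    Nonempty (Algebra.adjoin C (S : Set K) →ₐ[C] L) := by
  obtain ⟨f⟩ := exists_algHom_adjoin_of_algebra (C := C) S hret
  exact exists_algHom_adjoin_trans S f fun T =>
    exists_algHom_adjoin_of_injective F.val T fun T hT => hL T (by simpa using hT)

end Paper

namespace Paper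

/-- Proposition `prop:main_mixed_characteristic` of the paper.
Let `(C, u)` be a `ℤ`-valued field of mixed characteristic with uniformizer `p = char(Cu)`
(i.e. unramified), and let `(K, v)`, `(L, w)` be henselian extensions of `(C, u)` in which `p`
is still a uniformizer, such that `Kv/Cu` is separable.  If `Th_∃(Kv, Cu) ⊆ Th_∃(Lw, Cu)`,
then `Th_∃(K, v, C) ⊆ Th_∃(L, w, C)`. -/
theorem statement4 (p : ℕ) (hp : p.Prime)
    (C : Type u) [Field C] (u : Valuation C Zm0) (hZ : Function.Surjective u)
    (hchar0 : ringChar C = 0) (hcharp : ringChar (ResF u) = p)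
    (hπu : IsUniformizer u (p : C))
    (K : Type u) [Field K] [Algebra C K]
    (ΓK : Type u) [LinearOrderedCommGroupWithZero ΓK] (v : Valuation K ΓK)
    (hKC : (v.comap (algebraMap C K)).IsEquiv u)
    (hKhens : IsHenselian v) (hπv : IsUniformizer v (p : K))
    (L : Type u) [Field L] [Algebra C L]
    (ΓL : Type u) [LinearOrderedCommGroupWithZero ΓL] (w : Valuation L ΓL)
    (hLC : (w.comap (algebraMap C L)).IsEquiv u)
    (hLhens : IsHenselian w) (hπw : IsUniformizer w (p : L))
    -- the residue extensions; only `Kv/Cu` is assumed separable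
    (gK : ResF u →+* ResF v) (hgK : ResCompat u v gK) (hsepK : IsSepExtHom gK)
    (gL : ResF u →+* ResF w) (hgL : ResCompat u w gL)
    -- `Th_∃(Kv, Cu) ⊆ Th_∃(Lw, Cu)`
    (hres : ThRingSub (fun {k} φ => IsExists φ) (ResF v) gK (ResF w) gL) :
    -- `Th_∃(K, v, C) ⊆ Th_∃(L, w, C)`
    ThValSub (fun {k} φ => IsExists φ) K (Oset v) (algebraMap C K)
      L (Oset w) (algebraMap C L) := by
  have hC0 : CharZero C := by
    have : CharP C 0 := by
      rw [← hchar0]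
      infer_instance
    exact CharP.charP_to_charZero C
  have hK0 : CharZero K := charZero_of_injective_algebraMap (algebraMap C K).injective
  have hp0 : (p : K) ≠ 0 := by exact_mod_cast hp.ne_zero
  obtain ⟨F, hF, hret⟩ := exists_intermediateField_retraction (C := C) hKhens.henselRoots p hp0
    hπv.2.1 fun c => by
      rcases eq_or_ne c 0 with rfl | hc
      · exact ⟨0, by simp⟩
      have hc0 : u c ≠ 0 := (Valuation.ne_zero_iff _).2 hc
      obtain ⟨n, hn⟩ := exists_pow_lt₀ hπu.2.1 (Units.mk0 (u c)⁻¹ (inv_ne_zero hc0))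
      refine ⟨n, ?_⟩
      have hle : u ((p : C) ^ n * c) ≤ 1 := by
        rw [map_mul, map_pow, ← le_mul_inv_iff₀ (zero_lt_iff.2 hc0), one_mul]
        exact hn.le
      have := hKC.le_one_iff_le_one.2 hle
      simpa using this
  exact thValSub_of_algHom (Oset v) (Oset w) (exists_finset_mem_Oset_iff p hKhens hπv hπw)
    fun S => exists_algHom_adjoin_of_retraction F S (hret S)
      (exists_algHom_of_residue p C u hchar0 hπu K ΓK v hKC hπv L ΓL w hLC hLhens hπw
        gK hgK hsepK gL hgL hres F hF)

end Paper
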